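/- arXiv:0709.2704 — 2 statements merged into one kernel-verified Lean document; each statement's English description precedes it below -/
import Mathlib

section
/- There is an absolute constant C such that for all sufficiently large n, for every nonprincipal Dirichlet character χ modulo 2^n, every integer t, and every integer N with 2^{n^{3/4}·ln n} ≤ N ≤ 2^n, one has | ∑_{k=0}^{N−1} χ(t + k) | ≤ C · N / n². -/
section IwaniecHelpers

open Finset

/-- equal power sums give equal elementary symmetric functions -/
lemma esymm_eq_of_psum_eq {R : Type*} [CommRing R] (d : ℕ) (hu : ∀ k : ℕ, 1 ≤ k → k ≤ d → IsUnit (k : R))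
    (x y : Fin d → R) (h : ∀ j : ℕ, 1 ≤ j → j ≤ d → ∑ i, x i ^ j = ∑ i, y i ^ j) (k : ℕ) (hk : k ≤ d) :
    MvPolynomial.aeval x (MvPolynomial.esymm (Fin d) R k) =
      MvPolynomial.aeval y (MvPolynomial.esymm (Fin d) R k) := by
  induction k using Nat.strong_induction_on with
  | _ k ih =>
    rcases Nat.eq_zero_or_pos k with rfl | hk0
    · simp
    · have key := MvPolynomial.mul_esymm_eq_sum (Fin d) R k
      have hx := congrArg (MvPolynomial.aeval x) key
      have hy := congrArg (MvPolynomial.aeval y) key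
      simp only [map_mul, map_natCast, map_sum, map_pow, map_neg, map_one] at hx hy
      apply (hu k hk0 hk).mul_left_cancel
      rw [hx, hy]
      congr 1
      apply Finset.sum_congr rfl
      intro a ha
      rw [mem_filter, HasAntidiagonal.mem_antidiagonal] at ha
      rw [ih a.1 ha.2 (by omega)]
      congr 1
      simp only [MvPolynomial.psum, map_sum, map_pow, MvPolynomial.aeval_X]
      exact h a.2 (by omega) (by omega)

lemma prod_sub_eq_of_psum_eq {R : Type*} [CommRing R] (d : ℕ) (hu : ∀ k : ℕ, 1 ≤ k → k ≤ d → IsUnit (k : R))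
    (x y : Fin d → R) (h : ∀ j : ℕ, 1 ≤ j → j ≤ d → ∑ i, x i ^ j = ∑ i, y i ^ j) (t : R) :
    ∏ i, (t - x i) = ∏ i, (t - y i) := by
  have H : ∀ z : Fin d → R, ∏ i, (t - z i) = ∑ j ∈ range (d + 1),
      (-1) ^ j * (MvPolynomial.aeval z (MvPolynomial.esymm (Fin d) R j) * t ^ (d - j)) := by
    intro z
    have := Multiset.prod_X_sub_X_eq_sum_esymm ((univ : Finset (Fin d)).val.map z)
    have h2 := congrArg (Polynomial.eval t) this
    simp only [Multiset.map_map, Polynomial.eval_multiset_prod, Polynomial.eval_finsetSum, Function.comp_def] at h2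
    simp only [Polynomial.eval_sub, Polynomial.eval_X, Polynomial.eval_C] at h2
    rw [Finset.prod_eq_multiset_prod, h2]
    simp only [Multiset.card_map, Finset.card_val, Finset.card_univ, Fintype.card_fin]
    apply Finset.sum_congr rfl
    intro j hj
    rw [MvPolynomial.aeval_esymm_eq_multiset_esymm]
    simp
  rw [H, H]
  apply Finset.sum_congr rfl
  intro j hj
  rw [esymm_eq_of_psum_eq d hu x y h j (by simpa [Nat.lt_succ_iff] using hj)]

lemma root_of_psum (p K d : ℕ) (hp : p.Prime) (hdp : d < p) (x y : Fin d → ℤ)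
    (hinj : ∀ i j, i ≠ j → ¬ (p : ℤ) ∣ x i - x j)
    (h : ∀ j : ℕ, 1 ≤ j → j ≤ d → ((p ^ K : ℕ) : ℤ) ∣ ∑ i, x i ^ j - ∑ i, y i ^ j) (k : Fin d) :
    ∃ i, ((p ^ K : ℕ) : ℤ) ∣ y k - x i := by
  have hu : ∀ k : ℕ, 1 ≤ k → k ≤ d → IsUnit (k : ZMod (p ^ K)) := by
    intro k h1 h2
    rw [ZMod.isUnit_iff_coprime]
    apply Nat.Coprime.pow_right
    exact (hp.coprime_iff_not_dvd.2 (fun hd => absurd (Nat.le_of_dvd h1 hd) (by omega))).symm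
  have h' : ∀ j : ℕ, 1 ≤ j → j ≤ d → ∑ i, ((x i : ℤ) : ZMod (p ^ K)) ^ j = ∑ i, ((y i : ℤ) : ZMod (p ^ K)) ^ j := by
    intro j h1 h2
    have := (ZMod.intCast_zmod_eq_zero_iff_dvd _ _).2 (h j h1 h2)
    push_cast at this
    exact sub_eq_zero.1 this
  have e := prod_sub_eq_of_psum_eq d hu _ _ h' ((y k : ℤ) : ZMod (p ^ K))
  have e0 : ∏ i, (((y k : ℤ) : ZMod (p ^ K)) - ((y i : ℤ) : ZMod (p ^ K))) = 0 :=
    Finset.prod_eq_zero (mem_univ k) (sub_self _)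
  rw [e0] at e
  have e1 : ((p ^ K : ℕ) : ℤ) ∣ ∏ i, (y k - x i) := by
    rw [← ZMod.intCast_zmod_eq_zero_iff_dvd]
    push_cast
    exact e
  obtain ⟨i, hi⟩ : ∃ i, ∀ j, j ≠ i → ¬ (p : ℤ) ∣ y k - x j := by
    by_cases hh : ∃ i, (p : ℤ) ∣ y k - x i
    · obtain ⟨i, hi⟩ := hh
      refine ⟨i, fun j hj hd => hinj j i hj ?_⟩
      have := dvd_sub hi hd
      simpa using this
    · push Not at hh
      exact ⟨k, fun j _ => hh j⟩
  refine ⟨i, ?_⟩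
  rw [← Finset.mul_prod_erase _ _ (mem_univ i)] at e1
  refine IsCoprime.dvd_of_dvd_mul_right ?_ e1
  push_cast
  apply IsCoprime.pow_left
  apply IsCoprime.prod_right
  intro j hj
  have hpp : Prime (p : ℤ) := Nat.prime_iff_prime_int.1 hp
  exact (Prime.coprime_iff_not_dvd hpp).2 (hi j (ne_of_mem_erase hj))

lemma linnik_count (p r d X : ℕ) (hp : p.Prime) (hdp : d < p) (hX : X ≤ p ^ (r * d)) (c : ℤ) (lam : ℕ → ℤ) :
    #{x ∈ Fintype.piFinset (fun _ : Fin d => range X) |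
      (∀ i j, i ≠ j → ¬ (p : ℤ) ∣ (x i : ℤ) - x j) ∧
      ∀ j : ℕ, 1 ≤ j → j ≤ d → ((p ^ (r * j) : ℕ) : ℤ) ∣ ∑ i, ((x i : ℤ) - c) ^ j - lam j}
      ≤ d ^ d * p ^ (r * (d * (d - 1) / 2)) := by
  classical
  set s := {x ∈ Fintype.piFinset (fun _ : Fin d => range X) |
      (∀ i j, i ≠ j → ¬ (p : ℤ) ∣ (x i : ℤ) - x j) ∧
      ∀ j : ℕ, 1 ≤ j → j ≤ d → ((p ^ (r * j) : ℕ) : ℤ) ∣ ∑ i, ((x i : ℤ) - c) ^ j - lam j} with hs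
  let f : (Fin d → ℕ) → ((j : Fin d) → ZMod (p ^ (r * (d - 1 - j)))) := fun x j =>
    (((∑ i, ((x i : ℤ) - c) ^ ((j : ℕ) + 1) - lam (j + 1)) / ((p ^ (r * (j + 1)) : ℕ) : ℤ) : ℤ) : ZMod _)
  haveI : ∀ j : Fin d, NeZero (p ^ (r * (d - 1 - j))) := fun j => ⟨pow_ne_zero _ hp.ne_zero⟩
  have h1 := Finset.card_le_mul_card_image (f := f) s (d ^ d) (by
    intro a ha
    obtain ⟨x0, hx0, rfl⟩ := mem_image.1 ha
    rw [hs, mem_filter] at hx0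
    obtain ⟨hx0m, hx0i, hx0c⟩ := hx0
    have : {x ∈ s | f x = f x0} ⊆ Fintype.piFinset (fun _ : Fin d => univ.image x0) := by
      intro x hx
      rw [mem_filter, hs, mem_filter] at hx
      obtain ⟨⟨hxm, hxi, hxc⟩, hxf⟩ := hx
      rw [Fintype.mem_piFinset]
      intro k
      obtain ⟨i, hi⟩ := root_of_psum p (r * d) d hp hdp (fun i => (x0 i : ℤ) - c) (fun i => (x i : ℤ) - c)
        (by intro i j hij; simpa using hx0i i j hij) (by
          intro j hj1 hj2
          obtain ⟨j, rfl⟩ : ∃ j', j = j' + 1 := ⟨j - 1, by omega⟩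
          have hfj := congrFun hxf ⟨j, by omega⟩
          simp only [f] at hfj
          rw [ZMod.intCast_eq_intCast_iff_dvd_sub] at hfj
          obtain ⟨u, hu⟩ := hx0c (j + 1) hj1 hj2
          obtain ⟨v, hv⟩ := hxc (j + 1) hj1 hj2
          have hne : ((p ^ (r * (j + 1)) : ℕ) : ℤ) ≠ 0 := by
            exact_mod_cast pow_ne_zero _ hp.ne_zero
          rw [hu, hv, Int.mul_ediv_cancel_left _ hne, Int.mul_ediv_cancel_left _ hne] at hfj
          have e : ∑ i, ((x0 i : ℤ) - c) ^ (j + 1) - ∑ i, ((x i : ℤ) - c) ^ (j + 1) =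
            ((p ^ (r * (j + 1)) : ℕ) : ℤ) * (u - v) := by linear_combination hu - hv
          rw [e]
          have e2 : p ^ (r * d) = p ^ (r * (j + 1)) * p ^ (r * (d - 1 - j)) := by
            rw [← pow_add, ← mul_add]; congr 2; omega
          rw [e2, Nat.cast_mul]
          exact mul_dvd_mul_left _ hfj) k
      rw [mem_image]
      refine ⟨i, mem_univ _, ?_⟩
      have a1 := mem_range.1 (Fintype.mem_piFinset.1 hxm k)
      have a2 := mem_range.1 (Fintype.mem_piFinset.1 hx0m i)
      have hi' : ((p ^ (r * d) : ℕ) : ℤ) ∣ (x k : ℤ) - x0 i := by simpa using hi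
      have := Int.eq_zero_of_abs_lt_dvd hi' (by rw [abs_lt]; constructor <;> omega)
      omega
    refine (card_le_card this).trans ?_
    rw [Fintype.card_piFinset]
    simp only [prod_const, card_univ, Fintype.card_fin]
    exact Nat.pow_le_pow_left (card_image_le.trans (by simp)) _)
  refine h1.trans (Nat.mul_le_mul_left _ ?_)
  refine (card_le_univ _).trans ?_
  rw [Fintype.card_pi]
  simp only [ZMod.card]
  rw [Finset.prod_pow_eq_pow_sum, ← Finset.mul_sum, Fin.sum_univ_eq_sum_range (fun j => d - 1 - j) d,
    Finset.sum_range_reflect (fun j => j) d, Finset.sum_range_id]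


lemma corr_le {κ V : Type*} [AddCommGroup V] [DecidableEq V] (s : Finset κ) (h : κ → V) (v : V) :
    #{z ∈ s ×ˢ s | h z.1 = h z.2 + v} ≤ #{z ∈ s ×ˢ s | h z.1 = h z.2} := by
  classical
  set ρ : V → ℕ := fun w => #{k ∈ s | h k = w} with hρ
  set W := s.image h with hW
  have key : ∀ v : V, #{z ∈ s ×ˢ s | h z.1 = h z.2 + v} = ∑ w ∈ W, ρ w * ρ (w - v) := by
    intro v
    rw [Finset.card_eq_sum_card_fiberwise (f := fun z => h z.1) (t := W)]
    · apply Finset.sum_congr rfl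
      intro w hw
      rw [hρ]
      simp only
      rw [← Finset.card_product]
      congr 1
      ext z
      simp only [mem_filter, mem_product]
      constructor
      · rintro ⟨⟨⟨h1, h2⟩, h3⟩, h4⟩
        exact ⟨⟨h1, h4⟩, h2, by rw [← h4, h3]; abel⟩
      · rintro ⟨⟨h1, h4⟩, h2, h3⟩
        exact ⟨⟨⟨h1, h2⟩, by rw [h4, h3]; abel⟩, h4⟩
    · intro z hz
      simp only [coe_filter, mem_product, Set.mem_ofPred_eq] at hz
      exact mem_coe.2 (mem_image_of_mem h hz.1.1)
  have k0 : #{z ∈ s ×ˢ s | h z.1 = h z.2} = ∑ w ∈ W, ρ w * ρ w := by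
    have := key 0
    simpa using this
  rw [key v, k0]
  have hz : ∀ w, w ∉ W → ρ w = 0 := by
    intro w hw
    rw [hρ]
    simp only [card_eq_zero, filter_eq_empty_iff]
    intro k hk hkw
    exact hw (hkw ▸ mem_image_of_mem h hk)
  have h2 : ∑ w ∈ W, ρ (w - v) * ρ (w - v) ≤ ∑ w ∈ W, ρ w * ρ w := by
    calc ∑ w ∈ W, ρ (w - v) * ρ (w - v) = ∑ w ∈ W.image (fun w => w - v), ρ w * ρ w := by
          refine (Finset.sum_image (f := fun w => ρ w * ρ w) (g := fun w => w - v) ?_).symm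
          intro a _ b _ hab
          simpa using hab
      _ = ∑ w ∈ (W.image (fun w => w - v)) with w ∈ W, ρ w * ρ w := by
          rw [Finset.sum_filter_of_ne]
          intro w _ hne
          by_contra hw
          exact hne (by simp [hz w hw])
      _ ≤ ∑ w ∈ W, ρ w * ρ w := by
          apply Finset.sum_le_sum_of_subset
          intro w hw
          exact (mem_filter.1 hw).2
  have h3 : 2 * ∑ w ∈ W, ρ w * ρ (w - v) ≤ ∑ w ∈ W, ρ w * ρ w + ∑ w ∈ W, ρ (w - v) * ρ (w - v) := by
    rw [Finset.mul_sum, ← Finset.sum_add_distrib]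
    apply Finset.sum_le_sum
    intro w _
    nlinarith [two_mul_le_add_sq (ρ w) (ρ (w - v))]
  omega

lemma orth_sq {V Λ κ : Type*} [AddCommGroup V] [Finite V] [Fintype Λ] [DecidableEq V] (e : Λ → AddChar V ℂ) (K : ℕ)
    (orth : ∀ v, ∑ l, e l v = if v = 0 then (K : ℂ) else 0) (s : Finset κ) (g : κ → V) :
    ∑ l, ‖∑ i ∈ s, e l (g i)‖ ^ 2 = K * #{z ∈ s ×ˢ s | g z.1 = g z.2} := by
  have : ((∑ l, ‖∑ i ∈ s, e l (g i)‖ ^ 2 : ℝ) : ℂ) = K * #{z ∈ s ×ˢ s | g z.1 = g z.2} := by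
    push_cast
    have h1 : ∀ l, ((‖∑ i ∈ s, e l (g i)‖ : ℝ) : ℂ) ^ 2 = ∑ z ∈ s ×ˢ s, e l (g z.1 - g z.2) := by
      intro l
      rw [← Complex.mul_conj', map_sum, Finset.sum_mul_sum, Finset.sum_product]
      apply Finset.sum_congr rfl; intro i _
      apply Finset.sum_congr rfl; intro j _
      rw [← AddChar.map_neg_eq_conj, ← AddChar.map_add_eq_mul, sub_eq_add_neg]
    simp_rw [h1]
    rw [Finset.sum_comm]
    simp_rw [orth, sub_eq_zero]
    rw [← Finset.sum_filter, Finset.sum_const, nsmul_eq_mul, mul_comm]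
  exact_mod_cast this

lemma orth_sq_mul {V Λ κ κ' : Type*} [AddCommGroup V] [Finite V] [Fintype Λ] [DecidableEq V] (e : Λ → AddChar V ℂ)
    (K : ℕ) (orth : ∀ v, ∑ l, e l v = if v = 0 then (K : ℂ) else 0) (s : Finset κ) (g : κ → V)
    (t : Finset κ') (h : κ' → V) (cong : κ × κ → Prop) [DecidablePred cong]
    (hc : ∀ z ∈ s ×ˢ s, ∀ w ∈ t ×ˢ t, g z.1 + h w.1 = g z.2 + h w.2 → cong z) :
    ∑ l, ‖∑ i ∈ s, e l (g i)‖ ^ 2 * ‖∑ i ∈ t, e l (h i)‖ ^ 2 ≤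
      K * (#{z ∈ s ×ˢ s | cong z} * #{w ∈ t ×ˢ t | h w.1 = h w.2} : ℕ) := by
  classical
  have h1 : ∀ l, ‖∑ i ∈ s, e l (g i)‖ ^ 2 * ‖∑ i ∈ t, e l (h i)‖ ^ 2 =
      ‖∑ i ∈ s ×ˢ t, e l (g i.1 + h i.2)‖ ^ 2 := by
    intro l
    rw [← mul_pow, ← norm_mul, Finset.sum_mul_sum, Finset.sum_product]
    simp_rw [AddChar.map_add_eq_mul]
  simp_rw [h1]
  rw [orth_sq e K orth (s ×ˢ t) (fun i => g i.1 + h i.2)]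
  gcongr
  have h2 := Finset.card_le_mul_card_image_of_maps_to
    (s := {z ∈ (s ×ˢ t) ×ˢ (s ×ˢ t) | g z.1.1 + h z.1.2 = g z.2.1 + h z.2.2})
    (t := {z ∈ s ×ˢ s | cong z}) (f := fun z => (z.1.1, z.2.1)) (by
      intro z hz
      simp only [mem_filter, mem_product] at hz ⊢
      obtain ⟨⟨⟨a1, a2⟩, a3, a4⟩, a5⟩ := hz
      exact ⟨⟨a1, a3⟩, hc (z.1.1, z.2.1) (mem_product.2 ⟨a1, a3⟩) (z.1.2, z.2.2) (mem_product.2 ⟨a2, a4⟩) a5⟩)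
    (#{w ∈ t ×ˢ t | h w.1 = h w.2}) (by
      intro z hz
      refine le_trans ?_ (corr_le t h (g z.2 - g z.1))
      apply Finset.card_le_card_of_injOn (fun x => (x.1.2, x.2.2))
      · intro x hx
        simp only [coe_filter, mem_filter, mem_product, Set.mem_ofPred_eq] at hx ⊢
        obtain ⟨⟨⟨⟨a1, a2⟩, a3, a4⟩, a5⟩, a6⟩ := hx
        refine ⟨⟨a2, a4⟩, ?_⟩
        rw [← a6]
        simp only
        rw [← add_sub_assoc, eq_sub_iff_add_eq, add_comm, a5, add_comm]
      · intro x hx y hy hxy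
        simp only [coe_filter, mem_filter, mem_product, Set.mem_ofPred_eq, Prod.mk.injEq] at hx hy hxy
        have b1 := hx.2.trans hy.2.symm
        simp only [Prod.mk.injEq] at b1
        exact Prod.ext (Prod.ext b1.1 hxy.1) (Prod.ext b1.2 hxy.2))
  rw [mul_comm]
  exact h2

lemma psum_shift {R ι : Type*} [CommRing R] [Fintype ι] (d : ℕ) (x y : ι → R)
    (h : ∀ j : ℕ, 1 ≤ j → j ≤ d → ∑ i, x i ^ j = ∑ i, y i ^ j) (c : R) (j : ℕ) (hj : j ≤ d) :
    ∑ i, (x i - c) ^ j = ∑ i, (y i - c) ^ j := by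
  have H : ∀ z : ι → R, ∑ i, (z i - c) ^ j =
      ∑ m ∈ range (j + 1), (∑ i, z i ^ m) * ((-c) ^ (j - m) * (j.choose m)) := by
    intro z
    simp_rw [sub_eq_add_neg, add_pow, Finset.sum_mul]
    rw [Finset.sum_comm]
    simp_rw [mul_assoc]
  rw [H, H]
  apply Finset.sum_congr rfl
  intro m hm
  rw [mem_range] at hm
  rcases Nat.eq_zero_or_pos m with rfl | h0
  · simp
  · rw [h m h0 (by omega)]

/-- number of solutions of the Vinogradov system of degree `d` with `2b` variables in `A` -/
def vinoCount (d b : ℕ) (A : Finset ℕ) : ℕ :=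
  #{z ∈ Fintype.piFinset (fun _ : Fin b => A) ×ˢ Fintype.piFinset (fun _ : Fin b => A) |
    ∀ j ∈ Icc 1 d, ∑ i, z.1 i ^ j = ∑ i, z.2 i ^ j}

lemma vinoCount_affine (d b a q Y : ℕ) (hq : 0 < q) :
    vinoCount d b ((range Y).image (fun u => a + q * u)) ≤ vinoCount d b (range Y) := by
  unfold vinoCount
  apply Finset.card_le_card_of_injOn (fun z => ((fun i => (z.1 i - a) / q), (fun i => (z.2 i - a) / q)))
  · intro z hz
    simp only [coe_filter, mem_product, Fintype.mem_piFinset, mem_image, mem_range, Set.mem_ofPred_eq, mem_Icc] at hz ⊢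
    obtain ⟨⟨h1, h2⟩, h3⟩ := hz
    choose u hu hu' using h1
    choose v hv hv' using h2
    have e1 : ∀ i, (z.1 i - a) / q = u i := fun i => by
      rw [← hu' i, Nat.add_sub_cancel_left, Nat.mul_div_cancel_left _ hq]
    have e2 : ∀ i, (z.2 i - a) / q = v i := fun i => by
      rw [← hv' i, Nat.add_sub_cancel_left, Nat.mul_div_cancel_left _ hq]
    simp_rw [e1, e2]
    refine ⟨⟨hu, hv⟩, ?_⟩
    intro j hj
    have := psum_shift d (fun i => (z.1 i : ℤ)) (fun i => (z.2 i : ℤ)) (by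
      intro j hj1 hj2
      exact_mod_cast h3 j ⟨hj1, hj2⟩) (a : ℤ) j hj.2
    simp only [← hu', ← hv'] at this
    push_cast at this
    simp only [add_sub_cancel_left, mul_pow, ← Finset.mul_sum] at this
    have hq' : (q : ℤ) ^ j ≠ 0 := pow_ne_zero _ (by exact_mod_cast hq.ne')
    have := mul_left_cancel₀ hq' this
    exact_mod_cast this
  · intro z hz w hw hzw
    simp only [coe_filter, mem_product, Fintype.mem_piFinset, mem_image, mem_range, Set.mem_ofPred_eq] at hz hw
    simp only [Prod.mk.injEq] at hzw
    have aux : ∀ x y : Fin b → ℕ, (∀ i, ∃ u < Y, a + q * u = x i) → (∀ i, ∃ u < Y, a + q * u = y i) →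
        (fun i => (x i - a) / q) = (fun i => (y i - a) / q) → x = y := by
      intro x y hx hy hxy
      funext i
      have := congrFun hxy i
      obtain ⟨u, _, hu⟩ := hx i
      obtain ⟨v, _, hv⟩ := hy i
      simp only [← hu, ← hv, Nat.add_sub_cancel_left, Nat.mul_div_cancel_left _ hq] at this
      rw [← hu, ← hv, this]
    exact Prod.ext (aux _ _ hz.1.1 hw.1.1 hzw.1) (aux _ _ hz.1.2 hw.1.2 hzw.2)

lemma filter_mod_eq (q Y c : ℕ) (hc : c < q) :
    {x ∈ range (q * Y) | x % q = c} = (range Y).image (fun u => c + q * u) := by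
  ext x
  simp only [mem_filter, mem_range, mem_image]
  constructor
  · rintro ⟨h1, h2⟩
    refine ⟨x / q, Nat.div_lt_of_lt_mul h1, ?_⟩
    rw [← h2]; exact Nat.mod_add_div x q
  · rintro ⟨u, hu, rfl⟩
    constructor
    · have : q * (u + 1) ≤ q * Y := Nat.mul_le_mul_left _ hu
      nlinarith
    · rw [Nat.add_mul_mod_self_left, Nat.mod_eq_of_lt hc]

lemma broad_narrow (p d b' : ℕ) (hp : 0 < p) (t : ℕ → ℝ) (ht : ∀ a, 0 ≤ t a) (S : ℝ) (hS0 : 0 ≤ S)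
    (hS : S ≤ ∑ a ∈ range p, t a) :
    S ^ (2 * (b' + d)) ≤ (2 * p) ^ (2 * d) *
      (∑ a ∈ (Fintype.piFinset (fun _ : Fin d => range p)) with Function.Injective a, (∏ i, t (a i)) ^ 2 * S ^ (2 * b'))
      + (2 * d) ^ (2 * (b' + d)) * ∑ a ∈ range p, t a ^ (2 * (b' + d)) := by
  classical
  set A := {a ∈ range p | S ≤ 2 * p * t a} with hA
  have hpR : (0 : ℝ) < p := by exact_mod_cast hp
  have n1 : 0 ≤ (2 * p : ℝ) ^ (2 * d) *
      (∑ a ∈ (Fintype.piFinset (fun _ : Fin d => range p)) with Function.Injective a, (∏ i, t (a i)) ^ 2 * S ^ (2 * b')) := by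
    apply mul_nonneg (by positivity)
    apply Finset.sum_nonneg
    intro a _
    positivity
  have n2 : 0 ≤ (2 * d : ℝ) ^ (2 * (b' + d)) * ∑ a ∈ range p, t a ^ (2 * (b' + d)) := by
    apply mul_nonneg (by positivity)
    apply Finset.sum_nonneg
    intro a _
    exact pow_nonneg (ht a) _
  by_cases hcard : d ≤ #A
  · let f : Fin d → ℕ := A.orderEmbOfCardLe hcard
    have hf : ∀ i, f i ∈ A := fun i => A.orderEmbOfCardLe_mem hcard i
    have hfi : Function.Injective f := (A.orderEmbOfCardLe hcard).injective
    have h1 : S ^ (2 * (b' + d)) ≤ (2 * p : ℝ) ^ (2 * d) * ((∏ i, t (f i)) ^ 2 * S ^ (2 * b')) := by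
      have : S ^ d ≤ (2 * p : ℝ) ^ d * ∏ i, t (f i) := by
        calc S ^ d = ∏ _i : Fin d, S := by simp
          _ ≤ ∏ i : Fin d, (2 * p * t (f i)) := by
            apply Finset.prod_le_prod
            · intros; exact hS0
            · intro i _
              exact (mem_filter.1 (hf i)).2
          _ = _ := by rw [Finset.prod_mul_distrib]; simp
      calc S ^ (2 * (b' + d)) = (S ^ d) ^ 2 * S ^ (2 * b') := by ring
        _ ≤ ((2 * p : ℝ) ^ d * ∏ i, t (f i)) ^ 2 * S ^ (2 * b') := by gcongr
        _ = _ := by ring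
    have h2 : (∏ i, t (f i)) ^ 2 * S ^ (2 * b') ≤ ∑ a ∈ (Fintype.piFinset (fun _ : Fin d => range p)) with Function.Injective a, (∏ i, t (a i)) ^ 2 * S ^ (2 * b') := by
      apply Finset.single_le_sum (f := fun a : Fin d → ℕ => (∏ i, t (a i)) ^ 2 * S ^ (2 * b'))
      · intro a _; positivity
      · rw [mem_filter, Fintype.mem_piFinset]
        exact ⟨fun i => (mem_filter.1 (hf i)).1, hfi⟩
    calc _ ≤ _ := h1
      _ ≤ (2 * p : ℝ) ^ (2 * d) * _ := by gcongr
      _ ≤ _ := le_add_of_nonneg_right n2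
  · push Not at hcard
    obtain ⟨m, hm, hmax⟩ := Finset.exists_max_image (range p) t ⟨0, mem_range.2 hp⟩
    have h1 : ∑ a ∈ range p with ¬ (S ≤ 2 * p * t a), t a ≤ S / 2 := by
      calc _ ≤ ∑ a ∈ range p with ¬ (S ≤ 2 * p * t a), S / (2 * p) := by
            apply Finset.sum_le_sum
            intro a ha
            have := (mem_filter.1 ha).2
            push Not at this
            rw [le_div_iff₀ (by positivity)]
            nlinarith
        _ ≤ p * (S / (2 * p)) := by
            rw [Finset.sum_const, nsmul_eq_mul]
            gcongr
            simpa using card_filter_le (range p) (fun a => ¬ (S ≤ 2 * p * t a))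
        _ = S / 2 := by field_simp
    have h2 : ∑ a ∈ A, t a ≤ d * t m := by
      calc _ ≤ ∑ a ∈ A, t m := Finset.sum_le_sum (fun a ha => hmax a (mem_filter.1 ha).1)
        _ = #A * t m := by rw [Finset.sum_const, nsmul_eq_mul]
        _ ≤ d * t m := by
          have := ht m
          gcongr
    have h3 : S ≤ 2 * d * t m := by
      rw [← Finset.sum_filter_add_sum_filter_not _ (fun a => S ≤ 2 * p * t a)] at hS
      linarith
    calc S ^ (2 * (b' + d)) ≤ (2 * d * t m) ^ (2 * (b' + d)) := by gcongr
      _ = (2 * d : ℝ) ^ (2 * (b' + d)) * t m ^ (2 * (b' + d)) := by rw [mul_pow]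
      _ ≤ (2 * d : ℝ) ^ (2 * (b' + d)) * ∑ a ∈ range p, t a ^ (2 * (b' + d)) := by
        gcongr
        exact Finset.single_le_sum (f := fun a => t a ^ (2 * (b' + d))) (fun a _ => pow_nonneg (ht a) _) hm
      _ ≤ _ := le_add_of_nonneg_left n1


/-- the moment curve modulo `M` -/
def curve (d M : ℕ) (x : ℕ) : Fin d → ZMod M := fun j => (x : ZMod M) ^ ((j : ℕ) + 1)

lemma curve_sum_eq (d M b X : ℕ) {ι : Type*} [Fintype ι] (hb : Fintype.card ι ≤ b) (hX : 1 ≤ X)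
    (hM : b * X ^ d < M) (x y : ι → ℕ) (hx : ∀ i, x i ≤ X) (hy : ∀ i, y i ≤ X) :
    ∑ i, curve d M (x i) = ∑ i, curve d M (y i) ↔ ∀ j ∈ Icc 1 d, ∑ i, x i ^ j = ∑ i, y i ^ j := by
  have bound : ∀ z : ι → ℕ, (∀ i, z i ≤ X) → ∀ j ≤ d, ∑ i, z i ^ j < M := by
    intro z hz j hj
    refine lt_of_le_of_lt ?_ hM
    calc ∑ i, z i ^ j ≤ ∑ _i : ι, X ^ d := by
          apply Finset.sum_le_sum
          intro i _
          exact (Nat.pow_le_pow_left (hz i) j).trans (Nat.pow_le_pow_right hX hj)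
      _ = Fintype.card ι * X ^ d := by simp
      _ ≤ b * X ^ d := Nat.mul_le_mul_right _ hb
  have key : ∀ j ≤ d, (∑ i, (x i : ZMod M) ^ j = ∑ i, (y i : ZMod M) ^ j ↔ ∑ i, x i ^ j = ∑ i, y i ^ j) := by
    intro j hj
    have := ZMod.natCast_eq_natCast_iff' (∑ i, x i ^ j) (∑ i, y i ^ j) M
    push_cast at this
    rw [this, Nat.mod_eq_of_lt (bound x hx j hj), Nat.mod_eq_of_lt (bound y hy j hj)]
  constructor
  · intro h j hj
    rw [mem_Icc] at hj
    have := congrFun h ⟨j - 1, by omega⟩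
    simp only [Finset.sum_apply, curve] at this
    rw [Nat.sub_add_cancel hj.1] at this
    exact (key j hj.2).1 this
  · intro h
    funext j
    simp only [Finset.sum_apply, curve]
    exact (key (j + 1) (by omega)).2 (h (j + 1) (mem_Icc.2 (by omega)))

lemma addChar_map_sum {V ι : Type*} [AddCommGroup V] (ψ : AddChar V ℂ) (s : Finset ι) (f : ι → V) :
    ψ (∑ i ∈ s, f i) = ∏ i ∈ s, ψ (f i) := by
  classical
  induction s using Finset.induction_on with
  | empty => simp
  | insert a s ha ih => rw [Finset.sum_insert ha, Finset.prod_insert ha, AddChar.map_add_eq_mul, ih]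

lemma prod_char_sum {V : Type*} [AddCommGroup V] (ψ : AddChar V ℂ) (b : ℕ) (A : Fin b → Finset ℕ) (φ : ℕ → V) :
    ∏ i, ∑ x ∈ A i, ψ (φ x) = ∑ x ∈ Fintype.piFinset A, ψ (∑ i, φ (x i)) := by
  rw [Finset.prod_univ_sum]
  simp_rw [addChar_map_sum]

lemma norm_pow_char_sum {V : Type*} [AddCommGroup V] (ψ : AddChar V ℂ) (b : ℕ) (A : Finset ℕ) (φ : ℕ → V) :
    ‖∑ x ∈ A, ψ (φ x)‖ ^ (2 * b) = ‖∑ x ∈ Fintype.piFinset (fun _ : Fin b => A), ψ (∑ i, φ (x i))‖ ^ 2 := by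
  rw [← prod_char_sum ψ b (fun _ => A) φ, Finset.prod_const, card_univ, Fintype.card_fin, norm_pow, ← pow_mul, mul_comm]

lemma card_curve_eq_vinoCount (d M b X : ℕ) (hX : 1 ≤ X) (hM : b * X ^ d < M) (A : Finset ℕ) (hA : ∀ x ∈ A, x ≤ X) :
    #{z ∈ Fintype.piFinset (fun _ : Fin b => A) ×ˢ Fintype.piFinset (fun _ : Fin b => A) |
      ∑ i, curve d M (z.1 i) = ∑ i, curve d M (z.2 i)} = vinoCount d b A := by
  unfold vinoCount
  congr 1
  apply Finset.filter_congr
  intro z hz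
  rw [mem_product, Fintype.mem_piFinset, Fintype.mem_piFinset] at hz
  exact curve_sum_eq d M b X (by simp) hX hM z.1 z.2 (fun i => hA _ (hz.1 i)) (fun i => hA _ (hz.2 i))

lemma hoelder_pow (P : ℕ) (hP : 0 < P) (t : ℕ → ℝ) (ht : ∀ a, 0 ≤ t a) (n : ℕ) (hn : 1 ≤ n) :
    P * (∑ c ∈ range P, t c) ^ n ≤ (P : ℝ) ^ n * ∑ c ∈ range P, t c ^ n := by
  obtain ⟨m, rfl⟩ : ∃ m, n = m + 1 := ⟨n - 1, by omega⟩
  have h := pow_sum_div_card_le_sum_pow (s := range P) (f := t) (fun i _ => ht i) m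
  rw [card_range, div_le_iff₀ (by positivity)] at h
  calc (P : ℝ) * (∑ c ∈ range P, t c) ^ (m + 1) ≤ P * ((∑ c ∈ range P, t c ^ (m + 1)) * P ^ m) := by gcongr
    _ = _ := by ring

lemma good_count (p d b' H r c : ℕ) (hp : p.Prime) (hdp : d < p) (hrd : H ≤ r * d) (hc : c < p ^ r) (M : ℕ) [NeZero M]
    (hrH : r ≤ H) (hM : (b' + d) * (p ^ H) ^ d < M) :
    ∑ a ∈ (Fintype.piFinset (fun _ : Fin d => range p)) with Function.Injective a,
      ∑ ψ : AddChar (Fin d → ZMod M) ℂ,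
      (∏ i, ‖∑ x ∈ range (p ^ H) with x % p = a i, ψ (curve d M x)‖) ^ 2 *
        ‖∑ x ∈ range (p ^ H) with x % p ^ r = c, ψ (curve d M x)‖ ^ (2 * b') ≤
      (M ^ d : ℕ) * ((p ^ H) ^ d * (d ^ d * p ^ (r * (d * (d - 1) / 2))) * vinoCount d b' (range (p ^ (H - r))) : ℕ) := by
  classical
  set X := p ^ H with hX
  have hX1 : 1 ≤ X := Nat.one_le_pow _ _ hp.pos
  set cong : (Fin d → ℕ) × (Fin d → ℕ) → Prop := fun z => ∀ j : ℕ, 1 ≤ j → j ≤ d →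
    ((p ^ (r * j) : ℕ) : ℤ) ∣ ∑ i, ((z.1 i : ℤ) - c) ^ j - ∑ i, ((z.2 i : ℤ) - c) ^ j with hcong
  have orth : ∀ v : Fin d → ZMod M, ∑ ψ : AddChar (Fin d → ZMod M) ℂ, (id ψ : AddChar (Fin d → ZMod M) ℂ) v =
      if v = 0 then ((M ^ d : ℕ) : ℂ) else 0 := by
    intro v
    have := AddChar.sum_apply_eq_ite v
    simp only [id]
    rw [this]
    simp
  have hcM : #{z ∈ Fintype.piFinset (fun _ : Fin b' => {x ∈ range X | x % p ^ r = c}) ×ˢ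
      Fintype.piFinset (fun _ : Fin b' => {x ∈ range X | x % p ^ r = c}) |
      ∑ i, curve d M (z.1 i) = ∑ i, curve d M (z.2 i)} ≤ vinoCount d b' (range (p ^ (H - r))) := by
    rw [card_curve_eq_vinoCount d M b' X hX1 (lt_of_le_of_lt (Nat.mul_le_mul_right _ (by omega)) hM) _
      (fun x hx => (mem_range.1 (mem_filter.1 hx).1).le)]
    have : X = p ^ r * p ^ (H - r) := by rw [← pow_add, hX]; congr 1; omega
    rw [this, filter_mod_eq _ _ _ hc]
    exact vinoCount_affine _ _ _ _ _ (pow_pos hp.pos _)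
  have step : ∀ a : Fin d → ℕ, 
      ∑ ψ : AddChar (Fin d → ZMod M) ℂ,
      (∏ i, ‖∑ x ∈ range X with x % p = a i, ψ (curve d M x)‖) ^ 2 *
        ‖∑ x ∈ range X with x % p ^ r = c, ψ (curve d M x)‖ ^ (2 * b') ≤
      (M ^ d : ℕ) * (#{z ∈ Fintype.piFinset (fun i : Fin d => {x ∈ range X | x % p = a i}) ×ˢ
        Fintype.piFinset (fun i : Fin d => {x ∈ range X | x % p = a i}) | cong z} *
          vinoCount d b' (range (p ^ (H - r))) : ℕ) := by
    intro a
    have := orth_sq_mul (V := Fin d → ZMod M) id (M ^ d) orth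
      (Fintype.piFinset (fun i : Fin d => {x ∈ range X | x % p = a i})) (fun x => ∑ i, curve d M (x i))
      (Fintype.piFinset (fun _ : Fin b' => {x ∈ range X | x % p ^ r = c})) (fun x => ∑ i, curve d M (x i))
      cong (by
        intro z hz w hw hzw
        rw [mem_product, Fintype.mem_piFinset, Fintype.mem_piFinset] at hz hw
        have hz1 := fun i => mem_filter.1 (hz.1 i)
        have hz2 := fun i => mem_filter.1 (hz.2 i)
        have hw1 := fun i => mem_filter.1 (hw.1 i)
        have hw2 := fun i => mem_filter.1 (hw.2 i)
        have e := (curve_sum_eq d M (b' + d) X (ι := Fin d ⊕ Fin b') (by simp [add_comm]) hX1 hM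
          (Sum.elim z.1 w.1) (Sum.elim z.2 w.2)
          (by rintro (i | i)
              · exact (mem_range.1 (hz1 i).1).le
              · exact (mem_range.1 (hw1 i).1).le)
          (by rintro (i | i)
              · exact (mem_range.1 (hz2 i).1).le
              · exact (mem_range.1 (hw2 i).1).le)).1 (by
            simpa [Fintype.sum_sum_type] using hzw)
        have e2 := psum_shift d (fun i => ((Sum.elim z.1 w.1 i : ℕ) : ℤ)) (fun i => ((Sum.elim z.2 w.2 i : ℕ) : ℤ))
          (by intro j h1 h2; exact_mod_cast e j (mem_Icc.2 ⟨h1, h2⟩)) (c : ℤ)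
        rw [hcong]
        intro j h1 h2
        have e3 := e2 j h2
        simp only [Fintype.sum_sum_type, Sum.elim_inl, Sum.elim_inr] at e3
        have e4 : ∑ i, ((z.1 i : ℤ) - c) ^ j - ∑ i, ((z.2 i : ℤ) - c) ^ j =
          ∑ i, ((w.2 i : ℤ) - c) ^ j - ∑ i, ((w.1 i : ℤ) - c) ^ j := by linear_combination e3
        rw [e4]
        have dv : ∀ n : ℕ, n % p ^ r = c → ((p ^ (r * j) : ℕ) : ℤ) ∣ ((n : ℤ) - c) ^ j := by
          intro n hn
          rw [pow_mul]
          push_cast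
          apply pow_dvd_pow_of_dvd
          have : ((p ^ r : ℕ) : ℤ) ∣ (n : ℤ) - c := by
            rw [← hn]
            push_cast
            exact Int.dvd_self_sub_emod
          exact_mod_cast this
        exact dvd_sub (Finset.dvd_sum fun i _ => dv _ (hw2 i).2) (Finset.dvd_sum fun i _ => dv _ (hw1 i).2))
    have conv : ∀ ψ : AddChar (Fin d → ZMod M) ℂ,
      (∏ i, ‖∑ x ∈ range X with x % p = a i, ψ (curve d M x)‖) ^ 2 *
        ‖∑ x ∈ range X with x % p ^ r = c, ψ (curve d M x)‖ ^ (2 * b') =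
        ‖∑ x ∈ Fintype.piFinset (fun i : Fin d => {x ∈ range X | x % p = a i}), ψ (∑ i, curve d M (x i))‖ ^ 2 *
        ‖∑ x ∈ Fintype.piFinset (fun _ : Fin b' => {x ∈ range X | x % p ^ r = c}), ψ (∑ i, curve d M (x i))‖ ^ 2 := by
      intro ψ
      rw [norm_pow_char_sum, ← prod_char_sum ψ d _ (curve d M), norm_prod]
    simp_rw [conv]
    refine this.trans ?_
    gcongr
  refine (Finset.sum_le_sum fun a _ => step a).trans ?_
  rw [← Finset.mul_sum, ← Nat.cast_sum, ← Finset.sum_mul]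
  gcongr
  set big := {z ∈ Fintype.piFinset (fun _ : Fin d => range X) ×ˢ Fintype.piFinset (fun _ : Fin d => range X) |
    (∀ i j, i ≠ j → ¬ (p : ℤ) ∣ (z.1 i : ℤ) - z.1 j) ∧ cong z} with hbig
  have c1 : ∑ a ∈ (Fintype.piFinset (fun _ : Fin d => range p)) with Function.Injective a,
      #{z ∈ Fintype.piFinset (fun i : Fin d => {x ∈ range X | x % p = a i}) ×ˢ
        Fintype.piFinset (fun i : Fin d => {x ∈ range X | x % p = a i}) | cong z} ≤ #big := by
    rw [← Finset.card_biUnion]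
    · apply Finset.card_le_card
      intro z hz
      simp only [mem_biUnion, mem_filter, mem_product, Fintype.mem_piFinset] at hz
      obtain ⟨a, ⟨ha, hai⟩, ⟨h1, h2⟩, h3⟩ := hz
      simp only [hbig, mem_filter, mem_product, Fintype.mem_piFinset]
      refine ⟨⟨fun i => (h1 i).1, fun i => (h2 i).1⟩, ?_, h3⟩
      intro i j hij hd
      apply hij
      apply hai
      rw [← (h1 i).2, ← (h1 j).2]
      exact ((Nat.modEq_iff_dvd.2 hd).symm)
    · intro a ha a' ha' hne
      rw [Function.onFun, Finset.disjoint_left]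
      intro z hz hz'
      simp only [mem_filter, mem_product, Fintype.mem_piFinset] at hz hz'
      apply hne
      funext i
      rw [← (hz.1.1 i).2, ← (hz'.1.1 i).2]
  refine c1.trans ?_
  have c2 := Finset.card_le_mul_card_image_of_maps_to (s := big) (t := Fintype.piFinset (fun _ : Fin d => range X))
    (f := fun z => z.2) (by
      intro z hz
      exact (mem_product.1 (mem_filter.1 hz).1).2) (d ^ d * p ^ (r * (d * (d - 1) / 2))) (by
      intro y hy
      refine le_trans ?_ (linnik_count p r d X hp hdp (Nat.pow_le_pow_right hp.pos hrd) c
        (fun j => ∑ i, ((y i : ℤ) - c) ^ j))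
      apply Finset.card_le_card_of_injOn (fun z => z.1)
      · intro z hz
        simp only [hbig, coe_filter, mem_filter, Set.mem_ofPred_eq, mem_product] at hz ⊢
        obtain ⟨⟨⟨h1, h2⟩, h3, h4⟩, rfl⟩ := hz
        exact ⟨h1, h3, h4⟩
      · intro z hz w hw hzw
        simp only [coe_filter, Set.mem_ofPred_eq] at hz hw
        exact Prod.ext hzw (hz.2.trans hw.2.symm))
  refine c2.trans (le_of_eq ?_)
  rw [Fintype.card_piFinset]
  simp [mul_comm]

lemma vino_recursion (p d b' H r : ℕ) (hp : p.Prime) (hdp : d < p) (hrd : H ≤ r * d)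
    (hrH : r ≤ H) (hH : 1 ≤ H) (hb' : 1 ≤ b') :
    vinoCount d (b' + d) (range (p ^ H)) ≤
      (2 * p) ^ (2 * d) * ((p ^ r) ^ (2 * b') * ((p ^ H) ^ d * (d ^ d * p ^ (r * (d * (d - 1) / 2)))
        * vinoCount d b' (range (p ^ (H - r)))))
      + (2 * d) ^ (2 * (b' + d)) * (p * vinoCount d (b' + d) (range (p ^ (H - 1)))) := by
  classical
  set M := (b' + d) * (p ^ H) ^ d + 1 with hMdef
  have hM : (b' + d) * (p ^ H) ^ d < M := Nat.lt_succ_self _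
  haveI : NeZero M := ⟨by omega⟩
  set X := p ^ H with hX
  have hX1 : 1 ≤ X := Nat.one_le_pow _ _ hp.pos
  have orth : ∀ v : Fin d → ZMod M, ∑ ψ : AddChar (Fin d → ZMod M) ℂ, (id ψ : AddChar (Fin d → ZMod M) ℂ) v =
      if v = 0 then ((M ^ d : ℕ) : ℂ) else 0 := by
    intro v
    have := AddChar.sum_apply_eq_ite v
    simp only [id]
    rw [this]
    simp
  have mom : ∀ A : Finset ℕ, (∀ x ∈ A, x ≤ X) → ∑ ψ : AddChar (Fin d → ZMod M) ℂ,
      ‖∑ x ∈ A, ψ (curve d M x)‖ ^ (2 * (b' + d)) = (M ^ d : ℕ) * (vinoCount d (b' + d) A : ℝ) := by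
    intro A hA
    simp_rw [norm_pow_char_sum]
    rw [← card_curve_eq_vinoCount d M (b' + d) X hX1 hM A hA]
    exact orth_sq id (M ^ d) orth (Fintype.piFinset (fun _ : Fin (b' + d) => A)) (fun x => ∑ i, curve d M (x i))
  have split : ∀ q : ℕ, 0 < q → ∀ ψ : AddChar (Fin d → ZMod M) ℂ, ‖∑ x ∈ range X, ψ (curve d M x)‖ ≤
      ∑ a ∈ range q, ‖∑ x ∈ range X with x % q = a, ψ (curve d M x)‖ := by
    intro q hq ψ
    rw [← Finset.sum_fiberwise_of_maps_to (s := range X) (t := range q) (g := fun x => x % q)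
      (fun x _ => mem_range.2 (Nat.mod_lt _ hq))]
    exact norm_sum_le _ _
  have hPpos : 0 < p ^ r := pow_pos hp.pos r
  have MR : (0 : ℝ) < ((M ^ d : ℕ) : ℝ) := by
    have : 0 < M ^ d := pow_pos (by omega) _
    exact_mod_cast this
  have pt : ∀ ψ : AddChar (Fin d → ZMod M) ℂ, ((p ^ r : ℕ) : ℝ) * ‖∑ x ∈ range X, ψ (curve d M x)‖ ^ (2 * (b' + d)) ≤
      (2 * p) ^ (2 * d) * (((p ^ r : ℕ) : ℝ) ^ (2 * b') * ∑ c ∈ range (p ^ r),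
      (∑ a ∈ (Fintype.piFinset (fun _ : Fin d => range p)) with Function.Injective a,
      (∏ i, ‖∑ x ∈ range X with x % p = a i, ψ (curve d M x)‖) ^ 2 *
        ‖∑ x ∈ range X with x % p ^ r = c, ψ (curve d M x)‖ ^ (2 * b')))
      + ((p ^ r : ℕ) : ℝ) * ((2 * d) ^ (2 * (b' + d)) *
        ∑ a ∈ range p, ‖∑ x ∈ range X with x % p = a, ψ (curve d M x)‖ ^ (2 * (b' + d))) := by
    intro ψ
    have h1 := broad_narrow p d b' hp.pos (fun a => ‖∑ x ∈ range X with x % p = a, ψ (curve d M x)‖)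
      (fun a => norm_nonneg _) _ (norm_nonneg _) (split p hp.pos ψ)
    have h2 : ((p ^ r : ℕ) : ℝ) * ‖∑ x ∈ range X, ψ (curve d M x)‖ ^ (2 * b') ≤
        ((p ^ r : ℕ) : ℝ) ^ (2 * b') * ∑ c ∈ range (p ^ r), ‖∑ x ∈ range X with x % p ^ r = c, ψ (curve d M x)‖ ^ (2 * b') := by
      refine le_trans ?_ (hoelder_pow (p ^ r) hPpos (fun c => ‖∑ x ∈ range X with x % p ^ r = c, ψ (curve d M x)‖)
        (fun c => norm_nonneg _) (2 * b') (by omega))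
      have := split (p ^ r) hPpos ψ
      gcongr
    calc _ ≤ ((p ^ r : ℕ) : ℝ) * _ := mul_le_mul_of_nonneg_left h1 (by positivity)
      _ = (2 * p) ^ (2 * d) * (∑ a ∈ (Fintype.piFinset (fun _ : Fin d => range p)) with Function.Injective a,
            (∏ i, ‖∑ x ∈ range X with x % p = a i, ψ (curve d M x)‖) ^ 2 *
            (((p ^ r : ℕ) : ℝ) * ‖∑ x ∈ range X, ψ (curve d M x)‖ ^ (2 * b'))) + _ := by
          rw [mul_add]
          congr 1
          rw [mul_left_comm]
          congr 1
          rw [Finset.mul_sum]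
          apply Finset.sum_congr rfl
          intro a _
          ring
      _ ≤ _ := by
          gcongr
          rw [Finset.sum_comm, Finset.mul_sum]
          apply Finset.sum_le_sum
          intro a _
          rw [← Finset.mul_sum]
          have hnn : 0 ≤ (∏ i, ‖∑ x ∈ range X with x % p = a i, ψ (curve d M x)‖) ^ 2 := by positivity
          exact (mul_le_mul_of_nonneg_left h2 hnn).trans (le_of_eq (by ring))
  have tot := Finset.sum_le_sum (fun ψ (_ : ψ ∈ (univ : Finset (AddChar (Fin d → ZMod M) ℂ))) => pt ψ)
  rw [← Finset.mul_sum, Finset.sum_add_distrib, ← Finset.mul_sum, ← Finset.mul_sum, ← Finset.mul_sum, ← Finset.mul_sum,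
    mom _ (fun x hx => (mem_range.1 hx).le), Finset.sum_comm (t := range (p ^ r)), Finset.sum_comm (t := range p)] at tot
  have g1 : ∑ c ∈ range (p ^ r), ∑ ψ : AddChar (Fin d → ZMod M) ℂ,
      (∑ a ∈ (Fintype.piFinset (fun _ : Fin d => range p)) with Function.Injective a,
      (∏ i, ‖∑ x ∈ range X with x % p = a i, ψ (curve d M x)‖) ^ 2 *
        ‖∑ x ∈ range X with x % p ^ r = c, ψ (curve d M x)‖ ^ (2 * b')) ≤
      ((p ^ r : ℕ) : ℝ) * ((M ^ d : ℕ) * ((p ^ H) ^ d * (d ^ d * p ^ (r * (d * (d - 1) / 2))) * vinoCount d b' (range (p ^ (H - r))) : ℕ)) := by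
    calc _ ≤ ∑ c ∈ range (p ^ r), (((M ^ d : ℕ) : ℝ) * ((p ^ H) ^ d * (d ^ d * p ^ (r * (d * (d - 1) / 2))) * vinoCount d b' (range (p ^ (H - r))) : ℕ)) := Finset.sum_le_sum (fun c hc => by
            rw [Finset.sum_comm]
            exact good_count p d b' H r c hp hdp hrd (mem_range.1 hc) M hrH hM)
      _ = _ := by rw [Finset.sum_const, card_range, nsmul_eq_mul]
  have g2 : ∑ a ∈ range p, ∑ ψ : AddChar (Fin d → ZMod M) ℂ,
      ‖∑ x ∈ range X with x % p = a, ψ (curve d M x)‖ ^ (2 * (b' + d)) ≤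
      p * ((M ^ d : ℕ) * (vinoCount d (b' + d) (range (p ^ (H - 1))) : ℝ)) := by
    calc _ ≤ ∑ a ∈ range p, ((M ^ d : ℕ) * (vinoCount d (b' + d) (range (p ^ (H - 1))) : ℝ)) :=
          Finset.sum_le_sum (fun a ha => by
            rw [mom _ (fun x hx => (mem_range.1 (mem_filter.1 hx).1).le)]
            gcongr
            have : X = p * p ^ (H - 1) := by rw [hX, ← pow_succ']; congr 1; omega
            rw [this, filter_mod_eq _ _ _ (mem_range.1 ha)]
            exact vinoCount_affine _ _ _ _ _ hp.pos)
      _ = _ := by rw [Finset.sum_const, card_range, nsmul_eq_mul]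
  have PR : (0 : ℝ) < ((p ^ r : ℕ) : ℝ) := by exact_mod_cast hPpos
  have fin := tot.trans (add_le_add
    (mul_le_mul_of_nonneg_left (mul_le_mul_of_nonneg_left g1 (by positivity)) (by positivity))
    (mul_le_mul_of_nonneg_left (mul_le_mul_of_nonneg_left g2 (by positivity)) (by positivity)))
  have fin2 : (((p ^ r : ℕ) : ℝ) * ((M ^ d : ℕ) : ℝ)) * (vinoCount d (b' + d) (range X) : ℝ) ≤
      (((p ^ r : ℕ) : ℝ) * ((M ^ d : ℕ) : ℝ)) * (((2 * p) ^ (2 * d) * ((p ^ r) ^ (2 * b') * ((p ^ H) ^ d * (d ^ d * p ^ (r * (d * (d - 1) / 2)))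
        * vinoCount d b' (range (p ^ (H - r)))))
      + (2 * d) ^ (2 * (b' + d)) * (p * vinoCount d (b' + d) (range (p ^ (H - 1)))) : ℕ) : ℝ) := by
    refine le_trans (le_of_eq (by ring)) (fin.trans (le_of_eq ?_))
    push_cast
    ring
  exact_mod_cast le_of_mul_le_mul_left fin2 (by positivity)


lemma vinoCount_trivial (d b X : ℕ) : vinoCount d b (range X) ≤ X ^ (2 * b) := by
  unfold vinoCount
  refine (card_filter_le _ _).trans ?_
  rw [card_product, Fintype.card_piFinset]
  simp
  rw [← pow_add, two_mul]

set_option maxHeartbeats 2000000 in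
lemma vino_bound (e d p : ℕ) (he : 1 ≤ e) (hd : d + 1 = 64 * e) (hp : p.Prime) (hpd : 4 * d ^ 2 ≤ p) :
    ∀ k ≤ 31 * d, ∀ H : ℕ, vinoCount d (d ^ 2 + k * d) (range (p ^ H)) * p ^ (H * (k * e)) ≤
      (p ^ (d ^ 2 + 6 * d)) ^ k * p ^ (2 * (d ^ 2 + k * d) * H) := by
  have hd63 : 63 ≤ d := by omega
  have hdp : d < p := by nlinarith
  have hp1 : 1 ≤ p := hp.pos
  intro k
  induction k with
  | zero =>
    intro _ H
    have := vinoCount_trivial d (d ^ 2) (p ^ H)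
    rw [← pow_mul] at this
    simp only [zero_mul, mul_zero, add_zero, pow_zero, mul_one, one_mul]
    refine this.trans (le_of_eq ?_)
    congr 1; ring
  | succ k ih =>
    intro hk H
    have ihk := ih (by omega)
    have hb : d ^ 2 + (k + 1) * d = (d ^ 2 + k * d) + d := by ring
    induction H with
    | zero =>
      have h1 := vinoCount_trivial d (d ^ 2 + (k + 1) * d) (p ^ 0)
      simp only [pow_zero, one_pow] at h1
      simp only [pow_zero, zero_mul, mul_zero, mul_one]
      exact h1.trans (Nat.one_le_pow _ _ (Nat.pow_pos hp1))
    | succ H0 ihH =>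
      obtain ⟨H, hH⟩ : ∃ H, H = H0 + 1 := ⟨_, rfl⟩
      rw [← hH]
      set r := (H + d - 1) / d with hr
      have hdpos : 0 < d := by omega
      have hr1 : r * d ≤ H + d - 1 := Nat.div_mul_le_self _ _
      have hr2 : H ≤ r * d := by
        have := Nat.div_add_mod (H + d - 1) d
        have h2 := Nat.mod_lt (H + d - 1) hdpos
        rw [← hr, mul_comm] at this
        omega
      have hrH : r ≤ H := by
        have : r * d ≤ H * d := by
          have : H0 ≤ H0 * d := Nat.le_mul_of_pos_right _ hdpos
          rw [hH, add_mul, one_mul]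
          omega
        exact Nat.le_of_mul_le_mul_right this hdpos
      have hrec := vino_recursion p d (d ^ 2 + k * d) H r hp hdp hr2 hrH (by omega) (by nlinarith)
      have hH1 : H - 1 = H0 := by omega
      rw [hH1] at hrec
      have ih1 := ihk (H - r)
      rw [hb] at ihH ⊢
      set b' := d ^ 2 + k * d with hb'
      set J1 := vinoCount d b' (range (p ^ (H - r)))
      set J2 := vinoCount d (b' + d) (range (p ^ H0))
      set C := p ^ (d ^ 2 + 6 * d) with hC
      -- good part
      have good : 2 * (((2 * p) ^ (2 * d) * ((p ^ r) ^ (2 * b') * ((p ^ H) ^ d * (d ^ d * p ^ (r * (d * (d - 1) / 2)))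
          * J1))) * p ^ (H * ((k + 1) * e))) ≤ C ^ (k + 1) * p ^ (2 * (b' + d) * H) := by
        have c1 : 2 * ((2 * p) ^ (2 * d) * d ^ d) * p ^ (d ^ 2) ≤ C := by
          have a1 : 2 ≤ p ^ d := hp.two_le.trans (Nat.le_self_pow (by omega) p)
          have a2 : 2 ^ (2 * d) ≤ p ^ d := by
            rw [pow_mul]; exact Nat.pow_le_pow_left (by omega) _
          have a3 : d ^ d ≤ p ^ d := Nat.pow_le_pow_left hdp.le _
          calc 2 * ((2 * p) ^ (2 * d) * d ^ d) * p ^ (d ^ 2)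
              = 2 * (2 ^ (2 * d) * p ^ (2 * d) * d ^ d) * p ^ (d ^ 2) := by rw [mul_pow]
            _ ≤ p ^ d * (p ^ d * p ^ (2 * d) * p ^ d) * p ^ (d ^ 2) := by gcongr
            _ = p ^ (d ^ 2 + 5 * d) := by ring
            _ ≤ C := Nat.pow_le_pow_right hp1 (by omega)
        have hex : r * (d * (d - 1) / 2) + r * (k * e) + H * e ≤ H * d + d ^ 2 := by
          have hh : d * (d - 1) / 2 + k * e ≤ d * (d - e) := by
            have k1 : k * e ≤ 31 * d * e := Nat.mul_le_mul_right _ (by omega)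
            have k2 : d * (d - 1) / 2 = d * (32 * e - 1) := by
              have : d - 1 = 2 * (32 * e - 1) := by omega
              rw [this, mul_left_comm, Nat.mul_div_cancel_left _ (by norm_num)]
            have k3 : d - e = 32 * e - 1 + 31 * e := by omega
            rw [k2, k3, mul_add]
            nlinarith
          calc r * (d * (d - 1) / 2) + r * (k * e) + H * e = r * (d * (d - 1) / 2 + k * e) + H * e := by ring
            _ ≤ r * (d * (d - e)) + H * e := by gcongr
            _ = (r * d) * (d - e) + H * e := by ring
            _ ≤ (H + d) * (d - e) + H * e := by gcongr; omega
            _ = H * ((d - e) + e) + d * (d - e) := by ring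
            _ ≤ H * d + d ^ 2 := by
              rw [Nat.sub_add_cancel (by omega), pow_two]
              gcongr
              omega
        have hsplit : p ^ (H * ((k + 1) * e)) = p ^ ((H - r) * (k * e)) * p ^ (r * (k * e) + H * e) := by
          rw [← pow_add]
          congr 1
          obtain ⟨q, hq⟩ : ∃ q, H = q + r := ⟨H - r, by omega⟩
          rw [hq, Nat.add_sub_cancel]; ring
        calc _ = (2 * ((2 * p) ^ (2 * d) * d ^ d)) * (J1 * p ^ ((H - r) * (k * e))) *
              (p ^ (r * (2 * b') + H * d) * p ^ (r * (d * (d - 1) / 2) + r * (k * e) + H * e)) := by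
              rw [hsplit]; ring
          _ ≤ (2 * ((2 * p) ^ (2 * d) * d ^ d)) * (C ^ k * p ^ (2 * b' * (H - r))) *
              (p ^ (r * (2 * b') + H * d) * p ^ (H * d + d ^ 2)) := by
              gcongr
          _ = (2 * ((2 * p) ^ (2 * d) * d ^ d) * p ^ (d ^ 2)) * (C ^ k * (p ^ (2 * b' * (H - r)) *
              p ^ (r * (2 * b') + H * d) * p ^ (H * d))) := by ring
          _ ≤ C * (C ^ k * (p ^ (2 * b' * (H - r)) * p ^ (r * (2 * b') + H * d) * p ^ (H * d))) := by
              gcongr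
          _ = C ^ (k + 1) * p ^ (2 * (b' + d) * H) := by
              rw [← mul_assoc, ← pow_succ', ← pow_add, ← pow_add]
              congr 2
              obtain ⟨q, hq⟩ : ∃ q, H = q + r := ⟨H - r, by omega⟩
              rw [hq, Nat.add_sub_cancel]; ring
      have bad : 2 * (((2 * d) ^ (2 * (b' + d)) * (p * J2)) * p ^ (H * ((k + 1) * e))) ≤
          C ^ (k + 1) * p ^ (2 * (b' + d) * H) := by
        have a1 : (2 * d) ^ (2 * (b' + d)) ≤ p ^ (b' + d) := by
          rw [pow_mul]
          exact Nat.pow_le_pow_left (by nlinarith) _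
        have a2 : 2 + (k + 1) * e ≤ b' + d := by
          have : (k + 1) * e ≤ (k + 1) * d := Nat.mul_le_mul_left _ (by omega)
          rw [hb']
          nlinarith
        calc _ = 2 * (2 * d) ^ (2 * (b' + d)) * p * p ^ ((k + 1) * e) * (J2 * p ^ (H0 * ((k + 1) * e))) := by
              rw [hH]; ring
          _ ≤ p * p ^ (b' + d) * p * p ^ ((k + 1) * e) * (C ^ (k + 1) * p ^ (2 * (b' + d) * H0)) := by
              gcongr
              exact hp.two_le
          _ = p ^ (2 + (k + 1) * e) * (p ^ (b' + d) * (C ^ (k + 1) * p ^ (2 * (b' + d) * H0))) := by ring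
          _ ≤ p ^ (b' + d) * (p ^ (b' + d) * (C ^ (k + 1) * p ^ (2 * (b' + d) * H0))) := by
              gcongr
          _ = _ := by rw [hH]; ring
      have := (Nat.mul_le_mul_right (p ^ (H * ((k + 1) * e))) hrec).trans (le_of_eq (add_mul _ _ _))
      omega


lemma bilinear_abs {V : Type*} [AddCommGroup V] [Fintype V] [DecidableEq V] (e : V → AddChar V ℂ)
    (hsymm : ∀ u v, e u v = e v u)
    (orth : ∀ v, ∑ l, e l v = if v = 0 then (Fintype.card V : ℂ) else 0) (b X : ℕ) (hb : 1 ≤ b)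
    (hX : 1 ≤ X) (φ : ℕ → V) (J : ℕ)
    (hJ : #{z ∈ Fintype.piFinset (fun _ : Fin b => range X) ×ˢ Fintype.piFinset (fun _ : Fin b => range X) |
      ∑ i, φ (z.1 i) = ∑ i, φ (z.2 i)} ≤ J) :
    ‖∑ x ∈ range X, ∑ y ∈ range X, e (φ x) (φ y)‖ ^ (4 * b ^ 2) * (X : ℝ) ^ (4 * b) ≤
      (X : ℝ) ^ (8 * b ^ 2) * Fintype.card V * (J : ℝ) ^ 2 := by
  set K := Fintype.piFinset (fun _ : Fin b => range X) with hK
  set g : (Fin b → ℕ) → V := fun x => ∑ i, φ (x i) with hg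
  set T : ℕ → ℂ := fun x => ∑ y ∈ range X, e (φ x) (φ y) with hT
  set w : V → ℝ := fun l => ‖∑ x ∈ range X, e l (φ x)‖ with hw
  have hX' : (0 : ℝ) < X := by exact_mod_cast hX
  have hcK : (#K : ℝ) = (X : ℝ) ^ b := by
    rw [hK, Fintype.card_piFinset]; simp
  have hw0 : ∀ l, 0 ≤ w l := fun l => norm_nonneg _
  -- step 1
  have s1 : (X : ℝ) * ‖∑ x ∈ range X, T x‖ ^ (2 * b) ≤ (X : ℝ) ^ (2 * b) * ∑ x ∈ range X, ‖T x‖ ^ (2 * b) := by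
    refine le_trans ?_ (hoelder_pow X hX (fun x => ‖T x‖) (fun _ => norm_nonneg _) (2 * b) (by omega))
    gcongr
    exact norm_sum_le _ _
  -- step 2
  have s2 : ∑ x ∈ range X, ‖T x‖ ^ (2 * b) ≤ ∑ z ∈ K ×ˢ K, w (g z.1 - g z.2) := by
    have h1 : ∀ x, ((‖T x‖ ^ (2 * b) : ℝ) : ℂ) = ∑ z ∈ K ×ˢ K, e (g z.1 - g z.2) (φ x) := by
      intro x
      rw [hT]
      simp only
      rw [norm_pow_char_sum (e (φ x)) b (range X) φ]
      push_cast
      rw [← Complex.mul_conj', map_sum, Finset.sum_mul_sum, Finset.sum_product]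
      apply Finset.sum_congr rfl; intro i _
      apply Finset.sum_congr rfl; intro j _
      rw [← AddChar.map_neg_eq_conj, ← AddChar.map_add_eq_mul, ← sub_eq_add_neg, hsymm]
    have h2 : ((∑ x ∈ range X, ‖T x‖ ^ (2 * b) : ℝ) : ℂ) =
        ∑ z ∈ K ×ˢ K, ∑ x ∈ range X, e (g z.1 - g z.2) (φ x) := by
      rw [Finset.sum_comm, Complex.ofReal_sum]
      exact Finset.sum_congr rfl (fun x _ => h1 x)
    have h3 : ∑ x ∈ range X, ‖T x‖ ^ (2 * b) = ‖((∑ x ∈ range X, ‖T x‖ ^ (2 * b) : ℝ) : ℂ)‖ := by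
      rw [Complex.norm_real, Real.norm_of_nonneg]
      positivity
    rw [h3, h2]
    exact norm_sum_le _ _
  -- R
  set R : V → ℕ := fun l => #{z ∈ K ×ˢ K | g z.1 - g z.2 = l} with hR
  have hRJ : ∀ l, R l ≤ J := by
    intro l
    refine le_trans (le_trans (le_of_eq ?_) (corr_le K g l)) hJ
    rw [hR]
    simp only
    congr 1
    apply Finset.filter_congr
    intro z _
    rw [sub_eq_iff_eq_add, add_comm]
  have fib : ∀ f : V → ℝ, ∑ z ∈ K ×ˢ K, f (g z.1 - g z.2) = ∑ l, R l * f l := by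
    intro f
    rw [← Finset.sum_fiberwise (K ×ˢ K) (fun z => g z.1 - g z.2)]
    apply Finset.sum_congr rfl
    intro l _
    rw [hR]
    simp only
    rw [← nsmul_eq_mul, ← Finset.sum_const]
    apply Finset.sum_congr rfl
    intro z hz
    rw [(mem_filter.1 hz).2]
  have hRsum : ∑ l, (R l : ℝ) = (X : ℝ) ^ (2 * b) := by
    have := fib (fun _ => 1)
    simp only [mul_one, Finset.sum_const, Finset.card_product] at this
    rw [← this]
    push_cast
    rw [nsmul_eq_mul]
    push_cast
    rw [hcK]; ring
  have s3 : (∑ z ∈ K ×ˢ K, w (g z.1 - g z.2)) ^ b * ((X : ℝ) ^ (2 * b)) ≤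
      ((X : ℝ) ^ (2 * b)) ^ b * ∑ z ∈ K ×ˢ K, w (g z.1 - g z.2) ^ b := by
    obtain ⟨c, rfl⟩ : ∃ c, b = c + 1 := ⟨b - 1, by omega⟩
    have := pow_sum_div_card_le_sum_pow (s := K ×ˢ K) (f := fun z => w (g z.1 - g z.2)) (fun z _ => hw0 _) c
    have hc : ((#(K ×ˢ K) : ℕ) : ℝ) = (X : ℝ) ^ (2 * (c + 1)) := by
      rw [Finset.card_product]; push_cast; rw [hcK]; ring
    rw [hc, div_le_iff₀ (by positivity)] at this
    calc _ ≤ ((∑ i ∈ K ×ˢ K, w (g i.1 - g i.2) ^ (c + 1)) * ((X : ℝ) ^ (2 * (c + 1))) ^ c) * ((X : ℝ) ^ (2 * (c + 1))) := by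
          gcongr
      _ = _ := by ring
  have s4 : (∑ z ∈ K ×ˢ K, w (g z.1 - g z.2) ^ b) ^ 2 ≤
      (J * (X : ℝ) ^ (2 * b)) * (Fintype.card V * J) := by
    rw [fib (fun l => w l ^ b)]
    refine le_trans (Finset.sum_mul_sq_le_sq_mul_sq univ (fun l => (R l : ℝ)) (fun l => w l ^ b)) ?_
    gcongr
    · rw [← hRsum, Finset.mul_sum]
      apply Finset.sum_le_sum
      intro l _
      rw [sq]
      have : (R l : ℝ) ≤ J := by exact_mod_cast hRJ l
      gcongr
    · have h := orth_sq e (Fintype.card V) orth K g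
      calc ∑ l, (w l ^ b) ^ 2 = ∑ l, ‖∑ i ∈ K, e l (g i)‖ ^ 2 := by
            apply Finset.sum_congr rfl
            intro l _
            rw [← norm_pow_char_sum (e l) b (range X) φ, ← pow_mul, mul_comm b 2]
        _ ≤ _ := by
            rw [h]
            have : ((#{z ∈ K ×ˢ K | g z.1 = g z.2} : ℕ) : ℝ) ≤ J := by exact_mod_cast hJ
            gcongr
  set Z := ∑ z ∈ K ×ˢ K, w (g z.1 - g z.2) with hZ
  have hZ0 : 0 ≤ Z := Finset.sum_nonneg (fun z _ => hw0 _)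
  set T0 := ‖∑ x ∈ range X, T x‖ with hT0
  have s5 : (Z ^ b * ((X : ℝ) ^ (2 * b))) ^ 2 ≤ (((X : ℝ) ^ (2 * b)) ^ b) ^ 2 * ((J * (X : ℝ) ^ (2 * b)) * (Fintype.card V * J)) := by
    refine (pow_le_pow_left₀ (by positivity) s3 2).trans ?_
    rw [mul_pow]
    gcongr
  have s6 : ((X : ℝ) * T0 ^ (2 * b)) ^ (2 * b) ≤ ((X : ℝ) ^ (2 * b) * Z) ^ (2 * b) :=
    pow_le_pow_left₀ (by positivity) (s1.trans (by gcongr)) _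
  have hpos : (0 : ℝ) < (X : ℝ) ^ (2 * b) := by positivity
  refine le_of_mul_le_mul_right ?_ hpos
  calc _ = ((X : ℝ) * T0 ^ (2 * b)) ^ (2 * b) * (X : ℝ) ^ (4 * b) := by
        rw [mul_pow, ← pow_mul]; ring
    _ ≤ ((X : ℝ) ^ (2 * b) * Z) ^ (2 * b) * (X : ℝ) ^ (4 * b) := by gcongr
    _ = ((X : ℝ) ^ (2 * b)) ^ (2 * b) * (Z ^ b * ((X : ℝ) ^ (2 * b))) ^ 2 := by ring
    _ ≤ ((X : ℝ) ^ (2 * b)) ^ (2 * b) * ((((X : ℝ) ^ (2 * b)) ^ b) ^ 2 * ((J * (X : ℝ) ^ (2 * b)) * (Fintype.card V * J))) := by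
        gcongr
    _ = _ := by ring


lemma jstar_le (d b X : ℕ) (q : Fin d → ℕ) (hq : ∀ j, 0 < q j) :
    #{z ∈ Fintype.piFinset (fun _ : Fin b => range X) ×ˢ Fintype.piFinset (fun _ : Fin b => range X) |
      ∀ j : Fin d, ∑ i, ((z.1 i : ℕ) : ZMod (q j)) ^ ((j : ℕ) + 1) = ∑ i, ((z.2 i : ℕ) : ZMod (q j)) ^ ((j : ℕ) + 1)} ≤
      vinoCount d b (range X) * ∏ j : Fin d, (2 * (b * X ^ ((j : ℕ) + 1) / q j) + 1) := by
  set K := Fintype.piFinset (fun _ : Fin b => range X) with hK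
  set G : (Fin b → ℕ) → Fin d → ℤ := fun x j => ∑ i, (x i : ℤ) ^ ((j : ℕ) + 1) with hG
  have hGb : ∀ x ∈ K, ∀ j, 0 ≤ G x j ∧ G x j ≤ ((b * X ^ ((j : ℕ) + 1) : ℕ) : ℤ) := by
    intro x hx j
    rw [hK, Fintype.mem_piFinset] at hx
    refine ⟨by positivity, ?_⟩
    calc G x j ≤ ∑ _i : Fin b, ((X ^ ((j : ℕ) + 1) : ℕ) : ℤ) := by
          apply Finset.sum_le_sum
          intro i _
          push_cast
          have := mem_range.1 (hx i)
          gcongr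
      _ = _ := by simp
  have hcard : #(Fintype.piFinset (fun j : Fin d => Icc (-((b * X ^ ((j : ℕ) + 1) / q j : ℕ) : ℤ)) ((b * X ^ ((j : ℕ) + 1) / q j : ℕ) : ℤ))) =
      ∏ j : Fin d, (2 * (b * X ^ ((j : ℕ) + 1) / q j) + 1) := by
    rw [Fintype.card_piFinset]
    apply Finset.prod_congr rfl
    intro j _
    rw [Int.card_Icc]
    omega
  rw [← hcard]
  have hdvd : ∀ z : (Fin b → ℕ) × (Fin b → ℕ), (∀ j : Fin d, ∑ i, ((z.1 i : ℕ) : ZMod (q j)) ^ ((j : ℕ) + 1) = ∑ i, ((z.2 i : ℕ) : ZMod (q j)) ^ ((j : ℕ) + 1)) →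
      ∀ j, (q j : ℤ) ∣ G z.1 j - G z.2 j := by
    intro z hz j
    rw [← ZMod.intCast_zmod_eq_zero_iff_dvd]
    rw [hG]; push_cast
    rw [hz j, sub_self]
  refine Finset.card_le_mul_card_image_of_maps_to
    (f := fun z : (Fin b → ℕ) × (Fin b → ℕ) => fun j : Fin d => (G z.1 j - G z.2 j) / (q j : ℤ)) ?_ _ ?_
  · intro z hz
    simp only [mem_filter, mem_product] at hz
    rw [Fintype.mem_piFinset]
    intro j
    have h1 := hGb z.1 hz.1.1 j
    have h2 := hGb z.2 hz.1.2 j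
    obtain ⟨c, hc⟩ := hdvd z hz.2 j
    have hqj : (0 : ℤ) < q j := by exact_mod_cast hq j
    rw [hc, Int.mul_ediv_cancel_left _ hqj.ne', mem_Icc]
    push_cast [Nat.cast_div]
    rw [neg_le, Int.le_ediv_iff_mul_le hqj, Int.le_ediv_iff_mul_le hqj]
    push_cast at h1 h2
    constructor <;> nlinarith
  · intro v hv
    refine le_trans ?_ (le_trans (corr_le K G (fun j => q j * v j)) ?_)
    · apply Finset.card_le_card
      intro z hz
      simp only [mem_filter] at hz ⊢
      refine ⟨hz.1.1, ?_⟩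
      funext j
      have := congrFun hz.2 j
      have h3 := Int.ediv_mul_cancel (hdvd z hz.1.2 j)
      rw [this] at h3
      simp only [Pi.add_apply]
      linarith
    · unfold vinoCount
      apply Finset.card_le_card
      intro z hz
      simp only [mem_filter] at hz ⊢
      refine ⟨hz.1, ?_⟩
      intro j hj
      rw [mem_Icc] at hj
      have := congrFun hz.2 ⟨j - 1, by omega⟩
      simp only [hG] at this
      rw [Nat.sub_add_cancel hj.1] at this
      exact_mod_cast this

/-- the bilinear character -/
noncomputable def bchar {d : ℕ} (q : Fin d → ℕ) [∀ j, NeZero (q j)] (a : ∀ j, ZMod (q j)) (l : ∀ j, ZMod (q j)) :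
    AddChar (∀ j, ZMod (q j)) ℂ where
  toFun v := ∏ j, ZMod.stdAddChar (a j * l j * v j)
  map_zero_eq_one' := by simp
  map_add_eq_mul' u v := by
    rw [← Finset.prod_mul_distrib]
    apply Finset.prod_congr rfl
    intro j _
    rw [Pi.add_apply, mul_add, AddChar.map_add_eq_mul]

lemma bchar_apply {d : ℕ} (q : Fin d → ℕ) [∀ j, NeZero (q j)] (a l v : ∀ j, ZMod (q j)) :
    bchar q a l v = ∏ j, ZMod.stdAddChar (a j * l j * v j) := rfl

lemma bchar_orth {d : ℕ} (q : Fin d → ℕ) [∀ j, NeZero (q j)] (a : ∀ j, ZMod (q j)) (ha : ∀ j, IsUnit (a j))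
    (v : ∀ j, ZMod (q j)) :
    ∑ l, bchar q a l v = if v = 0 then ((Fintype.card (∀ j, ZMod (q j)) : ℕ) : ℂ) else 0 := by
  simp_rw [bchar_apply]
  have h := Finset.prod_univ_sum (fun j : Fin d => (univ : Finset (ZMod (q j)))) (fun j t => (ZMod.stdAddChar (a j * t * v j) : ℂ))
  rw [Fintype.piFinset_univ] at h
  rw [← h]
  have h2 : ∀ j, ∑ t : ZMod (q j), (ZMod.stdAddChar (a j * t * v j) : ℂ) = if v j = 0 then (q j : ℂ) else 0 := by
    intro j
    have := AddChar.sum_mulShift (R := ZMod (q j)) (a j * v j) (ZMod.isPrimitive_stdAddChar (q j))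
    rw [ZMod.card] at this
    have h3 : a j * v j = 0 ↔ v j = 0 := (ha j).mul_right_eq_zero
    simp only [h3] at this
    rw [Nat.cast_ite, Nat.cast_zero] at this
    rw [← this]
    apply Finset.sum_congr rfl
    intro t _
    congr 1; ring
  simp_rw [h2]
  split_ifs with hv
  · subst hv
    simp [Fintype.card_pi, ZMod.card]
  · obtain ⟨j, hj⟩ := Function.ne_iff.1 hv
    apply Finset.prod_eq_zero (mem_univ j)
    exact if_neg hj

lemma bilinear_bound (d b X : ℕ) (hb : 1 ≤ b) (hX : 1 ≤ X) (q : Fin d → ℕ) [∀ j, NeZero (q j)]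
    (a : ∀ j, ZMod (q j)) (ha : ∀ j, IsUnit (a j)) :
    ‖∑ x ∈ range X, ∑ y ∈ range X, ∏ j : Fin d, (ZMod.stdAddChar
        (a j * (x : ZMod (q j)) ^ ((j : ℕ) + 1) * (y : ZMod (q j)) ^ ((j : ℕ) + 1)) : ℂ)‖ ^ (4 * b ^ 2) * (X : ℝ) ^ (4 * b) ≤
      (X : ℝ) ^ (8 * b ^ 2) * (∏ j, q j : ℕ) *
        ((vinoCount d b (range X) * ∏ j : Fin d, (2 * (b * X ^ ((j : ℕ) + 1) / q j) + 1) : ℕ) : ℝ) ^ 2 := by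
  have h := bilinear_abs (bchar q a) (by
      intro u v
      rw [bchar_apply, bchar_apply]
      apply Finset.prod_congr rfl
      intro j _
      congr 1; ring) (bchar_orth q a ha) b X hb hX (fun x j => (x : ZMod (q j)) ^ ((j : ℕ) + 1))
    (vinoCount d b (range X) * ∏ j : Fin d, (2 * (b * X ^ ((j : ℕ) + 1) / q j) + 1)) (by
      refine le_trans (Finset.card_le_card ?_) (jstar_le d b X q (fun j => NeZero.pos _))
      intro z hz
      simp only [mem_filter] at hz ⊢
      refine ⟨hz.1, fun j => ?_⟩
      have := congrFun hz.2 j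
      simpa only [Finset.sum_apply] using this)
  rw [Fintype.card_pi] at h
  simp only [ZMod.card, bchar_apply] at h
  exact h


lemma sumM_aux (d : ℤ) (n : ℕ) :
    6 * ∑ j ∈ range n, max (d - ((j : ℤ) + 1)) (5 * ((j : ℤ) + 1) - d) ≤
      15 * n * (n + 1) - 6 * d * n + 2 * d ^ 2 - 2 * (max 0 (d - 3 * n)) ^ 2 ∨ d < 0 := by
  by_cases hd : d < 0
  · right; exact hd
  left
  push Not at hd
  induction n with
  | zero => simp [max_eq_right hd]
  | succ n ih =>
    rw [Finset.sum_range_succ, mul_add]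
    push_cast
    rcases le_total 0 (d - 3 * n) with h1 | h1 <;> rcases le_total 0 (d - 3 * ((n : ℤ) + 1)) with h2 | h2 <;>
    rcases le_total (d - ((n : ℤ) + 1)) (5 * ((n : ℤ) + 1) - d) with h3 | h3 <;>
    simp only [max_eq_left, max_eq_right, h1, h2, h3] at ih ⊢ <;> nlinarith

lemma sumM_le (d : ℕ) : 6 * ∑ j : Fin d, max (d - ((j : ℕ) + 1)) (5 * ((j : ℕ) + 1) - d) ≤ 11 * d ^ 2 + 15 * d := by
  rw [Fin.sum_univ_eq_sum_range (fun j => max (d - (j + 1)) (5 * (j + 1) - d)) d]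
  have h := (sumM_aux d d).resolve_right (by omega)
  have h2 : ((∑ j ∈ range d, max (d - (j + 1)) (5 * (j + 1) - d) : ℕ) : ℤ) =
      ∑ j ∈ range d, max ((d : ℤ) - ((j : ℤ) + 1)) (5 * ((j : ℤ) + 1) - d) := by
    push_cast
    apply Finset.sum_congr rfl
    intro j hj
    have := mem_range.1 hj
    omega
  rw [← h2] at h
  have h3 : (0 : ℤ) ≤ max 0 ((d : ℤ) - 3 * d) ^ 2 := by positivity
  zify
  zify at h
  nlinarith

lemma perj (d b s X w J : ℕ) (hJ : J ≤ d) (hX : X ≤ 2 ^ (2 * s)) (hw1 : s * (d - J) ≤ w + d) (hw2 : w ≤ s * (d - J) + d) :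
    2 ^ w * (2 * (b * X ^ J / 2 ^ w) + 1) ^ 2 ≤ (2 * b + 1) ^ 2 * 2 ^ (d + s * max (d - J) (5 * J - d)) := by
  rcases le_or_gt (X ^ J) (2 ^ w) with h | h
  · have h1 : b * X ^ J / 2 ^ w ≤ b := by
      apply Nat.div_le_of_le_mul
      rw [mul_comm]
      gcongr
    calc _ ≤ 2 ^ w * (2 * b + 1) ^ 2 := by gcongr
      _ ≤ 2 ^ (d + s * max (d - J) (5 * J - d)) * (2 * b + 1) ^ 2 := by
          gcongr
          · norm_num
          · have := Nat.mul_le_mul_left s (le_max_left (d - J) (5 * J - d))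
            omega
      _ = _ := by ring
  · have h1 : 2 ^ w * (2 * (b * X ^ J / 2 ^ w) + 1) ≤ (2 * b + 1) * X ^ J := by
      have := Nat.mul_div_le (b * X ^ J) (2 ^ w)
      nlinarith
    have h2 : (X ^ J) ^ 2 ≤ 2 ^ w * 2 ^ (d + s * max (d - J) (5 * J - d)) := by
      rw [← pow_mul, ← pow_add]
      refine (Nat.pow_le_pow_left hX _).trans ?_
      rw [← pow_mul]
      apply Nat.pow_le_pow_right (by norm_num)
      have h3 : s * (4 * J) ≤ s * ((d - J) + max (d - J) (5 * J - d)) := by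
        apply Nat.mul_le_mul_left
        omega
      rw [mul_add] at h3
      nlinarith
    apply Nat.le_of_mul_le_mul_left _ (Nat.two_pow_pos w)
    calc _ = (2 ^ w * (2 * (b * X ^ J / 2 ^ w) + 1)) ^ 2 := by ring
      _ ≤ ((2 * b + 1) * X ^ J) ^ 2 := by gcongr
      _ = (2 * b + 1) ^ 2 * (X ^ J) ^ 2 := by ring
      _ ≤ (2 * b + 1) ^ 2 * (2 ^ w * 2 ^ (d + s * max (d - J) (5 * J - d))) := by gcongr
      _ = _ := by ring

lemma expo_ineq (e d s r ν S : ℕ) (he : 1 ≤ e) (hd : d + 1 = 64 * e) (hS : 6 * S ≤ 11 * d ^ 2 + 15 * d)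
    (hr : 1 ≤ r) (h1 : 2240 * r * d ≤ s) (h2 : 2 ^ 18 * ν * d ^ 2 ≤ s) :
    r * (62 * d * e) + r * ((d ^ 2 + 6 * d) * (31 * d) * 2) + r * (2 * d) + (d * d + s * S) + 2 * ν * (4 * (32 * d ^ 2) ^ 2)
      ≤ 2 * s * (62 * d * e) := by
  have hd63 : 63 ≤ d := by omega
  have a1 : r * (62 * d * e) + r * ((d ^ 2 + 6 * d) * (31 * d) * 2) + r * (2 * d) + d * d ≤ 70 * r * d ^ 3 := by
    have h5 : e ≤ d := by omega
    have h6 : r * (62 * d * e) ≤ 62 * (r * d * d) := by nlinarith [Nat.zero_le (r * d)]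
    have h7 : d * d ≤ r * d * d := by nlinarith [Nat.zero_le (d * d)]
    have h8 : 63 * (r * d * d) ≤ r * d * d * d := by nlinarith [Nat.zero_le (r * d * d)]
    have h9 : r * (2 * d) ≤ 2 * (r * d * d) := by nlinarith [Nat.zero_le (r * d)]
    nlinarith
  have a2 : 32 * (70 * r * d ^ 3) ≤ s * d ^ 2 := by nlinarith [Nat.zero_le (d ^ 2)]
  have a3 : 32 * (2 * ν * (4 * (32 * d ^ 2) ^ 2)) ≤ s * d ^ 2 := by
    calc _ = (2 ^ 18 * ν * d ^ 2) * d ^ 2 := by ring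
      _ ≤ _ := by gcongr
  have a4 : 6 * (s * S) ≤ 11 * (s * d ^ 2) + 15 * (s * d) := by nlinarith
  have a5 : 64 * (2 * s * (62 * d * e)) = 124 * (s * d ^ 2) + 124 * (s * d) := by
    calc _ = 124 * (s * d) * (64 * e) := by ring
      _ = _ := by rw [← hd]; ring
  have a6 : 63 * (s * d) ≤ s * d ^ 2 := by nlinarith [Nat.zero_le (s * d)]
  omega

lemma T_bound (e d s r ν n : ℕ) (he : 1 ≤ e) (hd : d + 1 = 64 * e)
    (hr : 64 * d ^ 2 + 1 ≤ 2 ^ r) (h1 : 2240 * r * d ≤ s) (h2 : 2 ^ 18 * ν * d ^ 2 ≤ s) (hn : n ≤ 2 ^ ν) :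
    ∃ X : ℕ, 1 ≤ X ∧ X ≤ 2 ^ (2 * s) ∧ ∀ w : Fin d → ℕ, 
      (∀ j : Fin d, s * (d - ((j : ℕ) + 1)) ≤ w j + d) → (∀ j : Fin d, w j ≤ s * (d - ((j : ℕ) + 1)) + d) →
      ∀ a : ∀ j, ZMod (2 ^ w j), (∀ j, IsUnit (a j)) →
      (n : ℝ) ^ 2 * ‖∑ x ∈ range X, ∑ y ∈ range X, ∏ j : Fin d, (ZMod.stdAddChar
        (a j * (x : ZMod (2 ^ w j)) ^ ((j : ℕ) + 1) * (y : ZMod (2 ^ w j)) ^ ((j : ℕ) + 1)) : ℂ)‖ ≤ (X : ℝ) ^ 2 := by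
  have hd63 : 63 ≤ d := by omega
  obtain ⟨p, hp, hp1, hp2⟩ := Nat.exists_prime_lt_and_le_two_mul (4 * d ^ 2) (by positivity)
  have hpr : p ≤ 2 ^ r := by omega
  have hp2' := hp.two_le
  set H := Nat.log p (2 ^ (2 * s)) with hH
  have hXle : p ^ H ≤ 2 ^ (2 * s) := Nat.pow_log_le_self p (by positivity)
  have hXlt : 2 ^ (2 * s) ≤ p ^ H * p := by
    have := Nat.lt_pow_succ_log_self hp.one_lt (2 ^ (2 * s))
    rw [pow_succ] at this
    exact this.le
  have hr1 : 1 ≤ r := by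
    by_contra hh
    have : r = 0 := by omega
    subst this
    nlinarith
  set X := p ^ H with hX
  have hX1 : 1 ≤ X := Nat.one_le_pow _ _ (by omega)
  refine ⟨X, hX1, hXle, ?_⟩
  intro w hw1 hw2 a ha
  set T := ‖∑ x ∈ range X, ∑ y ∈ range X, ∏ j : Fin d, (ZMod.stdAddChar
        (a j * (x : ZMod (2 ^ w j)) ^ ((j : ℕ) + 1) * (y : ZMod (2 ^ w j)) ^ ((j : ℕ) + 1)) : ℂ)‖ with hT
  have hT0 : 0 ≤ T := norm_nonneg _
  set b := 32 * d ^ 2 with hb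
  have hB := bilinear_bound d b X (by nlinarith) hX1 (fun j => 2 ^ w j) a ha
  have hV := vino_bound e d p he hd hp hp1.le (31 * d) le_rfl H
  rw [show d ^ 2 + 31 * d * d = b by rw [hb]; ring] at hV
  set J := vinoCount d b (range X) with hJ
  set S := ∑ j : Fin d, max (d - ((j : ℕ) + 1)) (5 * ((j : ℕ) + 1) - d) with hS
  have hprod : (∏ j : Fin d, 2 ^ w j) * (∏ j : Fin d, (2 * (b * X ^ ((j : ℕ) + 1) / 2 ^ w j) + 1)) ^ 2 ≤
      (2 ^ r) ^ (2 * d) * 2 ^ (d * d + s * S) := by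
    rw [← Finset.prod_pow, ← Finset.prod_mul_distrib]
    calc _ ≤ ∏ j : Fin d, ((2 ^ r) ^ 2 * 2 ^ (d + s * max (d - ((j : ℕ) + 1)) (5 * ((j : ℕ) + 1) - d))) := by
          apply Finset.prod_le_prod'
          intro j _
          refine (perj d b s X (w j) (j + 1) (by omega) hXle (hw1 j) (hw2 j)).trans ?_
          gcongr
          rw [hb]; omega
      _ = _ := by
          rw [Finset.prod_mul_distrib, Finset.prod_pow_eq_pow_sum univ _ 2, Finset.sum_add_distrib, ← Finset.mul_sum,
            Finset.prod_const, Finset.sum_const, card_univ, Fintype.card_fin, smul_eq_mul, ← pow_mul (2 ^ r) 2 d]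
  have hV2 : J ^ 2 * X ^ (62 * d * e) ≤ (2 ^ r) ^ ((d ^ 2 + 6 * d) * (31 * d) * 2) * X ^ (4 * b) := by
    calc J ^ 2 * X ^ (62 * d * e) = (J * p ^ (H * (31 * d * e))) ^ 2 := by rw [hX]; ring
      _ ≤ ((p ^ (d ^ 2 + 6 * d)) ^ (31 * d) * p ^ (2 * b * H)) ^ 2 := by gcongr
      _ = p ^ ((d ^ 2 + 6 * d) * (31 * d) * 2) * X ^ (4 * b) := by rw [hX]; ring
      _ ≤ _ := by gcongr
  have hexp := expo_ineq e d s r ν S he hd (sumM_le d) hr1 h1 h2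
  have hXR : (0 : ℝ) < X := by exact_mod_cast hX1
  -- natural number inequality
  set Q := ∏ j : Fin d, 2 ^ w j with hQ
  set P := ∏ j : Fin d, (2 * (b * X ^ ((j : ℕ) + 1) / 2 ^ w j) + 1) with hP
  have hN : Q * (J * P) ^ 2 * X ^ (62 * d * e) ≤
      (2 ^ r) ^ (2 * d) * 2 ^ (d * d + s * S) * ((2 ^ r) ^ ((d ^ 2 + 6 * d) * (31 * d) * 2) * X ^ (4 * b)) := by
    calc _ = (Q * P ^ 2) * (J ^ 2 * X ^ (62 * d * e)) := by ring
      _ ≤ _ := Nat.mul_le_mul hprod hV2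
  have hN2 : (n ^ 2) ^ (4 * b ^ 2) * (Q * (J * P) ^ 2) ≤ X ^ (4 * b) := by
    have hpos : 0 < X ^ (62 * d * e) * (2 ^ r) ^ (62 * d * e) := by positivity
    apply Nat.le_of_mul_le_mul_right _ hpos
    calc _ = (n ^ 2) ^ (4 * b ^ 2) * (2 ^ r) ^ (62 * d * e) * (Q * (J * P) ^ 2 * X ^ (62 * d * e)) := by ring
      _ ≤ ((2 ^ ν) ^ 2) ^ (4 * b ^ 2) * (2 ^ r) ^ (62 * d * e) * 
          ((2 ^ r) ^ (2 * d) * 2 ^ (d * d + s * S) * ((2 ^ r) ^ ((d ^ 2 + 6 * d) * (31 * d) * 2) * X ^ (4 * b))) := by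
          gcongr
      _ = X ^ (4 * b) * 2 ^ (r * (62 * d * e) + r * ((d ^ 2 + 6 * d) * (31 * d) * 2) + r * (2 * d) + (d * d + s * S) + 2 * ν * (4 * b ^ 2)) := by
          simp only [← pow_mul, pow_add, mul_assoc]
          rw [show ν * (2 * (4 * b ^ 2)) = 2 * (ν * (4 * b ^ 2)) by ring]
          ring
      _ ≤ X ^ (4 * b) * 2 ^ (2 * s * (62 * d * e)) := by
          gcongr
          norm_num
      _ = X ^ (4 * b) * (2 ^ (2 * s)) ^ (62 * d * e) := by rw [pow_mul 2 (2 * s)]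
      _ ≤ X ^ (4 * b) * (X * 2 ^ r) ^ (62 * d * e) := by
          gcongr
          exact hXlt.trans (by gcongr)
      _ = _ := by rw [mul_pow]
  have hb0 : 4 * b ^ 2 ≠ 0 := by rw [hb]; positivity
  refine le_of_pow_le_pow_left₀ hb0 (by positivity) ?_
  have hpos : (0 : ℝ) < (X : ℝ) ^ (4 * b) := by positivity
  refine le_of_mul_le_mul_right ?_ hpos
  have hN2R : ((n : ℝ) ^ 2) ^ (4 * b ^ 2) * ((Q : ℝ) * ((J * P : ℕ) : ℝ) ^ 2) ≤ (X : ℝ) ^ (4 * b) := by exact_mod_cast hN2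
  calc _ = ((n : ℝ) ^ 2) ^ (4 * b ^ 2) * (T ^ (4 * b ^ 2) * (X : ℝ) ^ (4 * b)) := by rw [mul_pow]; ring
    _ ≤ ((n : ℝ) ^ 2) ^ (4 * b ^ 2) * ((X : ℝ) ^ (8 * b ^ 2) * (Q : ℕ) * ((J * P : ℕ) : ℝ) ^ 2) := by
        gcongr
    _ = (X : ℝ) ^ (8 * b ^ 2) * (((n : ℝ) ^ 2) ^ (4 * b ^ 2) * ((Q : ℝ) * ((J * P : ℕ) : ℝ) ^ 2)) := by ring
    _ ≤ (X : ℝ) ^ (8 * b ^ 2) * (X : ℝ) ^ (4 * b) := by gcongr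
    _ = _ := by
        rw [← pow_mul]
        congr 2
        ring


lemma pow_two_pow_form (s : ℕ) (hs : 2 ≤ s) (u : ℤ) (i : ℕ) :
    ∃ u' : ℤ, (1 + 2 ^ s * u) ^ (2 ^ i) = 1 + 2 ^ (s + i) * u' ∧ (2 : ℤ) ∣ u' - u := by
  induction i with
  | zero => exact ⟨u, by simp, by simp⟩
  | succ i ih =>
    obtain ⟨u', h1, h2⟩ := ih
    obtain ⟨t, ht⟩ : ∃ t, s + i = t + 2 := ⟨s + i - 2, by omega⟩
    refine ⟨u' + 2 ^ (t + 1) * u' ^ 2, ?_, ?_⟩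
    · rw [pow_succ, pow_mul, h1, ← add_assoc, ht]
      ring
    · have : (2 : ℤ) ∣ 2 ^ (t + 1) * u' ^ 2 := by rw [pow_succ]; exact ⟨2 ^ t * u' ^ 2, by ring⟩
      have := dvd_add h2 this
      refine (congrArg (Dvd.dvd _) ?_).mp this; ring

lemma postnikov (f : ℤ → ℂ) (hmul : ∀ z z', f (z * z') = f z * f z') (h1 : f 1 = 1) (m s : ℕ) (hs : 2 ≤ s)
    (hsm : s < m) (hper : ∀ z, f (1 + 2 ^ m * z) = 1) (hne : ∃ z, f (1 + 2 ^ (m - 1) * z) ≠ 1) (N : ℕ) (hN : m ≤ N) :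
    ∃ a : ℤ, Odd a ∧ ∀ u L : ℤ, (1 + 2 ^ s * u) ^ (2 ^ N) = 1 + 2 ^ (s + N) * L →
      f (1 + 2 ^ s * u) = ZMod.stdAddChar ((a * L : ℤ) : ZMod (2 ^ (m - s))) := by
  obtain ⟨W, hW⟩ : ∃ W, m = s + W := ⟨m - s, by omega⟩
  have hW1 : 1 ≤ W := by omega
  rw [show m - s = W by omega]
  -- uniqueness of L
  have huniq : ∀ L L' : ℤ, (1 : ℤ) + 2 ^ (s + N) * L = 1 + 2 ^ (s + N) * L' → L = L' := by
    intro L L' h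
    have h' : (2 : ℤ) ^ (s + N) * L = 2 ^ (s + N) * L' := by linarith
    exact mul_left_cancel₀ (by positivity) h'
  have hWN : (2 : ℤ) ^ W ∣ 2 ^ (s + N) := pow_dvd_pow _ (by omega)
  -- product
  have hprod : ∀ z z' L L' : ℤ, z ^ (2 ^ N) = 1 + 2 ^ (s + N) * L → z' ^ (2 ^ N) = 1 + 2 ^ (s + N) * L' →
      ∃ M, (z * z') ^ (2 ^ N) = 1 + 2 ^ (s + N) * M ∧ (2 : ℤ) ^ W ∣ M - (L + L') := by
    intro z z' L L' h h'
    refine ⟨L + L' + 2 ^ (s + N) * (L * L'), ?_, ?_⟩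
    · rw [mul_pow, h, h']; ring
    · rw [add_sub_cancel_left]
      exact hWN.mul_right _
  -- trivial kernel
  have hker : ∀ u L : ℤ, (1 + 2 ^ s * u) ^ (2 ^ N) = 1 + 2 ^ (s + N) * L → (2 : ℤ) ^ W ∣ L → f (1 + 2 ^ s * u) = 1 := by
    intro u L hL hdvd
    have key : ∀ i ≤ W, ∃ v, 2 ^ s * u = 2 ^ (s + i) * v := by
      intro i hi
      induction i with
      | zero => exact ⟨u, by simp⟩
      | succ i ih =>
        obtain ⟨v, hv⟩ := ih (by omega)
        obtain ⟨v', h3, h4⟩ := pow_two_pow_form (s + i) (by omega) v N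
        rw [← hv, hL] at h3
        have h5 : L = 2 ^ i * v' := by
          apply huniq
          rw [h3]; ring
        have h6 : (2 : ℤ) ^ (i + 1) ∣ 2 ^ i * v' := by
          rw [← h5]; exact (pow_dvd_pow _ hi).trans hdvd
        rw [pow_succ] at h6
        have h7 : (2 : ℤ) ∣ v' := (mul_dvd_mul_iff_left (by positivity)).1 h6
        have h8 : (2 : ℤ) ∣ v := by
          have := dvd_sub h7 h4; simpa using this
        obtain ⟨c, rfl⟩ := h8
        exact ⟨c, by rw [hv]; ring⟩
    obtain ⟨v, hv⟩ := key W le_rfl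
    rw [hv, ← hW]; exact hper v
  obtain ⟨l, hl, hl2⟩ := pow_two_pow_form s hs 1 N
  set g : ℤ := 1 + 2 ^ s * 1 with hg
  have hlodd : Odd l := by
    obtain ⟨c, hc⟩ := hl2
    exact ⟨c, by linarith⟩
  have hgk : ∀ k : ℕ, ∃ M, (g ^ k) ^ (2 ^ N) = 1 + 2 ^ (s + N) * M ∧ (2 : ℤ) ^ W ∣ M - k * l := by
    intro k
    induction k with
    | zero => exact ⟨0, by simp, by simp⟩
    | succ k ih =>
      obtain ⟨M, hM1, hM2⟩ := ih
      obtain ⟨M', h3, h4⟩ := hprod (g ^ k) g M l hM1 hl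
      refine ⟨M', by rw [pow_succ, h3], ?_⟩
      have := dvd_add h4 hM2
      refine (congrArg (Dvd.dvd _) ?_).mp this
      push_cast; ring
  have hform : ∀ z z' : ℤ, (2 : ℤ) ^ s ∣ z - 1 → (2 : ℤ) ^ s ∣ z' - 1 → (2 : ℤ) ^ s ∣ z * z' - 1 := by
    intro z z' h h'
    have := dvd_add (h.mul_right z') h'
    refine (congrArg (Dvd.dvd _) ?_).mp this; ring
  have hgform : ∀ k : ℕ, (2 : ℤ) ^ s ∣ g ^ k - 1 := by
    intro k
    induction k with
    | zero => simp
    | succ k ih => rw [pow_succ]; exact hform _ _ ih ⟨1, by rw [hg]; ring⟩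
  have hker' : ∀ z L : ℤ, (2 : ℤ) ^ s ∣ z - 1 → z ^ (2 ^ N) = 1 + 2 ^ (s + N) * L → (2 : ℤ) ^ W ∣ L → f z = 1 := by
    intro z L hz hL hd
    obtain ⟨u, hu⟩ := hz
    have : z = 1 + 2 ^ s * u := by linarith
    subst this
    exact hker u L hL hd
  have hfpow : ∀ (z : ℤ) (k : ℕ), f (z ^ k) = f z ^ k := by
    intro z k
    induction k with
    | zero => simp [h1]
    | succ k ih => rw [pow_succ, hmul, ih, pow_succ]
  have hroot : f g ^ (2 ^ W) = 1 := by
    rw [← hfpow]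
    obtain ⟨M, hM1, hM2⟩ := hgk (2 ^ W)
    refine hker' _ M (hgform _) hM1 ?_
    have h9 : (2 : ℤ) ^ W ∣ ((2 ^ W : ℕ) : ℤ) * l := by push_cast; exact dvd_mul_right _ _
    have := dvd_add hM2 h9
    simpa using this
  have hfg : ∃ a' : ℕ, f g = ZMod.stdAddChar ((a' : ℤ) : ZMod (2 ^ W)) := by
    have hu : f g ≠ 0 := by
      intro h0
      rw [h0, zero_pow (by positivity)] at hroot
      exact zero_ne_one hroot
    obtain ⟨i, -, hi⟩ := (Complex.mem_rootsOfUnity (2 ^ W) (Units.mk0 (f g) hu)).1 (by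
      rw [mem_rootsOfUnity, Units.ext_iff]
      simpa using hroot)
    refine ⟨i, ?_⟩
    rw [ZMod.stdAddChar_coe]
    rw [Units.val_mk0] at hi
    rw [← hi]
    congr 1
    push_cast
    ring
  obtain ⟨a', ha'⟩ := hfg
  -- inverse of l
  obtain ⟨l', hl'⟩ : ∃ l' : ℤ, (2 : ℤ) ^ W ∣ l * l' - 1 := by
    have : IsCoprime l ((2 : ℤ) ^ W) := by
      apply IsCoprime.pow_right
      obtain ⟨c, hc⟩ := hlodd
      exact ⟨1, -c, by rw [hc]; ring⟩
    obtain ⟨x, y, hxy⟩ := this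
    exact ⟨x, ⟨-y, by linarith⟩⟩
  have hmain : ∀ u L : ℤ, (1 + 2 ^ s * u) ^ (2 ^ N) = 1 + 2 ^ (s + N) * L →
      f (1 + 2 ^ s * u) = ZMod.stdAddChar (((a' * l') * L : ℤ) : ZMod (2 ^ W)) := by
    intro u L hL
    -- choose k
    obtain ⟨k, hk⟩ : ∃ k : ℕ, (2 : ℤ) ^ W ∣ k - (-(L * l')) := by
      refine ⟨((-(L * l')) % (2 ^ W)).toNat, ?_⟩
      rw [Int.toNat_of_nonneg (Int.emod_nonneg _ (by positivity))]
      exact (Int.mod_modEq _ _).symm.dvd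
    obtain ⟨M, hM1, hM2⟩ := hgk k
    obtain ⟨M', h3, h4⟩ := hprod _ _ L M hL hM1
    have hone : f ((1 + 2 ^ s * u) * g ^ k) = 1 := by
      refine hker' _ M' (hform _ _ ⟨u, by ring⟩ (hgform k)) h3 ?_
      -- M' ≡ L + M ≡ L + k l ≡ L - L l' l ≡ 0
      have e1 := dvd_add h4 hM2
      have e2 := dvd_add e1 (hk.mul_right l)
      have e3 := dvd_sub e2 (hl'.mul_right L)
      refine (congrArg (Dvd.dvd _) ?_).mp e3; ring
    rw [hmul, hfpow, ha', ← AddChar.map_nsmul_eq_pow] at hone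
    have : f (1 + 2 ^ s * u) * (ZMod.stdAddChar (k • (((a' : ℤ)) : ZMod (2 ^ W))) * ZMod.stdAddChar (-(k • (((a' : ℤ)) : ZMod (2 ^ W))))) = ZMod.stdAddChar (-(k • (((a' : ℤ)) : ZMod (2 ^ W)))) := by
      rw [← mul_assoc, hone, one_mul]
    rw [← AddChar.map_add_eq_mul, add_neg_cancel, AddChar.map_zero_eq_one, mul_one] at this
    rw [this]
    congr 1
    have hk2 : ((k : ℤ) : ZMod (2 ^ W)) = ((-(L * l') : ℤ) : ZMod (2 ^ W)) := by
      rw [ZMod.intCast_eq_intCast_iff_dvd_sub]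
      push_cast
      have := dvd_neg.2 hk
      refine (congrArg (Dvd.dvd _) ?_).mp this; ring
    rw [nsmul_eq_mul]
    push_cast at hk2 ⊢
    rw [hk2]; ring
  refine ⟨a' * l', ?_, hmain⟩
  by_contra hodd
  rw [Int.not_odd_iff_even] at hodd
  obtain ⟨c, hc⟩ := hodd
  obtain ⟨v, hv⟩ := hne
  apply hv
  obtain ⟨V, rfl⟩ : ∃ V, W = V + 1 := ⟨W - 1, by omega⟩
  have hm1 : m - 1 = s + V := by omega
  obtain ⟨v', h3, h4⟩ := pow_two_pow_form (s + V) (by omega) v N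
  have := hmain (2 ^ V * v) (2 ^ V * v') (by
    rw [← mul_assoc, ← pow_add, h3]; ring)
  rw [hm1, pow_add, mul_assoc, this]
  have : (((a' * l') * (2 ^ V * v') : ℤ) : ZMod (2 ^ (V + 1))) = 0 := by
    rw [ZMod.intCast_zmod_eq_zero_iff_dvd]
    push_cast
    rw [hc]
    exact ⟨c * v', by ring⟩
  rw [this, AddChar.map_zero_eq_one]


lemma exp_term (A : ℤ) (p q : ℕ) : Complex.exp (2 * Real.pi * Complex.I * (A * 2 ^ p / 2 ^ q)) =
    ZMod.stdAddChar ((A : ℤ) : ZMod (2 ^ (q - p))) := by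
  rcases le_total p q with h | h
  · obtain ⟨r, rfl⟩ := Nat.exists_eq_add_of_le h
    rw [Nat.add_sub_cancel_left, ZMod.stdAddChar_coe]
    congr 1
    push_cast
    rw [pow_add]
    field_simp
  · obtain ⟨r, rfl⟩ := Nat.exists_eq_add_of_le h
    rw [show q - (q + r) = 0 by omega]
    have h2 : ((A : ℤ) : ZMod (2 ^ 0)) = ((A * 2 ^ r : ℤ) : ZMod (2 ^ 0)) := by
      rw [ZMod.intCast_eq_intCast_iff_dvd_sub]
      simp
    rw [h2, ZMod.stdAddChar_coe]
    congr 1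
    push_cast
    rw [pow_add]
    field_simp

lemma choose_two_pow (N J : ℕ) (hJ : 1 ≤ J) (hJN : J ≤ 2 ^ N) :
    ∃ o : ℕ, Odd o ∧ (2 ^ N).choose J * 2 ^ (J.factorization 2) = o * 2 ^ N := by
  have h := Nat.factorization_choose_prime_pow_add_factorization (p := 2) (n := N) (k := J) Nat.prime_two hJN (by omega)
  have hc : (2 ^ N).choose J ≠ 0 := (Nat.choose_pos hJN).ne'
  refine ⟨(2 ^ N).choose J / 2 ^ (((2 ^ N).choose J).factorization 2), ?_, ?_⟩
  · rw [← Nat.not_even_iff_odd, even_iff_two_dvd]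
    exact Nat.not_dvd_ordCompl Nat.prime_two hc
  · have h2 := Nat.ordProj_mul_ordCompl_eq_self ((2 ^ N).choose J) 2
    have h3 : 2 ^ (((2 ^ N).choose J).factorization 2) * 2 ^ (J.factorization 2) = 2 ^ N := by
      rw [← pow_add, h]
    generalize (2 ^ N).choose J / 2 ^ (((2 ^ N).choose J).factorization 2) = o at h2 ⊢
    generalize 2 ^ (((2 ^ N).choose J).factorization 2) = P at h2 h3
    rw [← h2, ← h3]; ring

lemma postnikov_poly (f : ℤ → ℂ) (hmul : ∀ z z', f (z * z') = f z * f z') (h1 : f 1 = 1) (m s d : ℕ) (hs : 2 ≤ s)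
    (hsm : s < m) (hper : ∀ z, f (1 + 2 ^ m * z) = 1) (hne : ∃ z, f (1 + 2 ^ (m - 1) * z) ≠ 1)
    (hd : m ≤ s * d) (hds : d + 1 ≤ 2 ^ s) :
    ∃ o : ℕ → ℤ, (∀ j < d, Odd (o j)) ∧ ∀ u : ℤ, f (1 + 2 ^ s * u) =
      ∏ j : Fin d, ZMod.stdAddChar ((o j * u ^ ((j : ℕ) + 1) : ℤ) :
        ZMod (2 ^ (m + ((j : ℕ) + 1).factorization 2 - s * ((j : ℕ) + 1)))) := by
  obtain ⟨a, ha, hf⟩ := postnikov f hmul h1 m s hs hsm hper hne (m + d) (by omega)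
  set N := m + d with hN
  have hdN : d ≤ 2 ^ N := (by omega : d ≤ N).trans Nat.lt_two_pow_self.le
  have hch : ∀ j : ℕ, ∃ o : ℕ, j < 2 ^ N → (Odd o ∧ (2 ^ N).choose (j + 1) * 2 ^ ((j + 1).factorization 2) = o * 2 ^ N) := by
    intro j
    by_cases h : j < 2 ^ N
    · obtain ⟨o, ho⟩ := choose_two_pow N (j + 1) (by omega) h
      exact ⟨o, fun _ => ho⟩
    · exact ⟨0, fun h' => absurd h' h⟩
  choose o ho using hch
  refine ⟨fun j => a * o j, ?_, ?_⟩
  · intro j hj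
    exact ha.mul (by exact_mod_cast (ho j (by omega)).1)
  intro u
  obtain ⟨L, hL, -⟩ := pow_two_pow_form s hs u N
  rw [hf u L hL, ZMod.stdAddChar_coe]
  have hbin : (2 : ℤ) ^ (s + N) * L = ∑ j ∈ range (2 ^ N), (2 ^ s * u) ^ (j + 1) * ((2 ^ N).choose (j + 1) : ℤ) := by
    have h2 := add_pow (2 ^ s * u) 1 (2 ^ N)
    rw [Finset.sum_range_succ', add_comm, hL] at h2
    simp only [one_pow, mul_one, pow_zero, Nat.choose_zero_right, Nat.cast_one] at h2
    linarith
  have hbinC : ((2 : ℂ) ^ (s + N) * L) = ∑ j ∈ range (2 ^ N), (2 ^ s * (u : ℂ)) ^ (j + 1) * ((2 ^ N).choose (j + 1) : ℂ) := by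
    exact_mod_cast congrArg (Int.cast : ℤ → ℂ) hbin
  have hterm : ∀ j ∈ range (2 ^ N), (2 ^ s * (u : ℂ)) ^ (j + 1) * ((2 ^ N).choose (j + 1) : ℂ) * (a / 2 ^ (s + N) / 2 ^ (m - s)) =
      ((a * o j * u ^ (j + 1) : ℤ) : ℂ) * 2 ^ (s * (j + 1)) / 2 ^ (m + (j + 1).factorization 2) := by
    intro j hj
    have h3 := (ho j (mem_range.1 hj)).2
    have h3C : ((2 ^ N).choose (j + 1) : ℂ) * 2 ^ ((j + 1).factorization 2) = o j * 2 ^ N := by exact_mod_cast h3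
    obtain ⟨W, hW⟩ : ∃ W, m = s + W := ⟨m - s, by omega⟩
    rw [show m - s = W by omega, hW]
    have hc : ((2 ^ N).choose (j + 1) : ℂ) = o j * 2 ^ N / 2 ^ ((j + 1).factorization 2) := by
      rw [eq_div_iff (pow_ne_zero _ two_ne_zero)]; exact h3C
    rw [hc]
    push_cast
    rw [mul_pow, ← pow_mul, pow_add 2 s N, pow_add 2 (s + W), pow_add 2 s W]
    field_simp
  have hsum : (a * L : ℂ) / 2 ^ (m - s) = ∑ j ∈ range (2 ^ N), ((a * o j * u ^ (j + 1) : ℤ) : ℂ) * 2 ^ (s * (j + 1)) / 2 ^ (m + (j + 1).factorization 2) := by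
    rw [← Finset.sum_congr rfl hterm, ← Finset.sum_mul, ← hbinC]
    field_simp
  have : 2 * Real.pi * Complex.I * ((a * L : ℤ) : ℂ) / ((2 ^ (m - s) : ℕ) : ℂ) =
      ∑ j ∈ range (2 ^ N), 2 * Real.pi * Complex.I * (((a * o j * u ^ (j + 1) : ℤ) : ℂ) * 2 ^ (s * (j + 1)) / 2 ^ (m + (j + 1).factorization 2)) := by
    rw [← Finset.mul_sum, ← hsum]
    push_cast
    ring
  rw [this, Complex.exp_sum, ← Finset.prod_range_mul_prod_Ico _ hdN]
  rw [Finset.prod_eq_one (s := Ico d (2 ^ N)), mul_one]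
  · rw [← Fin.prod_univ_eq_prod_range (fun j => Complex.exp (2 * Real.pi * Complex.I * (((a * o j * u ^ (j + 1) : ℤ) : ℂ) * 2 ^ (s * (j + 1)) / 2 ^ (m + (j + 1).factorization 2)))) d]
    apply Finset.prod_congr rfl
    intro j _
    rw [exp_term]
  · intro j hj
    rw [mem_Ico] at hj
    rw [exp_term]
    obtain ⟨i, rfl⟩ := Nat.exists_eq_add_of_le hj.1
    have h4 : 2 ^ ((d + i + 1).factorization 2) ≤ d + i + 1 := Nat.ordProj_le 2 (by omega)
    have h5 : d + i + 1 ≤ 2 ^ (s * (i + 1)) := by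
      calc d + i + 1 ≤ 2 ^ s + i := by omega
        _ ≤ 2 ^ s * 2 ^ i := by
            have : i + 1 ≤ 2 ^ i := Nat.lt_two_pow_self
            have : 1 ≤ 2 ^ s := Nat.one_le_two_pow
            nlinarith
        _ = 2 ^ (s + i) := by rw [pow_add]
        _ ≤ _ := by
            apply Nat.pow_le_pow_right (by norm_num)
            nlinarith
    have h6 : (d + i + 1).factorization 2 ≤ s * (i + 1) :=
      (Nat.pow_le_pow_iff_right (by norm_num : 1 < 2)).1 (h4.trans h5)
    have h7 : m + (d + i + 1).factorization 2 - s * (d + i + 1) = 0 := by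
      have : s * (d + i + 1) = s * d + s * (i + 1) := by ring
      omega
    rw [h7]
    have h8 : ((a * o (d + i) * u ^ (d + i + 1) : ℤ) : ZMod (2 ^ 0)) = 0 := by
      rw [ZMod.intCast_zmod_eq_zero_iff_dvd]; simp
    rw [h8, AddChar.map_zero_eq_one]


lemma odd_isCoprime (z : ℤ) (hz : Odd z) (m : ℕ) : IsCoprime z ((2 ^ m : ℕ) : ℤ) := by
  push_cast
  apply IsCoprime.pow_right
  obtain ⟨c, hc⟩ := hz
  exact ⟨1, -c, by rw [hc]; ring⟩

lemma even_not_isCoprime (z : ℤ) (hz : Even z) (m : ℕ) (hm : 1 ≤ m) : ¬ IsCoprime z ((2 ^ m : ℕ) : ℤ) := by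
  push_cast
  rintro h
  have h2 : IsCoprime z 2 := h.of_isCoprime_of_dvd_right (dvd_pow_self 2 (by omega))
  have := h2.isUnit_of_dvd' (even_iff_two_dvd.1 hz) dvd_rfl
  rw [Int.isUnit_iff] at this
  omega

lemma primitive_reduce (n : ℕ) (χ : DirichletCharacter ℂ (2 ^ n)) (hχ : χ ≠ 1) :
    ∃ m, m ≤ n ∧ 1 ≤ m ∧ ∃ ψ : DirichletCharacter ℂ (2 ^ m), ψ ≠ 1 ∧ ψ.conductor = 2 ^ m ∧
      ∀ z : ℤ, χ (z : ZMod (2 ^ n)) = ψ (z : ZMod (2 ^ m)) := by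
  obtain ⟨m, hm, hc⟩ := (Nat.dvd_prime_pow Nat.prime_two).1 χ.conductor_dvd_level
  have hcne : χ.conductor ≠ 1 := by
    intro h
    exact hχ ((DirichletCharacter.eq_one_iff_conductor_eq_one (χ := χ) ).2 h)
  have hm1 : 1 ≤ m := by
    by_contra h
    have : m = 0 := by omega
    subst this
    exact hcne (by simpa using hc)
  refine ⟨m, hm, hm1, ?_⟩
  have key : ∃ ψ : DirichletCharacter ℂ χ.conductor, ψ.conductor = χ.conductor ∧
      ∀ z : ℤ, Odd z → χ (z : ZMod (2 ^ n)) = ψ (z : ZMod χ.conductor) := by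
    refine ⟨χ.primitiveCharacter, χ.primitiveCharacter_isPrimitive, ?_⟩
    intro z hz
    exact (χ.primitiveCharacter_apply_of_isCoprime (odd_isCoprime z hz n)).symm
  rw [hc] at key
  obtain ⟨ψ, h1, h2⟩ := key
  refine ⟨ψ, ?_, h1, ?_⟩
  · rintro rfl
    rw [DirichletCharacter.conductor_one] at h1
    exact hcne (by rw [hc, ← h1])
  · intro z
    rcases Int.even_or_odd z with hz | hz
    · rw [(χ.apply_eq_zero_iff z).2 (even_not_isCoprime z hz n (by omega)),
        (ψ.apply_eq_zero_iff z).2 (even_not_isCoprime z hz m hm1)]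
    · exact h2 z hz

lemma primitive_ne (m : ℕ) (hm : 1 ≤ m) (ψ : DirichletCharacter ℂ (2 ^ m)) (hψ : ψ.conductor = 2 ^ m) :
    ∃ z : ℤ, ψ ((1 + 2 ^ (m - 1) * z : ℤ) : ZMod (2 ^ m)) ≠ 1 := by
  by_contra hcon
  push Not at hcon
  have hd : 2 ^ (m - 1) ∣ 2 ^ m := pow_dvd_pow 2 (by omega)
  have h : ψ.FactorsThrough (2 ^ (m - 1)) := by
    rw [DirichletCharacter.factorsThrough_iff_ker_unitsMap hd]
    intro x hx
    rw [MonoidHom.mem_ker, Units.ext_iff, MulChar.coe_toUnitHom, Units.val_one]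
    rw [MonoidHom.mem_ker, Units.ext_iff, ZMod.unitsMap_val, ← ZMod.natCast_val,
      Units.val_one] at hx
    have h3 : (((x.val.val : ℤ) - 1 : ℤ) : ZMod (2 ^ (m - 1))) = 0 := by
      push_cast
      rw [hx, sub_self]
    rw [ZMod.intCast_zmod_eq_zero_iff_dvd] at h3
    obtain ⟨z, hz⟩ := h3
    rw [← hcon z]
    congr 1
    push_cast at hz
    rw [← hz]
    push_cast
    rw [ZMod.natCast_zmod_val]; ring
  have h4 : ψ.conductor ∣ 2 ^ (m - 1) := DirichletCharacter.conductor_dvd_of_mem_conductorSet (χ := ψ) h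
  rw [hψ, Nat.pow_dvd_pow_iff_le_right (by norm_num)] at h4
  omega

lemma complete_sum (M : ℕ) [NeZero M] (ψ : DirichletCharacter ℂ M) (hψ : ψ ≠ 1) (t : ℤ) :
    ∑ k ∈ range M, ψ ((t + k : ℤ) : ZMod M) = 0 := by
  have h1 : ∑ k ∈ range M, ψ ((t + k : ℤ) : ZMod M) = ∑ x : ZMod M, ψ (t + x) := by
    refine Finset.sum_nbij' (fun k => (k : ZMod M)) (fun x => x.val) ?_ ?_ ?_ ?_ ?_
    · intro k _; exact mem_univ _
    · intro x _; exact mem_range.2 (ZMod.val_lt x)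
    · intro k hk; exact ZMod.val_cast_of_lt (mem_range.1 hk)
    · intro x _; exact ZMod.natCast_zmod_val x
    · intro k _; push_cast; rfl
  rw [h1, ← MulChar.sum_eq_zero_of_ne_one hψ]
  exact Equiv.sum_comp (Equiv.addLeft (t : ZMod M)) ψ

lemma incomplete_sum (M : ℕ) [NeZero M] (ψ : DirichletCharacter ℂ M) (hψ : ψ ≠ 1) (N : ℕ) : ∀ (t : ℤ),
    ‖∑ k ∈ range N, ψ ((t + k : ℤ) : ZMod M)‖ ≤ M := by
  induction N using Nat.strong_induction_on with
  | _ N ih =>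
    intro t
    rcases lt_or_ge N M with h | h
    · refine (norm_sum_le _ _).trans ?_
      calc _ ≤ ∑ k ∈ range N, (1 : ℝ) := Finset.sum_le_sum (fun k _ => ψ.norm_le_one _)
        _ = N := by simp
        _ ≤ M := by exact_mod_cast h.le
    · have hM : 0 < M := NeZero.pos M
      have := ih (N - M) (by omega) (t + M)
      obtain ⟨K, rfl⟩ := Nat.exists_eq_add_of_le h
      rw [Nat.add_sub_cancel_left] at this
      rw [Finset.sum_range_add, complete_sum M ψ hψ t, zero_add]
      refine le_trans (le_of_eq ?_) this
      congr 1
      apply Finset.sum_congr rfl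
      intro k _
      congr 1
      push_cast; ring

lemma inner_bound (m e d s r ν n : ℕ) (ψ : DirichletCharacter ℂ (2 ^ m))
    (hψ : ψ.conductor = 2 ^ m) (he : 1 ≤ e) (hd : d + 1 = 64 * e)
    (hr : 64 * d ^ 2 + 1 ≤ 2 ^ r) (h1 : 2240 * r * d ≤ s) (h2 : 2 ^ 18 * ν * d ^ 2 ≤ s) (hn : n ≤ 2 ^ ν)
    (hs1 : m ≤ s * d) (hs2 : s * d ≤ m + d) :
    ∃ X : ℕ, 1 ≤ X ∧ X ≤ 2 ^ (2 * s) ∧ ∀ c : ℤ, Odd c →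
      (n : ℝ) ^ 2 * ‖∑ x ∈ range X, ∑ y ∈ range X, ψ ((1 + 2 ^ s * (c * x * y) : ℤ) : ZMod (2 ^ m))‖ ≤ (X : ℝ) ^ 2 := by
  have hr1 : 1 ≤ r := by
    by_contra hh
    have : r = 0 := by omega
    subst this
    have : 1 ≤ d := by omega
    nlinarith
  have hd63 : 63 ≤ d := by omega
  have hs2240 : 2240 * d ≤ s := by nlinarith
  have hrs : r ≤ s := by nlinarith
  have hsm : s < m := by nlinarith
  obtain ⟨X, hX1, hX2, hX⟩ := T_bound e d s r ν n he hd hr h1 h2 hn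
  refine ⟨X, hX1, hX2, ?_⟩
  intro c hc
  obtain ⟨o, ho, hf⟩ := postnikov_poly (fun z => ψ ((z : ℤ) : ZMod (2 ^ m)))
    (by intro z z'; push_cast; rw [map_mul]) (by simp) m s d (by omega) hsm
    (by
      intro z
      have : (((1 + 2 ^ m * z : ℤ)) : ZMod (2 ^ m)) = 1 := by
        push_cast
        have : ((2 ^ m : ℕ) : ZMod (2 ^ m)) = 0 := ZMod.natCast_self _
        push_cast at this
        rw [this]; simp
      rw [this, map_one])
    (primitive_ne m (by omega) ψ hψ) hs1 (by
      have h5 : 2 ^ r ≤ 2 ^ s := Nat.pow_le_pow_right (by norm_num) hrs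
      nlinarith)
  have hv : ∀ j : Fin d, ((j : ℕ) + 1).factorization 2 ≤ d := by
    intro j
    have h4 : 2 ^ (((j : ℕ) + 1).factorization 2) ≤ (j : ℕ) + 1 := Nat.ordProj_le 2 (by omega)
    have := (Nat.lt_two_pow_self (n := ((j : ℕ) + 1).factorization 2))
    omega
  have hsj : ∀ j : Fin d, s * d = s * (d - ((j : ℕ) + 1)) + s * ((j : ℕ) + 1) := by
    intro j
    rw [← mul_add]
    congr 1
    omega
  have := hX (fun j => m + ((j : ℕ) + 1).factorization 2 - s * ((j : ℕ) + 1))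
    (by intro j; have := hsj j; have := hv j; omega)
    (by intro j; have := hsj j; have := hv j; omega)
    (fun j => ((o j * c ^ ((j : ℕ) + 1) : ℤ) : ZMod (2 ^ _)))
    (by
      intro j
      rw [ZMod.coe_int_isUnit_iff_isCoprime]
      exact (odd_isCoprime _ ((ho j j.2).mul hc.pow) _).symm)
  refine le_trans (le_of_eq ?_) this
  congr 2
  apply Finset.sum_congr rfl
  intro x _
  apply Finset.sum_congr rfl
  intro y _
  refine (hf (c * x * y)).trans ?_
  apply Finset.prod_congr rfl
  intro j _
  congr 1
  push_cast
  ring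


lemma shift_sum (g : ℤ → ℂ) (hg : ∀ z, ‖g z‖ ≤ 1) (t : ℤ) (N h : ℕ) :
    ‖∑ k ∈ range N, g (t + k) - ∑ k ∈ range N, g (t + h + k)‖ ≤ 2 * h := by
  have h1 : ∑ k ∈ range (h + N), g (t + k) = ∑ k ∈ range h, g (t + k) + ∑ k ∈ range N, g (t + h + k) := by
    rw [Finset.sum_range_add]
    congr 1
    apply Finset.sum_congr rfl
    intro k _
    congr 1
    push_cast; ring
  have h2 : ∑ k ∈ range (N + h), g (t + k) = ∑ k ∈ range N, g (t + k) + ∑ k ∈ range h, g (t + N + k) := by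
    rw [Finset.sum_range_add]
    congr 1
    apply Finset.sum_congr rfl
    intro k _
    congr 1
    push_cast; ring
  rw [add_comm h N] at h1
  have h3 : ∑ k ∈ range N, g (t + k) - ∑ k ∈ range N, g (t + h + k) =
      ∑ k ∈ range h, g (t + k) - ∑ k ∈ range h, g (t + N + k) := by
    rw [h1] at h2
    linear_combination -h2
  have hb : ∀ t' : ℤ, ‖∑ k ∈ range h, g (t' + k)‖ ≤ h := by
    intro t'
    refine (norm_sum_le _ _).trans ?_
    calc _ ≤ ∑ k ∈ range h, (1 : ℝ) := Finset.sum_le_sum (fun k _ => hg _)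
      _ = h := by simp
  rw [h3]
  refine (norm_sub_le _ _).trans ?_
  have := hb t
  have := hb (t + N)
  linarith

lemma shifted_bound (m s n X N : ℕ) (ψ : DirichletCharacter ℂ (2 ^ m)) (hm : 1 ≤ m) (hs : 1 ≤ s) (hX1 : 1 ≤ X)
    (hX2 : X ≤ 2 ^ (2 * s)) (hn : 1 ≤ n)
    (hX : ∀ c : ℤ, Odd c →
      (n : ℝ) ^ 2 * ‖∑ x ∈ range X, ∑ y ∈ range X, ψ ((1 + 2 ^ s * (c * x * y) : ℤ) : ZMod (2 ^ m))‖ ≤ (X : ℝ) ^ 2)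
    (t : ℤ) :
    ‖∑ k ∈ range N, ψ ((t + k : ℤ) : ZMod (2 ^ m))‖ ≤ 2 ^ (5 * s + 1) + N / (n : ℝ) ^ 2 := by
  set g : ℤ → ℂ := fun z => ψ ((z : ℤ) : ZMod (2 ^ m)) with hg
  have hg1 : ∀ z, ‖g z‖ ≤ 1 := fun z => ψ.norm_le_one _
  have hn' : (0 : ℝ) < (n : ℝ) ^ 2 := by positivity
  have hXp : (0 : ℝ) < (X : ℝ) ^ 2 := by
    have : (0 : ℝ) < X := by exact_mod_cast hX1
    positivity
  set F := ∑ k ∈ range N, g (t + k) with hF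
  -- pointwise
  have hpt : ∀ z : ℤ, ‖∑ x ∈ range X, ∑ y ∈ range X, g (z + 2 ^ s * (x * y))‖ ≤ (X : ℝ) ^ 2 / (n : ℝ) ^ 2 := by
    intro z
    rcases Int.even_or_odd z with hz | hz
    · have : ∑ x ∈ range X, ∑ y ∈ range X, g (z + 2 ^ s * (x * y)) = 0 := by
        apply Finset.sum_eq_zero
        intro x _
        apply Finset.sum_eq_zero
        intro y _
        refine (ψ.apply_eq_zero_iff _).2 (even_not_isCoprime _ ?_ m hm)
        refine hz.add (Even.mul_right ?_ _)
        exact (Int.even_pow.2 ⟨even_two, by omega⟩)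
      rw [this, norm_zero]
      positivity
    · obtain ⟨c, w, hcw⟩ := odd_isCoprime z hz m
      have hc : Odd c := by
        rw [← Int.not_even_iff_odd]
        intro hc
        have h3 : Even (c * z + w * ((2 ^ m : ℕ) : ℤ)) := by
          refine (hc.mul_right _).add (Even.mul_left ?_ _)
          push_cast
          exact (Int.even_pow.2 ⟨even_two, by omega⟩)
        rw [hcw] at h3
        exact absurd h3 (by decide)
      have hzc : (c : ZMod (2 ^ m)) * z = 1 := by
        have := congrArg (Int.cast : ℤ → ZMod (2 ^ m)) hcw
        push_cast at this
        have h0 : ((2 ^ m : ℕ) : ZMod (2 ^ m)) = 0 := ZMod.natCast_self _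
        push_cast at h0
        rw [h0] at this
        simpa using this
      have h4 : ∑ x ∈ range X, ∑ y ∈ range X, g (z + 2 ^ s * (x * y)) =
          g z * ∑ x ∈ range X, ∑ y ∈ range X, ψ ((1 + 2 ^ s * (c * x * y) : ℤ) : ZMod (2 ^ m)) := by
        rw [Finset.mul_sum]
        apply Finset.sum_congr rfl
        intro x _
        rw [Finset.mul_sum]
        apply Finset.sum_congr rfl
        intro y _
        rw [hg]
        simp only
        rw [← map_mul]
        congr 1
        push_cast
        linear_combination (-2 ^ s * (x : ZMod (2 ^ m)) * y) * hzc
      rw [h4, norm_mul, le_div_iff₀ hn']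
      have h5 := hX c hc
      have h6 := hg1 z
      calc _ ≤ 1 * ‖∑ x ∈ range X, ∑ y ∈ range X, ψ ((1 + 2 ^ s * (c * x * y) : ℤ) : ZMod (2 ^ m))‖ * (n : ℝ) ^ 2 := by
            gcongr
        _ ≤ _ := by linarith
  have hsh : ∀ x ∈ range X, ∀ y ∈ range X, ‖F - ∑ k ∈ range N, g (t + k + 2 ^ s * (x * y))‖ ≤ 2 ^ (5 * s + 1) := by
    intro x hx y hy
    have := shift_sum g hg1 t N (2 ^ s * (x * y))
    have h7 : 2 * (2 ^ s * (x * y)) ≤ 2 ^ (5 * s + 1) := by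
      have hx' : x ≤ 2 ^ (2 * s) := (mem_range.1 hx).le.trans hX2
      have hy' : y ≤ 2 ^ (2 * s) := (mem_range.1 hy).le.trans hX2
      calc 2 * (2 ^ s * (x * y)) ≤ 2 * (2 ^ s * (2 ^ (2 * s) * 2 ^ (2 * s))) := by gcongr
        _ = _ := by ring
    have h7R : 2 * (((2 ^ s * (x * y) : ℕ)) : ℝ) ≤ 2 ^ (5 * s + 1) := by exact_mod_cast h7
    refine le_trans (le_of_eq ?_) (this.trans h7R)
    congr 2
    apply Finset.sum_congr rfl
    intro k _
    congr 1
    push_cast; ring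
  have hsum : ∑ x ∈ range X, ∑ y ∈ range X, ∑ k ∈ range N, g (t + k + 2 ^ s * (x * y)) =
      ∑ k ∈ range N, ∑ x ∈ range X, ∑ y ∈ range X, g (t + k + 2 ^ s * (x * y)) := by
    symm
    rw [Finset.sum_comm]
    apply Finset.sum_congr rfl
    intro x _
    rw [Finset.sum_comm]
  have htot : (X : ℂ) ^ 2 * F = ∑ x ∈ range X, ∑ y ∈ range X, (F - ∑ k ∈ range N, g (t + k + 2 ^ s * (x * y))) +
      ∑ k ∈ range N, ∑ x ∈ range X, ∑ y ∈ range X, g (t + k + 2 ^ s * (x * y)) := by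
    rw [← hsum]
    simp only [Finset.sum_sub_distrib, Finset.sum_const, card_range, nsmul_eq_mul]
    ring
  have hfin : (X : ℝ) ^ 2 * ‖F‖ ≤ (X : ℝ) ^ 2 * (2 ^ (5 * s + 1) + N / (n : ℝ) ^ 2) := by
    calc (X : ℝ) ^ 2 * ‖F‖ = ‖(X : ℂ) ^ 2 * F‖ := by simp
      _ ≤ ‖∑ x ∈ range X, ∑ y ∈ range X, (F - ∑ k ∈ range N, g (t + k + 2 ^ s * (x * y)))‖ +
          ‖∑ k ∈ range N, ∑ x ∈ range X, ∑ y ∈ range X, g (t + k + 2 ^ s * (x * y))‖ := by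
          rw [htot]; exact norm_add_le _ _
      _ ≤ ∑ x ∈ range X, ∑ y ∈ range X, (2 : ℝ) ^ (5 * s + 1) + ∑ k ∈ range N, (X : ℝ) ^ 2 / (n : ℝ) ^ 2 := by
          gcongr ?_ + ?_
          · refine (norm_sum_le _ _).trans (Finset.sum_le_sum fun x hx => ?_)
            exact (norm_sum_le _ _).trans (Finset.sum_le_sum fun y hy => hsh x hx y hy)
          · exact (norm_sum_le _ _).trans (Finset.sum_le_sum fun k _ => hpt _)
      _ = _ := by
          simp only [Finset.sum_const, card_range, nsmul_eq_mul]
          ring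
  exact le_of_mul_le_mul_left hfin hXp

lemma param_bound (n m e d r N : ℕ) (L : ℝ) (hn : 1 ≤ n) (hm1 : 1 ≤ m) (hmn : m ≤ n)
    (ψ : DirichletCharacter ℂ (2 ^ m)) (hψ1 : ψ ≠ 1)
    (hψ : ψ.conductor = 2 ^ m) (he : 1 ≤ e) (hd : d + 1 = 64 * e)
    (hr : 64 * d ^ 2 + 1 ≤ 2 ^ r) (hnr : n ≤ 2 ^ r) (hL : (2 : ℝ) ^ L ≤ N)
    (hi : 5 * ((n : ℝ) / d + 1) + 1 + 2 * r ≤ L) (hiii : (2 : ℝ) ^ 18 * r * d ^ 3 ≤ L - 2 * r) (t : ℤ) :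
    ‖∑ k ∈ range N, ψ ((t + k : ℤ) : ZMod (2 ^ m))‖ ≤ 2 * N / (n : ℝ) ^ 2 := by
  have hn0 : (0 : ℝ) < (n : ℝ) ^ 2 := by positivity
  have hnrR : (n : ℝ) ^ 2 ≤ 2 ^ (2 * r) := by
    have : (n : ℝ) ≤ 2 ^ r := by exact_mod_cast hnr
    calc (n : ℝ) ^ 2 ≤ (2 ^ r) ^ 2 := by gcongr
      _ = _ := by rw [← pow_mul, mul_comm]
  rcases le_or_gt ((2 : ℝ) ^ m * (n : ℝ) ^ 2) N with hA | hB
  · refine (incomplete_sum (2 ^ m) ψ hψ1 N t).trans ?_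
    push_cast
    rw [le_div_iff₀ hn0]
    have : (0 : ℝ) ≤ N := by positivity
    linarith
  · have hd63 : 63 ≤ d := by omega
    have hdR : (0 : ℝ) < d := by exact_mod_cast (by omega : 0 < d)
    have hmL : L < m + 2 * r := by
      have h1 : (2 : ℝ) ^ L < (2 : ℝ) ^ ((m : ℝ) + 2 * r) := by
        calc (2 : ℝ) ^ L ≤ N := hL
          _ < 2 ^ m * (n : ℝ) ^ 2 := hB
          _ ≤ 2 ^ m * 2 ^ (2 * r) := by gcongr
          _ = (2 : ℝ) ^ ((m : ℝ) + 2 * r) := by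
              rw [← pow_add, ← Real.rpow_natCast]; push_cast; rfl
      exact (Real.rpow_lt_rpow_left_iff (by norm_num)).1 h1
    set s := m / d + 1 with hs
    have hs1 : m ≤ s * d := by
      have := Nat.lt_div_mul_add (a := m) (b := d) (by omega)
      rw [hs, add_mul]; omega
    have hs2 : s * d ≤ m + d := by
      have := Nat.div_mul_le_self m d
      rw [hs, add_mul]; omega
    have hsR : (s : ℝ) ≤ n / d + 1 := by
      rw [hs]; push_cast
      have h1 : ((m / d : ℕ) : ℝ) ≤ m / d := Nat.cast_div_le
      have h2 : (m : ℝ) / d ≤ n / d := by gcongr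
      linarith
    have h3R : (2 : ℝ) ^ 18 * r * d ^ 2 * d ≤ s * d := by
      have : (m : ℝ) ≤ s * d := by exact_mod_cast hs1
      nlinarith
    have h3 : 2 ^ 18 * r * d ^ 2 ≤ s := by
      have := le_of_mul_le_mul_right h3R hdR
      exact_mod_cast this
    have h4 : 2240 * r * d ≤ s := by
      refine le_trans ?_ h3
      have : r * d ≤ r * d ^ 2 := Nat.mul_le_mul_left _ (by nlinarith)
      nlinarith
    obtain ⟨X, hX1, hX2, hX⟩ := inner_bound m e d s r r n ψ hψ he hd hr h4 h3 hnr hs1 hs2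
    refine (shifted_bound m s n X N ψ hm1 (by rw [hs]; exact Nat.le_add_left 1 _) hX1 hX2 hn hX t).trans ?_
    have h5 : (2 : ℝ) ^ (5 * s + 1) * (n : ℝ) ^ 2 ≤ N := by
      calc (2 : ℝ) ^ (5 * s + 1) * (n : ℝ) ^ 2 ≤ 2 ^ (5 * s + 1) * 2 ^ (2 * r) := by gcongr
        _ = (2 : ℝ) ^ ((5 * s + 1 : ℝ) + 2 * r) := by
              rw [← pow_add, ← Real.rpow_natCast]; push_cast; rfl
        _ ≤ (2 : ℝ) ^ L := by
            apply Real.rpow_le_rpow_of_exponent_le (by norm_num)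
            linarith
        _ ≤ N := hL
    rw [← le_div_iff₀ hn0] at h5
    have : 2 * (N : ℝ) / (n : ℝ) ^ 2 = N / (n : ℝ) ^ 2 + N / (n : ℝ) ^ 2 := by ring
    linarith


lemma params_exist (n : ℕ) (y l : ℝ) (hl : 2 ^ 14 ≤ l) (hyl : l ≤ y) (hn : (n : ℝ) = y ^ 4)
    (hln : l = Real.log n) :
    ∃ e d r : ℕ, 1 ≤ e ∧ d + 1 = 64 * e ∧ 64 * d ^ 2 + 1 ≤ 2 ^ r ∧ n ≤ 2 ^ r ∧
      5 * ((n : ℝ) / d + 1) + 1 + 2 * r ≤ y ^ 3 * l ∧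
      (2 : ℝ) ^ 18 * r * d ^ 3 ≤ y ^ 3 * l - 2 * r := by
  have hl0 : 0 < l := by linarith [show (0 : ℝ) < 2 ^ 14 by norm_num]
  have hy0 : 0 < y := by linarith
  have hy14 : 2 ^ 14 ≤ y := hl.trans hyl
  have hn0 : (0 : ℝ) < n := by rw [hn]; positivity
  have hyd : 1 ≤ y / l := by rw [le_div_iff₀ hl0]; linarith
  set e := ⌈y / l⌉₊ with he
  have he1 : y / l ≤ e := Nat.le_ceil _
  have he2 : (e : ℝ) ≤ y / l + 1 := (Nat.ceil_lt_add_one (by positivity)).le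
  have he3 : 1 ≤ e := by exact_mod_cast hyd.trans he1
  set r := ⌈2 * l⌉₊ with hr
  have hr1 : 2 * l ≤ r := Nat.le_ceil _
  have hr2 : (r : ℝ) ≤ 3 * l := by
    have := (Nat.ceil_lt_add_one (show (0 : ℝ) ≤ 2 * l by positivity)).le
    rw [← hr] at this
    norm_num at hl
    linarith
  obtain ⟨d, hd⟩ : ∃ d, d + 1 = 64 * e := ⟨64 * e - 1, by omega⟩
  have hdR : (d : ℝ) + 1 = 64 * e := by exact_mod_cast hd
  have heR : (1 : ℝ) ≤ e := by exact_mod_cast he3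
  have hd1 : 63 * (y / l) ≤ d := by linarith
  have hd2 : (d : ℝ) ≤ 128 * (y / l) := by linarith
  have hd0 : (0 : ℝ) < d := by linarith
  have hnr : (n : ℝ) ≤ 2 ^ r := by
    have h2 : (n : ℝ) = Real.exp l := by rw [hln, Real.exp_log hn0]
    have h3 : (2 : ℝ) ^ r = Real.exp (r * Real.log 2) := by
      rw [mul_comm, ← Real.rpow_natCast, Real.rpow_def_of_pos (by norm_num)]
    rw [h2, h3]
    apply Real.exp_le_exp.2
    have := Real.log_two_gt_d9
    have h5 : (1 : ℝ) / 2 ≤ Real.log 2 := by linarith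
    nlinarith
  have hyl3 : l ≤ y ^ 3 * l / 2 ^ 42 := by
    have : (2 ^ 14 : ℝ) ^ 3 ≤ y ^ 3 := by gcongr
    rw [le_div_iff₀ (by positivity)]
    norm_num at this ⊢
    nlinarith
  have hnd : (n : ℝ) / d ≤ y ^ 3 * l / 63 := by
    rw [div_le_iff₀ hd0, hn]
    calc y ^ 4 = y ^ 3 * l / 63 * (63 * (y / l)) := by field_simp
      _ ≤ _ := by gcongr
  have hL0 : 0 < y ^ 3 * l := by positivity
  norm_num at hyl3
  refine ⟨e, d, r, he3, hd, ?_, by exact_mod_cast hnr, ?_, ?_⟩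
  · have h1 : (64 : ℝ) * d ^ 2 + 1 ≤ n := by
      have h2 : y / l ≤ y / 2 ^ 14 := by gcongr
      have h3 : (d : ℝ) ≤ y := by
        norm_num at h2; linarith
      have h4 : (64 : ℝ) * d ^ 2 ≤ 64 * y ^ 2 := by gcongr
      rw [hn]
      have h5 : (2 ^ 14 : ℝ) ^ 2 ≤ y ^ 2 := by gcongr
      norm_num at h5
      nlinarith
    have := h1.trans hnr
    exact_mod_cast this
  · have : (1 : ℝ) ≤ l := by norm_num at hl; linarith
    linarith
  · have h1 : (2 : ℝ) ^ 18 * r * d ^ 3 ≤ 2 ^ 18 * (3 * l) * (128 * (y / l)) ^ 3 := by gcongr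
    have h2 : 2 ^ 18 * (3 * l) * (128 * (y / l)) ^ 3 ≤ y ^ 3 * l * (3 / 8) := by
      have h3 : 2 ^ 18 * (3 * l) * (128 * (y / l)) ^ 3 = y ^ 3 * l * (3 * 2 ^ 39 / l ^ 3) := by
        field_simp; norm_num
      rw [h3]
      have h4 : (2 ^ 14 : ℝ) ^ 3 ≤ l ^ 3 := by gcongr
      have h5 : 3 * 2 ^ 39 / l ^ 3 ≤ (3 / 8 : ℝ) := by
        rw [div_le_iff₀ (by positivity)]
        norm_num at h4 ⊢
        linarith
      gcongr
    linarith

lemma eventually_params : ∃ n₀ : ℕ, ∀ n : ℕ, n₀ ≤ n →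
    (2 : ℝ) ^ 14 ≤ Real.log n ∧ Real.log n ≤ (n : ℝ) ^ ((1 : ℝ) / 4) := by
  have h1 : ∀ᶠ n : ℕ in Filter.atTop, (2 : ℝ) ^ 14 ≤ Real.log n :=
    (Real.tendsto_log_atTop.comp tendsto_natCast_atTop_atTop).eventually_ge_atTop _
  have h2 : ∀ᶠ n : ℕ in Filter.atTop, Real.log n ≤ (n : ℝ) ^ ((1 : ℝ) / 4) := by
    have h3 := (isLittleO_log_rpow_atTop (show (0 : ℝ) < 1 / 4 by norm_num)).bound
      (show (0 : ℝ) < 1 by norm_num)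
    have h4 := tendsto_natCast_atTop_atTop (R := ℝ) |>.eventually h3
    filter_upwards [h4] with n hn
    rw [one_mul, Real.norm_of_nonneg (show (0 : ℝ) ≤ (n : ℝ) ^ ((1 : ℝ) / 4) by positivity)] at hn
    exact (le_abs_self _).trans hn
  exact Filter.eventually_atTop.1 (h1.and h2)


end IwaniecHelpers

/-- Iwaniec's character sum estimate for moduli that are powers of 2: there is an
absolute constant `C` such that for all sufficiently large `n`, every nonprincipal
Dirichlet character `χ` mod `2^n`, every integer `t` and every `N` with
`2^(n^(3/4)·ln n) ≤ N ≤ 2^n`, `|∑_{k=0}^{N-1} χ(t+k)| ≤ C·N/n²`. -/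
theorem iwaniec_character_sum_bound :
    ∃ C : ℝ, 0 < C ∧ ∃ n₀ : ℕ, ∀ n : ℕ, n₀ ≤ n →
      ∀ χ : DirichletCharacter ℂ (2 ^ n), χ ≠ 1 →
        ∀ t : ℤ, ∀ N : ℕ,
          (2 : ℝ) ^ ((n : ℝ) ^ ((3 : ℝ)/4) * Real.log n) ≤ N → N ≤ 2 ^ n →
            ‖∑ k ∈ Finset.range N, χ (((t + k : ℤ) : ZMod (2 ^ n)))‖
              ≤ C * N / (n : ℝ) ^ 2 := by
  obtain ⟨n₀, h₀⟩ := eventually_params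
  refine ⟨2, by norm_num, n₀, fun n hn χ hχ t N hN _ => ?_⟩
  obtain ⟨hl, hy⟩ := h₀ n hn
  have hnn : (0 : ℝ) ≤ n := by positivity
  have hn4 : (n : ℝ) = ((n : ℝ) ^ ((1 : ℝ) / 4)) ^ 4 := by
    rw [← Real.rpow_natCast, ← Real.rpow_mul hnn]; norm_num
  have hn3 : (n : ℝ) ^ ((3 : ℝ) / 4) = ((n : ℝ) ^ ((1 : ℝ) / 4)) ^ 3 := by
    rw [← Real.rpow_natCast, ← Real.rpow_mul hnn]; norm_num
  have hn1 : 1 ≤ n := by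
    rcases Nat.eq_zero_or_pos n with h | h
    · subst h; norm_num at hl
    · exact h
  obtain ⟨e, d, r, he, hd, hr, hnr, hi, hiii⟩ := params_exist n _ _ hl hy hn4 rfl
  obtain ⟨m, hmn, hm1, ψ, hψ1, hψ, hχψ⟩ := primitive_reduce n χ hχ
  simp only [hχψ]
  rw [hn3] at hN
  exact param_bound n m e d r N _ hn1 hm1 hmn ψ hψ1 hψ he hd hr hnr hN hi hiii t
end

section
/- For every ε > 0 there exists n₀ such that for every integer n ≥ n₀ there exist two distinct primes p, ℓ ∈ 𝒫_n such that the number of nonzero binary digits of the product M = p·ℓ is at most (1/2 + ε)·n. -/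
/-- `𝒫 n` is the set of primes `p` with `2^(n-1) < p < 2^n`. -/
def primesP (n : ℕ) : Finset ℕ := (Finset.Ioo (2^(n-1)) (2^n)).filter Nat.Prime

/-- Number of ones in the binary expansion. -/
def wt (x : ℕ) : ℕ := (Nat.digits 2 x).count 1

lemma wt_zero : wt 0 = 0 := by simp [wt]

lemma wt_two_mul (x : ℕ) : wt (2 * x) = wt x := by
  rcases Nat.eq_zero_or_pos x with rfl | h
  · simp
  · unfold wt
    have := Nat.digits_add 2 (by norm_num) 0 x (by norm_num) (Or.inr h.ne')
    rw [zero_add] at this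
    rw [this]; simp

lemma wt_two_mul_add_one (x : ℕ) : wt (2 * x + 1) = wt x + 1 := by
  unfold wt
  have := Nat.digits_add 2 (by norm_num) 1 x (by norm_num) (Or.inl (by norm_num))
  rw [add_comm 1 (2 * x)] at this
  rw [this]; simp

lemma wt_split (k : ℕ) : ∀ r q : ℕ, r < 2 ^ k → wt (r + 2 ^ k * q) = wt r + wt q := by
  induction k with
  | zero => intro r q h; have : r = 0 := by simpa using h
            subst this; simp [wt_zero]
  | succ k ih =>
    intro r q h
    have h2 : r / 2 < 2 ^ k := by rw [pow_succ] at h; omega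
    have e := ih (r / 2) q h2
    rcases Nat.even_or_odd' r with ⟨s, rfl | rfl⟩
    · have h3 : 2 * s / 2 = s := by omega
      rw [h3] at e
      have : 2 * s + 2 ^ (k + 1) * q = 2 * (s + 2 ^ k * q) := by ring
      rw [this, wt_two_mul, wt_two_mul, e]
    · have h3 : (2 * s + 1) / 2 = s := by omega
      rw [h3] at e
      have : 2 * s + 1 + 2 ^ (k + 1) * q = 2 * (s + 2 ^ k * q) + 1 := by ring
      rw [this, wt_two_mul_add_one, wt_two_mul_add_one, e]; ring

lemma wt_mod_add_div (k x : ℕ) : wt x = wt (x % 2 ^ k) + wt (x / 2 ^ k) := by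
  rw [← wt_split k _ _ (Nat.mod_lt _ (by positivity)), Nat.mod_add_div]

lemma wt_mod_le (k x : ℕ) : wt (x % 2 ^ k) ≤ wt x := by
  rw [wt_mod_add_div k x]; omega

lemma wt_succ_le (x : ℕ) : wt (x + 1) ≤ wt x + 1 := by
  induction x using Nat.strong_induction_on with
  | _ x ih =>
    rcases Nat.even_or_odd' x with ⟨s, rfl | rfl⟩
    · rw [wt_two_mul_add_one, wt_two_mul]
    · have : 2 * s + 1 + 1 = 2 * (s + 1) := by ring
      rw [this, wt_two_mul, wt_two_mul_add_one]
      have := ih s (by omega)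
      omega

lemma wt_add_pow_le (i : ℕ) : ∀ x, wt (x + 2 ^ i) ≤ wt x + 1 := by
  induction i with
  | zero => simpa using wt_succ_le
  | succ i ih =>
    intro x
    rcases Nat.even_or_odd' x with ⟨s, rfl | rfl⟩
    · have : 2 * s + 2 ^ (i + 1) = 2 * (s + 2 ^ i) := by ring
      rw [this, wt_two_mul, wt_two_mul]; exact ih s
    · have : 2 * s + 1 + 2 ^ (i + 1) = 2 * (s + 2 ^ i) + 1 := by ring
      rw [this, wt_two_mul_add_one, wt_two_mul_add_one]; have := ih s; omega

lemma sum_range_two_mul (F : ℕ → ℝ) (n : ℕ) :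
    ∑ x ∈ Finset.range (2 * n), F x
      = ∑ x ∈ Finset.range n, F (2 * x) + ∑ x ∈ Finset.range n, F (2 * x + 1) := by
  induction n with
  | zero => simp
  | succ n ih =>
    rw [show 2 * (n + 1) = 2 * n + 1 + 1 by ring, Finset.sum_range_succ, Finset.sum_range_succ, ih,
      Finset.sum_range_succ, Finset.sum_range_succ]
    ring

lemma wt_gen (z : ℝ) (m : ℕ) : ∑ x ∈ Finset.range (2 ^ m), z ^ wt x = (1 + z) ^ m := by
  induction m with
  | zero => simp [wt_zero]
  | succ m ih =>
    rw [pow_succ', sum_range_two_mul]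
    simp only [wt_two_mul, wt_two_mul_add_one, pow_succ]
    rw [← Finset.sum_mul, ih]; ring

lemma sum_shift (F : ℕ → ℝ) (n : ℕ) (h : ∀ x, F (x + n) = F x) :
    ∑ x ∈ Finset.range n, F (x + 1) = ∑ x ∈ Finset.range n, F x := by
  have h1 := Finset.sum_range_succ F n
  have h2 := Finset.sum_range_succ' F n
  have h3 := h 0
  rw [zero_add] at h3
  linarith

lemma conc_aux {q S0 S1 R0 R1 K : ℝ} (hq : 1 ≤ q) (hS0 : 0 < S0) (hS1 : 0 < S1)
    (hR0 : 0 < R0)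
    (h0 : S0 * R0 ≤ K) (h1 : S1 * R1 ≤ K) (h01 : S1 ≤ q * S0) (h10 : S0 ≤ q * S1) :
    (S0 + S1) * (R0 + R1) ≤ K * (2 + q + q⁻¹) := by
  have hK : 0 < K := lt_of_lt_of_le (by positivity) h0
  have e1 : S0 * R1 ≤ K * (S0 / S1) := by
    rw [← mul_div_assoc, le_div_iff₀ hS1]; nlinarith
  have e2 : S1 * R0 ≤ K * (S1 / S0) := by
    rw [← mul_div_assoc, le_div_iff₀ hS0]; nlinarith
  have hq0 : 0 < q := by linarith
  have e3 : S0 / S1 + S1 / S0 ≤ q + q⁻¹ := by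
    rw [div_add_div _ _ hS1.ne' hS0.ne', div_le_iff₀ (by positivity)]
    have : (q + q⁻¹) * (S1 * S0) - (S0 * S0 + S1 * S1) = (q * S1 - S0) * (q * S0 - S1) / q := by
      field_simp; ring
    have h' : 0 ≤ (q * S1 - S0) * (q * S0 - S1) / q :=
      div_nonneg (mul_nonneg (by linarith) (by linarith)) hq0.le
    linarith
  have := mul_le_mul_of_nonneg_left e3 hK.le
  nlinarith

lemma conc {q : ℝ} (hq : 1 ≤ q) (m : ℕ) : ∀ g : ℕ → ℝ, (∀ x, 0 < g x) →
    (∀ x, g (x + 2 ^ m) = g x) → (∀ i < m, ∀ x, g (x + 2 ^ i) ≤ q * g x) →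
    (∑ x ∈ Finset.range (2 ^ m), g x) * (∑ x ∈ Finset.range (2 ^ m), (g x)⁻¹)
      ≤ (2 + q + q⁻¹) ^ m := by
  induction m with
  | zero => intro g hg _ _; simp [(hg 0).ne']
  | succ m ih =>
    intro g hg hper hlip
    have hne : (Finset.range (2 ^ m)).Nonempty := by simp
    have k0 := ih (fun x => g (2 * x)) (fun x => hg _)
      (fun x => by
        show g (2 * (x + 2 ^ m)) = g (2 * x)
        rw [← hper (2 * x)]; congr 1; ring)
      (fun i hi x => by
        show g (2 * (x + 2 ^ i)) ≤ q * g (2 * x)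
        have := hlip (i + 1) (by omega) (2 * x)
        rwa [show 2 * (x + 2 ^ i) = 2 * x + 2 ^ (i + 1) by ring])
    have k1 := ih (fun x => g (2 * x + 1)) (fun x => hg _)
      (fun x => by
        show g (2 * (x + 2 ^ m) + 1) = g (2 * x + 1)
        rw [← hper (2 * x + 1)]; congr 1; ring)
      (fun i hi x => by
        show g (2 * (x + 2 ^ i) + 1) ≤ q * g (2 * x + 1)
        have := hlip (i + 1) (by omega) (2 * x + 1)
        rwa [show 2 * (x + 2 ^ i) + 1 = 2 * x + 1 + 2 ^ (i + 1) by ring])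
    rw [pow_succ' 2 m, sum_range_two_mul, sum_range_two_mul, pow_succ]
    apply conc_aux hq _ _ _ k0 k1
    · rw [Finset.mul_sum]
      apply Finset.sum_le_sum
      intro x _
      simpa using hlip 0 (by omega) (2 * x)
    · rw [← sum_shift (fun x => g (2 * x)) (2 ^ m), Finset.mul_sum]
      · apply Finset.sum_le_sum
        intro x _
        have := hlip 0 (by omega) (2 * x + 1)
        rw [pow_zero] at this
        exact this
      · intro x
        show g (2 * (x + 2 ^ m)) = g (2 * x)
        rw [← hper (2 * x)]; congr 1; ring
    all_goals exact Finset.sum_pos (fun x _ => by first | exact hg _ | exact inv_pos.2 (hg _)) hne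

lemma conc_const (l : ℝ) : 2 + Real.exp l + (Real.exp l)⁻¹ ≤ 4 * Real.exp (l ^ 2 / 4) := by
  have h := Real.cosh_le_exp_half_sq (l / 2)
  have h1 : 2 + Real.exp l + (Real.exp l)⁻¹ = 4 * (Real.cosh (l / 2)) ^ 2 := by
    rw [Real.cosh_eq, ← Real.exp_neg]
    have a1 : Real.exp l = Real.exp (l / 2) ^ 2 := by rw [← Real.exp_nat_mul]; congr 1; push_cast; ring
    have a2 : Real.exp (-l) = Real.exp (-(l / 2)) ^ 2 := by
      rw [← Real.exp_nat_mul]; congr 1; push_cast; ring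
    have a3 : Real.exp (l / 2) * Real.exp (-(l / 2)) = 1 := by rw [← Real.exp_add]; simp
    rw [a1, a2]; linear_combination (-2) * a3
  have h2 : Real.exp (l ^ 2 / 4) = (Real.exp ((l / 2) ^ 2 / 2)) ^ 2 := by
    rw [← Real.exp_nat_mul]; congr 1; push_cast; ring
  rw [h1, h2]
  have := Real.cosh_pos (l / 2)
  gcongr

lemma lin_core (m d T K : ℕ) (hmK : m ≤ K) (hK : 0 < K) (hT : K * (2 * d + 1) ≤ T ^ 2)
    (X : Finset ℕ) (hX : X ⊆ Finset.range (2 ^ m)) (hXc : 2 ^ m ≤ 2 ^ d * X.card) :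
    2 ^ (d + 1) * ((Finset.range (2 ^ m)).filter
      (fun y => ∀ x ∈ X, T < wt ((y + x) % 2 ^ m))).card ≤ 2 ^ m := by
  classical
  set B := (Finset.range (2 ^ m)).filter (fun y => ∀ x ∈ X, T < wt ((y + x) % 2 ^ m)) with hB
  have hXne : X.Nonempty := by
    rw [Finset.nonempty_iff_ne_empty]; rintro rfl
    have : 0 < 2 ^ m := by positivity
    simp at hXc
  set f : ℕ → ℕ := fun y => X.inf' hXne (fun x => wt ((y + x) % 2 ^ m)) with hf
  set l : ℝ := 2 * T / K with hl
  have hK' : (0 : ℝ) < K := by exact_mod_cast hK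
  have hl0 : 0 ≤ l := by positivity
  have key := conc (q := Real.exp l) (Real.one_le_exp hl0) m (fun y => Real.exp (l * f y))
    (fun x => Real.exp_pos _)
    (fun y => by
      have : f (y + 2 ^ m) = f y := by
        simp only [hf]
        congr 1; ext x
        rw [show y + 2 ^ m + x = y + x + 2 ^ m by ring, Nat.add_mod_right]
      simp only [this])
    (fun i hi y => by
      have : f (y + 2 ^ i) ≤ f y + 1 := by
        obtain ⟨x, hx, hxe⟩ := Finset.exists_mem_eq_inf' hXne (fun x => wt ((y + x) % 2 ^ m))
        have h1 : f (y + 2 ^ i) ≤ wt ((y + 2 ^ i + x) % 2 ^ m) :=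
          Finset.inf'_le (fun x => wt ((y + 2 ^ i + x) % 2 ^ m)) hx
        have h2 : f y = wt ((y + x) % 2 ^ m) := hxe
        have h3 : (y + 2 ^ i + x) % 2 ^ m = ((y + x) % 2 ^ m + 2 ^ i) % 2 ^ m := by
          rw [Nat.mod_add_mod]; congr 1; ring
        have h4 := wt_mod_le m ((y + x) % 2 ^ m + 2 ^ i)
        have h5 := wt_add_pow_le i ((y + x) % 2 ^ m)
        rw [← h3] at h4
        omega
      rw [← Real.exp_add]
      apply Real.exp_le_exp.2
      have h' : (f (y + 2 ^ i) : ℝ) ≤ f y + 1 := by exact_mod_cast this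
      nlinarith)
  have s1 : (B.card : ℝ) * Real.exp (l * T) ≤
      ∑ y ∈ Finset.range (2 ^ m), Real.exp (l * f y) := by
    rw [← nsmul_eq_mul]
    refine (Finset.card_nsmul_le_sum B (fun y => Real.exp (l * f y)) _ ?_).trans
      (Finset.sum_le_sum_of_subset_of_nonneg (Finset.filter_subset _ _)
        (fun _ _ _ => (Real.exp_pos _).le))
    intro y hy
    apply Real.exp_le_exp.2
    apply mul_le_mul_of_nonneg_left _ hl0
    have : T ≤ f y := by
      apply Finset.le_inf'
      intro x hx
      exact ((Finset.mem_filter.1 hy).2 x hx).le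
    exact_mod_cast this
  have s2 : (X.card : ℝ) ≤ ∑ y ∈ Finset.range (2 ^ m), (Real.exp (l * f y))⁻¹ := by
    set Z := X.image (fun x => (2 ^ m - x) % 2 ^ m) with hZ
    have hZc : Z.card = X.card := by
      apply Finset.card_image_of_injOn
      intro x hx x' hx' h
      have a := Finset.mem_range.1 (hX hx)
      have b := Finset.mem_range.1 (hX hx')
      simp only at h
      rcases Nat.eq_zero_or_pos x with h0 | h0 <;> rcases Nat.eq_zero_or_pos x' with h0' | h0'
      · omega
      · rw [h0, Nat.sub_zero, Nat.mod_self, Nat.mod_eq_of_lt (by omega)] at h; omega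
      · rw [h0', Nat.sub_zero, Nat.mod_self, Nat.mod_eq_of_lt (by omega)] at h; omega
      · rw [Nat.mod_eq_of_lt (by omega), Nat.mod_eq_of_lt (by omega)] at h; omega
    rw [← hZc, ← nsmul_one]
    refine (Finset.card_nsmul_le_sum Z (fun y => (Real.exp (l * f y))⁻¹) _ ?_).trans
      (Finset.sum_le_sum_of_subset_of_nonneg ?_
        (fun _ _ _ => (inv_pos.2 (Real.exp_pos _)).le))
    · intro y hy
      obtain ⟨x, hx, rfl⟩ := Finset.mem_image.1 hy
      have a := Finset.mem_range.1 (hX hx)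
      have h1 : f ((2 ^ m - x) % 2 ^ m) ≤ wt (((2 ^ m - x) % 2 ^ m + x) % 2 ^ m) :=
        Finset.inf'_le (fun x' => wt (((2 ^ m - x) % 2 ^ m + x') % 2 ^ m)) hx
      rw [Nat.mod_add_mod, Nat.sub_add_cancel a.le, Nat.mod_self, wt_zero] at h1
      have h2 : f ((2 ^ m - x) % 2 ^ m) = 0 := by omega
      simp [h2]
    · intro y hy
      obtain ⟨x, hx, rfl⟩ := Finset.mem_image.1 hy
      exact Finset.mem_range.2 (Nat.mod_lt _ (by positivity))
  have s3 : (B.card : ℝ) * Real.exp (l * T) * X.card ≤ (4 * Real.exp (l ^ 2 / 4)) ^ m := by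
    refine (mul_le_mul s1 s2 (by positivity)
      (Finset.sum_nonneg fun _ _ => (Real.exp_pos _).le)).trans (key.trans ?_)
    have := conc_const l
    gcongr
  have s4 : Real.exp (l ^ 2 / 4) ^ m ≤ Real.exp (T ^ 2 / K) := by
    rw [← Real.exp_nat_mul]
    apply Real.exp_le_exp.2
    have : (m : ℝ) ≤ K := by exact_mod_cast hmK
    calc (m : ℝ) * (l ^ 2 / 4) ≤ K * (l ^ 2 / 4) := by gcongr
      _ = (T : ℝ) ^ 2 / K := by rw [hl]; field_simp; ring
  have s5 : l * T = T ^ 2 / K + T ^ 2 / K := by rw [hl]; field_simp; ring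
  have s6 : (2 : ℝ) ^ (2 * d + 1) ≤ Real.exp (T ^ 2 / K) := by
    have h1 : ((2 * d + 1 : ℕ) : ℝ) ≤ T ^ 2 / K := by
      rw [le_div_iff₀ hK', mul_comm]; exact_mod_cast hT
    have h2 : (2 : ℝ) ≤ Real.exp 1 := by have := Real.add_one_le_exp (1 : ℝ); linarith
    calc (2 : ℝ) ^ (2 * d + 1) ≤ (Real.exp 1) ^ (2 * d + 1) := by gcongr
      _ = Real.exp ((2 * d + 1 : ℕ) : ℝ) := by rw [← Real.exp_nat_mul, mul_one]
      _ ≤ _ := Real.exp_le_exp.2 h1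
  rw [mul_pow, s5, Real.exp_add] at s3
  set Q := Real.exp ((T : ℝ) ^ 2 / K) with hQ
  have hQ0 : 0 < Q := Real.exp_pos _
  have s7 : (B.card : ℝ) * Q * X.card ≤ 4 ^ m := by
    have h4 : (4 : ℝ) ^ m * Real.exp (l ^ 2 / 4) ^ m ≤ 4 ^ m * Q := by gcongr
    have : ((B.card : ℝ) * Q * X.card) * Q ≤ 4 ^ m * Q := by nlinarith
    exact le_of_mul_le_mul_right this hQ0
  have s8 : (B.card : ℝ) * 2 ^ (2 * d + 1) * X.card ≤ 4 ^ m := by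
    refine le_trans ?_ s7
    gcongr
  have s9 : B.card * 2 ^ (2 * d + 1) * X.card ≤ 4 ^ m := by exact_mod_cast s8
  have s10 : 2 ^ m * (2 ^ (d + 1) * B.card) ≤ 2 ^ m * 2 ^ m := by
    calc 2 ^ m * (2 ^ (d + 1) * B.card) ≤ (2 ^ d * X.card) * (2 ^ (d + 1) * B.card) := by gcongr
      _ = B.card * 2 ^ (2 * d + 1) * X.card := by ring
      _ ≤ 4 ^ m := s9
      _ = 2 ^ m * 2 ^ m := by rw [← mul_pow]; norm_num
  exact Nat.le_of_mul_le_mul_left s10 (by positivity)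

lemma lin_inj {m b c x x' : ℕ} (hb : b % 2 = 1) (hx : x < 2 ^ m) (hx' : x' < 2 ^ m)
    (h : (c + b * x) % 2 ^ m = (c + b * x') % 2 ^ m) : x = x' := by
  have h1 : b * x ≡ b * x' [MOD 2 ^ m] := Nat.ModEq.add_left_cancel' c h
  have h2 : Nat.Coprime (2 ^ m) b :=
    Nat.Coprime.pow_left _ ((Nat.coprime_two_left).2 (Nat.odd_iff.2 hb))
  exact (Nat.ModEq.cancel_left_of_coprime h2 h1).eq_of_lt_of_lt hx hx'

lemma lin (m d T K : ℕ) (hmK : m ≤ K) (hK : 0 < K) (hT : K * (2 * d + 1) ≤ T ^ 2)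
    (X Y : Finset ℕ) (hX : X ⊆ Finset.range (2 ^ m)) (hXc : 2 ^ m ≤ 2 ^ d * X.card)
    (hY : Y ⊆ Finset.range (2 ^ m)) (hYc : 2 ^ m ≤ 2 ^ d * Y.card)
    (a b c : ℕ) (ha : a % 2 = 1) (hb : b % 2 = 1) :
    2 ^ m ≤ 2 ^ (d + 1) * ((X ×ˢ Y).filter
      (fun z => wt ((c + a * z.2 + b * z.1) % 2 ^ m) ≤ T)).card := by
  classical
  set X' := X.image (fun x => (c + b * x) % 2 ^ m) with hX'
  have hX'c : X'.card = X.card := by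
    apply Finset.card_image_of_injOn
    intro x hx x' hx' h
    exact lin_inj hb (Finset.mem_range.1 (hX hx)) (Finset.mem_range.1 (hX hx')) h
  have core := lin_core m d T K hmK hK hT X' (by
    intro y hy
    obtain ⟨x, hx, rfl⟩ := Finset.mem_image.1 hy
    exact Finset.mem_range.2 (Nat.mod_lt _ (by positivity))) (by rwa [hX'c])
  set B := (Finset.range (2 ^ m)).filter (fun y => ∀ x ∈ X', T < wt ((y + x) % 2 ^ m)) with hB
  set Z := (X ×ˢ Y).filter (fun z => wt ((c + a * z.2 + b * z.1) % 2 ^ m) ≤ T) with hZ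
  have e := Finset.card_filter_add_card_filter_not (s := Y)
    (fun y => ∃ x ∈ X, wt ((c + a * y + b * x) % 2 ^ m) ≤ T)
  have e1 : (Y.filter (fun y => ∃ x ∈ X, wt ((c + a * y + b * x) % 2 ^ m) ≤ T)).card ≤ Z.card := by
    refine le_trans (Finset.card_le_card ?_) (Finset.card_image_le (f := Prod.snd))
    intro y hy
    obtain ⟨hy, x, hx, h⟩ := Finset.mem_filter.1 hy
    exact Finset.mem_image.2 ⟨(x, y), Finset.mem_filter.2 ⟨Finset.mem_product.2 ⟨hx, hy⟩, h⟩, rfl⟩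
  have e2 : (Y.filter (fun y => ¬ ∃ x ∈ X, wt ((c + a * y + b * x) % 2 ^ m) ≤ T)).card
      ≤ B.card := by
    apply Finset.card_le_card_of_injOn (fun y => (0 + a * y) % 2 ^ m)
    · intro y hy
      obtain ⟨hy, h⟩ := Finset.mem_filter.1 hy
      refine Finset.mem_coe.2 (Finset.mem_filter.2
        ⟨Finset.mem_range.2 (Nat.mod_lt _ (by positivity)), ?_⟩)
      intro x' hx'
      obtain ⟨x, hx, rfl⟩ := Finset.mem_image.1 hx'
      by_contra hc
      apply h
      refine ⟨x, hx, ?_⟩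
      rw [← Nat.add_mod, show 0 + a * y + (c + b * x) = c + a * y + b * x by ring] at hc
      omega
    · intro y hy y' hy' h
      exact lin_inj ha (Finset.mem_range.1 (hY (Finset.mem_filter.1 hy).1))
        (Finset.mem_range.1 (hY (Finset.mem_filter.1 hy').1)) h
  have e3 : Y.card ≤ Z.card + B.card := by omega
  have e4 := Nat.mul_le_mul_left (2 ^ (d + 1)) e3
  have e5 : 2 ^ (d + 1) * Y.card = 2 * (2 ^ d * Y.card) := by ring
  rw [mul_add] at e4
  omega

/-- The fibre of `U` over the residue class `a` modulo `2^j`. -/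
def fib (U : Finset ℕ) (j r a : ℕ) : Finset ℕ :=
  (Finset.range (2 ^ r)).filter (fun x => a + 2 ^ j * x ∈ U)

/-- Residue classes with dense fibre. -/
def dens (U : Finset ℕ) (j r d : ℕ) : Finset ℕ :=
  (Finset.range (2 ^ j)).filter (fun a => 2 ^ r ≤ 2 ^ d * (fib U j r a).card)

lemma fib_card (U : Finset ℕ) (j r : ℕ) (hU : U ⊆ Finset.range (2 ^ (j + r))) :
    U.card ≤ ∑ a ∈ Finset.range (2 ^ j), (fib U j r a).card := by
  classical
  rw [Finset.card_eq_sum_card_fiberwise (f := fun u => u % 2 ^ j) (t := Finset.range (2 ^ j))]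
  · apply Finset.sum_le_sum
    intro a ha
    apply Finset.card_le_card_of_injOn (fun u => u / 2 ^ j)
    · intro u hu
      obtain ⟨huU, hua⟩ := Finset.mem_filter.1 (Finset.mem_coe.1 hu)
      refine Finset.mem_coe.2 (Finset.mem_filter.2 ⟨Finset.mem_range.2 ?_, ?_⟩)
      · have := Finset.mem_range.1 (hU huU)
        rw [pow_add] at this
        exact Nat.div_lt_of_lt_mul this
      · rwa [← hua, Nat.mod_add_div]
    · intro u hu u' hu' h
      have h1 := (Finset.mem_filter.1 hu).2
      have h2 := (Finset.mem_filter.1 hu').2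
      simp only at h h1 h2
      rw [← Nat.mod_add_div u (2 ^ j), ← Nat.mod_add_div u' (2 ^ j), h1, h2, h]
  · intro u hu
    exact Finset.mem_coe.2 (Finset.mem_range.2 (Nat.mod_lt _ (by positivity)))

lemma dens_card (U : Finset ℕ) (j r d : ℕ) (hU : U ⊆ Finset.range (2 ^ (j + r)))
    (hc : 2 ^ (j + r) ≤ 2 ^ d * U.card) :
    2 ^ j ≤ 2 ^ (d + 1) * (dens U j r (d + 1)).card := by
  have h1 := fib_card U j r hU
  have h2 : ∀ a ∈ Finset.range (2 ^ j), 2 ^ (d + 1) * (fib U j r a).card ≤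
      (if 2 ^ r ≤ 2 ^ (d + 1) * (fib U j r a).card then 2 ^ (d + 1) * 2 ^ r else 0) + 2 ^ r := by
    intro a _
    have : (fib U j r a).card ≤ 2 ^ r := by
      refine (Finset.card_filter_le _ _).trans ?_
      simp
    split_ifs with h
    · have := Nat.mul_le_mul_left (2 ^ (d + 1)) this
      omega
    · omega
  have h3 := Finset.sum_le_sum h2
  rw [Finset.sum_add_distrib, ← Finset.mul_sum, ← Finset.sum_filter, Finset.sum_const,
    Finset.sum_const, Finset.card_range, smul_eq_mul, smul_eq_mul] at h3
  have h4 : (Finset.filter (fun a => 2 ^ r ≤ 2 ^ (d + 1) * (fib U j r a).card)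
    (Finset.range (2 ^ j))).card = (dens U j r (d + 1)).card := rfl
  rw [h4] at h3
  have h5 := Nat.mul_le_mul_left (2 ^ (d + 1)) h1
  have h6 : 2 ^ (d + 1) * U.card = 2 * (2 ^ d * U.card) := by ring
  have h7 : 2 ^ (j + r) = 2 ^ j * 2 ^ r := pow_add _ _ _
  have h8 : 2 ^ j * 2 ^ r ≤ (2 ^ (d + 1) * (dens U j r (d + 1)).card) * 2 ^ r := by
    have : (dens U j r (d + 1)).card * (2 ^ (d + 1) * 2 ^ r)
      = (2 ^ (d + 1) * (dens U j r (d + 1)).card) * 2 ^ r := by ring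
    omega
  exact Nat.le_of_mul_le_mul_right h8 (by positivity)

lemma prod_mod {j r : ℕ} (hr : r ≤ j) (a b x y : ℕ) :
    wt (((a + 2 ^ j * x) * (b + 2 ^ j * y)) % 2 ^ (j + r))
      = wt (a * b % 2 ^ j) + wt ((a * b / 2 ^ j + a * y + b * x) % 2 ^ r) := by
  obtain ⟨s, rfl⟩ := Nat.exists_eq_add_of_le hr
  rw [← wt_split (r + s) _ _ (Nat.mod_lt _ (by positivity))]
  congr 1
  set j := r + s
  have h1 : (a + 2 ^ j * x) * (b + 2 ^ j * y)
      = a * b % 2 ^ j + 2 ^ j * ((a * b / 2 ^ j + a * y + b * x) + 2 ^ r * (2 ^ s * x * y)) := by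
    have := Nat.mod_add_div (a * b) (2 ^ j)
    have e : 2 ^ j = 2 ^ r * 2 ^ s := pow_add _ _ _
    calc (a + 2 ^ j * x) * (b + 2 ^ j * y)
        = a * b + 2 ^ j * (a * y + b * x) + 2 ^ j * (2 ^ j * x * y) := by ring
      _ = (a * b % 2 ^ j + 2 ^ j * (a * b / 2 ^ j)) + 2 ^ j * (a * y + b * x)
          + 2 ^ j * ((2 ^ r * 2 ^ s) * x * y) := by rw [this, ← e]
      _ = _ := by ring
  rw [h1, pow_add 2 j r, Nat.mod_mul, Nat.add_mul_mod_self_left, Nat.mod_mod,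
    Nat.add_mul_div_left _ _ (by positivity), Nat.div_eq_of_lt (Nat.mod_lt _ (by positivity)),
    zero_add, Nat.add_mul_mod_self_left]

lemma main_rec (T K : ℕ) (hK : 0 < K) (L : ℕ) : ∀ (k d : ℕ) (U V : Finset ℕ), k ≤ 2 ^ L → k ≤ K →
    K * (2 * (d + L) + 1) ≤ T ^ 2 →
    U ⊆ Finset.range (2 ^ k) → V ⊆ Finset.range (2 ^ k) →
    (∀ u ∈ U, u % 2 = 1) → (∀ v ∈ V, v % 2 = 1) →
    2 ^ k ≤ 2 ^ d * U.card → 2 ^ k ≤ 2 ^ d * V.card →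
    2 ^ k ≤ 2 ^ (1 + L * (d + L + 2)) *
      ((U ×ˢ V).filter (fun z => wt (z.1 * z.2 % 2 ^ k) ≤ 1 + L * T)).card := by
  classical
  induction L with
  | zero =>
    intro k d U V hk _ _ hU hV _ _ hUc hVc
    have ne : ∀ W : Finset ℕ, 2 ^ k ≤ 2 ^ d * W.card → W.Nonempty := by
      intro W h
      rw [Finset.nonempty_iff_ne_empty]; rintro rfl
      simp at h
    obtain ⟨u, hu⟩ := ne U hUc
    obtain ⟨v, hv⟩ := ne V hVc
    have hk1 : k ≤ 1 := by simpa using hk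
    have h1 : 0 < ((U ×ˢ V).filter (fun z => wt (z.1 * z.2 % 2 ^ k) ≤ 1 + 0 * T)).card := by
      apply Finset.card_pos.2
      refine ⟨(u, v), Finset.mem_filter.2 ⟨Finset.mem_product.2 ⟨hu, hv⟩, ?_⟩⟩
      have : u * v % 2 ^ k < 2 := by
        refine (Nat.mod_lt _ (by positivity)).trans_le ?_
        interval_cases k <;> simp
      show wt (u * v % 2 ^ k) ≤ _
      generalize u * v % 2 ^ k = w at this
      interval_cases w <;> simp [wt]
    have h2 : 2 ^ k ≤ 2 ^ 1 := Nat.pow_le_pow_right (by norm_num) hk1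
    rw [zero_mul, add_zero]
    nlinarith
  | succ L ih =>
    intro k d U V hk hkK hT hU hV hUo hVo hUc hVc
    have ne : U.Nonempty := by
      rw [Finset.nonempty_iff_ne_empty]; rintro rfl
      simp at hUc
    have hk0 : k ≠ 0 := by
      rintro rfl
      obtain ⟨u, hu⟩ := ne
      have := hUo u hu
      have := Finset.mem_range.1 (hU hu)
      simp at this
      omega
    obtain ⟨j, r, hj0, hrj, hjr, rfl⟩ : ∃ j r, 1 ≤ j ∧ r ≤ j ∧ j ≤ r + 1 ∧ k = j + r :=
      ⟨(k + 1) / 2, k / 2, by omega, by omega, by omega, by omega⟩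
    have hj2 : j ≤ 2 ^ L := by rw [pow_succ] at hk; omega
    have odd_of : ∀ W : Finset ℕ, (∀ u ∈ W, u % 2 = 1) → ∀ a ∈ dens W j r (d + 1), a % 2 = 1 := by
      intro W hW a ha
      obtain ⟨_, h⟩ := Finset.mem_filter.1 ha
      have : (fib W j r a).Nonempty := by
        rw [Finset.nonempty_iff_ne_empty]; intro h0
        rw [h0] at h
        simp at h
      obtain ⟨x, hx⟩ := this
      have h1 := hW _ (Finset.mem_filter.1 hx).2
      obtain ⟨i, rfl⟩ := Nat.exists_eq_add_of_le hj0
      rw [pow_add, pow_one, mul_assoc] at h1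
      omega
    have step := ih j (d + 1) (dens U j r (d + 1)) (dens V j r (d + 1)) hj2 (by omega)
      (by rwa [show d + 1 + L = d + (L + 1) by ring]) (Finset.filter_subset _ _)
      (Finset.filter_subset _ _) (odd_of U hUo) (odd_of V hVo)
      (dens_card U j r d hU hUc) (dens_card V j r d hV hVc)
    set G := ((dens U j r (d + 1)) ×ˢ (dens V j r (d + 1))).filter
      (fun z => wt (z.1 * z.2 % 2 ^ j) ≤ 1 + L * T) with hG
    set Z := (U ×ˢ V).filter (fun z => wt (z.1 * z.2 % 2 ^ (j + r)) ≤ 1 + (L + 1) * T) with hZ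
    have fibers : ∀ t ∈ G, 2 ^ r ≤ 2 ^ (d + 2) *
        (Z.filter (fun z => (z.1 % 2 ^ j, z.2 % 2 ^ j) = t)).card := by
      rintro ⟨a, b⟩ ht
      obtain ⟨hab, hw⟩ := Finset.mem_filter.1 ht
      obtain ⟨ha, hb⟩ := Finset.mem_product.1 hab
      simp only at ha hb hw
      have l := lin r (d + 1) T K (by omega) hK
        (le_trans (Nat.mul_le_mul_left K (by omega)) hT) (fib U j r a) (fib V j r b)
        (Finset.filter_subset _ _) (Finset.mem_filter.1 ha).2
        (Finset.filter_subset _ _) (Finset.mem_filter.1 hb).2 a b (a * b / 2 ^ j)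
        (odd_of U hUo a ha) (odd_of V hVo b hb)
      refine l.trans (Nat.mul_le_mul_left _ ?_)
      have ha' := Finset.mem_range.1 (Finset.mem_filter.1 ha).1
      have hb' := Finset.mem_range.1 (Finset.mem_filter.1 hb).1
      apply Finset.card_le_card_of_injOn (fun z => (a + 2 ^ j * z.1, b + 2 ^ j * z.2))
      · rintro ⟨x, y⟩ hz
        obtain ⟨hxy, h⟩ := Finset.mem_filter.1 hz
        obtain ⟨hx, hy⟩ := Finset.mem_product.1 hxy
        simp only at hx hy h
        refine Finset.mem_coe.2 (Finset.mem_filter.2 ⟨Finset.mem_filter.2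
          ⟨Finset.mem_product.2 ⟨(Finset.mem_filter.1 hx).2, (Finset.mem_filter.1 hy).2⟩, ?_⟩, ?_⟩)
        · simp only
          rw [prod_mod hrj]
          have : 1 + (L + 1) * T = 1 + L * T + T := by ring
          omega
        · simp only
          rw [Nat.add_mul_mod_self_left, Nat.add_mul_mod_self_left, Nat.mod_eq_of_lt ha',
            Nat.mod_eq_of_lt hb']
      · rintro ⟨x, y⟩ _ ⟨x', y'⟩ _ h
        simpa using h
    have total : G.card * 2 ^ r ≤ 2 ^ (d + 2) * Z.card := by
      have h1 := Finset.sum_le_sum fibers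
      rw [Finset.sum_const, smul_eq_mul, ← Finset.mul_sum] at h1
      refine h1.trans (Nat.mul_le_mul_left _ ?_)
      rw [← Finset.card_biUnion]
      · apply Finset.card_le_card
        intro z hz
        obtain ⟨t, _, h⟩ := Finset.mem_biUnion.1 hz
        exact (Finset.mem_filter.1 h).1
      · intro t _ t' _ htt'
        apply Finset.disjoint_left.2
        intro z hz hz'
        exact htt' ((Finset.mem_filter.1 hz).2.symm.trans (Finset.mem_filter.1 hz').2)
    calc 2 ^ (j + r) = 2 ^ j * 2 ^ r := pow_add _ _ _
      _ ≤ 2 ^ (1 + L * (d + 1 + L + 2)) * G.card * 2 ^ r := Nat.mul_le_mul_right _ step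
      _ = 2 ^ (1 + L * (d + 1 + L + 2)) * (G.card * 2 ^ r) := by ring
      _ ≤ 2 ^ (1 + L * (d + 1 + L + 2)) * (2 ^ (d + 2) * Z.card) := Nat.mul_le_mul_left _ total
      _ = 2 ^ (1 + L * (d + 1 + L + 2) + (d + 2)) * Z.card := by rw [pow_add]; ring
      _ ≤ 2 ^ (1 + (L + 1) * (d + (L + 1) + 2)) * Z.card := by
        apply Nat.mul_le_mul_right
        apply Nat.pow_le_pow_right (by norm_num)
        nlinarith

lemma centralBinom_le_count (N : ℕ) (hN : 2 < N) :
    Nat.centralBinom N ≤ (2 * N) ^ Nat.sqrt (2 * N) * 4 ^ (2 * N / 3) *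
      (2 * N) ^ ((Finset.Ioc N (2 * N)).filter Nat.Prime).card := by
  classical
  have n2_pos : 1 ≤ 2 * N := by omega
  let f : ℕ → ℕ := fun x => x ^ N.centralBinom.factorization x
  let R := (Finset.range (2 * N + 1)).filter Nat.Prime
  have e0 : N.centralBinom = ∏ x ∈ R, f x := by
    rw [← N.prod_pow_factorization_centralBinom]
    symm
    refine Finset.prod_filter_of_ne fun p _ h => ?_
    contrapose h
    show p ^ N.centralBinom.factorization p = 1
    rw [Nat.factorization_eq_zero_of_not_prime N.centralBinom h, pow_zero]
  rw [e0, ← Finset.prod_filter_mul_prod_filter_not R (· ≤ N)]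
  apply Nat.mul_le_mul
  · rw [← Finset.prod_filter_mul_prod_filter_not (R.filter (· ≤ N)) (· ≤ Nat.sqrt (2 * N))]
    apply Nat.mul_le_mul
    · refine (Finset.prod_le_prod' fun p _ => (?_ : f p ≤ 2 * N)).trans ?_
      · exact Nat.pow_factorization_choose_le (by omega)
      rw [Finset.prod_const]
      refine Nat.pow_le_pow_right n2_pos ?_
      have : (Finset.Icc 1 (Nat.sqrt (2 * N))).card = Nat.sqrt (2 * N) := by simp
      refine (Finset.card_le_card fun x hx => ?_).trans this.le
      obtain ⟨h1, h2⟩ := Finset.mem_filter.1 hx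
      exact Finset.mem_Icc.mpr
        ⟨(Finset.mem_filter.1 (Finset.mem_filter.1 h1).1).2.one_lt.le, h2⟩
    · refine le_trans ?_ (primorial_le_four_pow (2 * N / 3))
      have : ∀ p ∈ (R.filter (· ≤ N)).filter (fun x => ¬ x ≤ Nat.sqrt (2 * N)),
          f p ≤ if p ∈ (Finset.range (2 * N / 3 + 1)).filter Nat.Prime then p else 1 := by
        intro p hp
        obtain ⟨h1, h2⟩ := Finset.mem_filter.1 hp
        obtain ⟨h3, h4⟩ := Finset.mem_filter.1 h1
        have hpp := (Finset.mem_filter.1 h3).2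
        split_ifs with h
        · refine (Nat.pow_le_pow_right hpp.one_lt.le ?_).trans (pow_one p).le
          exact Nat.factorization_choose_le_one (Nat.sqrt_lt'.mp <| not_le.1 h2)
        · have : 2 * N < 3 * p := by
            by_contra hc
            apply h
            simp only [Finset.mem_filter, Finset.mem_range]
            exact ⟨by omega, hpp⟩
          show p ^ _ ≤ 1
          rw [Nat.factorization_centralBinom_of_two_mul_self_lt_three_mul hN h4 this, pow_zero]
      refine (Finset.prod_le_prod' this).trans ?_
      rw [← Finset.prod_filter]
      refine Finset.prod_le_prod_of_subset_of_one_le' ?_ ?_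
      · intro p hp
        exact (Finset.mem_filter.1 hp).2
      · exact fun p hp _ => (Finset.mem_filter.1 hp).2.one_lt.le
  · refine (Finset.prod_le_prod' fun p _ => (?_ : f p ≤ 2 * N)).trans ?_
    · exact Nat.pow_factorization_choose_le (by omega)
    rw [Finset.prod_const]
    refine Nat.pow_le_pow_right n2_pos (Finset.card_le_card fun x hx => ?_)
    obtain ⟨h1, h2⟩ := Finset.mem_filter.1 hx
    obtain ⟨h3, h4⟩ := Finset.mem_filter.1 h1
    have := Finset.mem_range.1 h3
    exact Finset.mem_filter.2 ⟨Finset.mem_Ioc.2 ⟨by omega, by omega⟩, h4⟩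

lemma aux_pow (h : ℕ) (hh : 9 ≤ h) : 48 * h ≤ 2 ^ h := by
  induction h, hh using Nat.le_induction with
  | base => norm_num
  | succ h hh ih => rw [pow_succ]; omega

lemma primes_count (n : ℕ) (hn : 17 ≤ n) : 2 ^ (n - 1) ≤ 3 * n * (primesP n).card := by
  set N := 2 ^ (n - 1) with hN
  have h2N : 2 * N = 2 ^ n := by
    rw [hN, ← pow_succ']; congr 1; omega
  have hN4 : 4 ≤ N := by
    calc 4 = 2 ^ 2 := by norm_num
      _ ≤ 2 ^ (n - 1) := Nat.pow_le_pow_right (by norm_num) (by omega)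
  have h1 := Nat.four_pow_lt_mul_centralBinom N hN4
  have h2 := centralBinom_le_count N (by omega)
  have h3 : (Finset.Ioc N (2 * N)).filter Nat.Prime = primesP n := by
    ext p
    simp only [primesP, Finset.mem_filter, Finset.mem_Ioc, Finset.mem_Ioo, h2N]
    constructor
    · rintro ⟨⟨ha, hb⟩, hp⟩
      refine ⟨⟨ha, lt_of_le_of_ne hb ?_⟩, hp⟩
      rintro rfl
      exact Nat.Prime.not_prime_pow (by omega) hp
    · rintro ⟨⟨ha, hb⟩, hp⟩
      exact ⟨⟨ha, hb.le⟩, hp⟩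
  rw [h3] at h2
  have h2e : 2 * N / 3 = 2 ^ n / 3 := by rw [h2N]
  rw [h2N, ← h2e] at h2
  set C := (primesP n).card with hC
  have hs : Nat.sqrt (2 ^ n) ≤ 2 ^ ((n + 1) / 2) := by
    rw [← Nat.lt_succ_iff, Nat.sqrt_lt']
    calc 2 ^ n ≤ 2 ^ (2 * ((n + 1) / 2)) := Nat.pow_le_pow_right (by norm_num) (by omega)
      _ = (2 ^ ((n + 1) / 2)) ^ 2 := by rw [← pow_mul, mul_comm]
      _ < _ := Nat.pow_lt_pow_left (Nat.lt_succ_self _) (by norm_num)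
  set s := Nat.sqrt (2 ^ n) with hs'
  have h4 : 2 ^ (2 * N) < 2 ^ (n + n * s + 2 * (2 * N / 3) + n * C) := by
    calc 2 ^ (2 * N) = 4 ^ N := by rw [pow_mul]; norm_num
      _ < N * N.centralBinom := h1
      _ ≤ 2 ^ n * ((2 ^ n) ^ s * 4 ^ (2 * N / 3) * (2 ^ n) ^ C) :=
          Nat.mul_le_mul (by omega) h2
      _ = _ := by
        rw [pow_add, pow_add, pow_add, pow_mul 2 n s, pow_mul 2 n C, pow_mul 2 2]; norm_num; ring
  have h5 := (Nat.pow_lt_pow_iff_right (by norm_num : 1 < 2)).1 h4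
  have h6 : 3 * (n + n * s) ≤ N := by
    set h := (n + 1) / 2 with hh
    have a := aux_pow h (by omega)
    have b : 2 ^ (2 * h - 2) ≤ N := Nat.pow_le_pow_right (by norm_num) (by omega)
    have c : 4 * 2 ^ (2 * h - 2) = 2 ^ h * 2 ^ h := by
      rw [show (4 : ℕ) = 2 ^ 2 by norm_num, ← pow_add, ← pow_add]; congr 1; omega
    have d : n + n * s ≤ 2 * h * (2 * 2 ^ h) := by
      have : 1 ≤ 2 ^ h := Nat.one_le_two_pow
      calc n + n * s = n * (1 + s) := by ring
        _ ≤ 2 * h * (2 * 2 ^ h) := Nat.mul_le_mul (by omega) (by omega)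
    nlinarith
  have h7 : 3 * n * C = 3 * (n * C) := by ring
  omega

lemma asym (c : ℝ) (hc : 0 < c) : ∃ n0 : ℕ, ∀ n : ℕ, n0 ≤ n →
    ((Nat.log 2 n + 5 : ℕ) : ℝ) ^ 3 * √n ≤ c * n := by
  have h1 := (Real.isLittleO_pow_log_id_atTop (n := 3)).bound
    (show (0 : ℝ) < c / 14 ^ 3 by positivity)
  have h2 : Filter.Tendsto (fun n : ℕ => √(n : ℝ)) Filter.atTop Filter.atTop :=
    Real.tendsto_sqrt_atTop.comp tendsto_natCast_atTop_atTop
  obtain ⟨n0, h0⟩ := Filter.eventually_atTop.1 (h2.eventually h1)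
  refine ⟨max n0 3, fun n hn => ?_⟩
  have hn3 : 3 ≤ n := le_trans (le_max_right _ _) hn
  have h3 := h0 n (le_trans (le_max_left _ _) hn)
  have hn3' : (3 : ℝ) ≤ n := by exact_mod_cast hn3
  have hlog : 1 ≤ Real.log n := by
    rw [Real.le_log_iff_exp_le (by linarith)]
    have := Real.exp_one_lt_d9
    linarith
  have hsl : Real.log n = 2 * Real.log (√n) := by
    rw [Real.log_sqrt (by linarith)]; ring
  have hD : ((Nat.log 2 n + 5 : ℕ) : ℝ) ≤ 14 * Real.log (√n) := by
    have e : (Nat.log 2 n : ℝ) * Real.log 2 ≤ Real.log n := by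
      rw [← Real.log_pow]
      apply Real.log_le_log (by positivity)
      exact_mod_cast Nat.pow_log_le_self 2 (by omega)
    have := Real.log_two_gt_d9
    have h0 : (0 : ℝ) ≤ Nat.log 2 n := by positivity
    push_cast
    nlinarith
  simp only [id, Real.norm_eq_abs] at h3
  rw [abs_of_nonneg (Real.sqrt_nonneg _)] at h3
  have h4 := (le_abs_self _).trans h3
  have hs : √(n : ℝ) * √n = n := Real.mul_self_sqrt (by linarith)
  calc ((Nat.log 2 n + 5 : ℕ) : ℝ) ^ 3 * √n ≤ (14 * Real.log (√n)) ^ 3 * √n := by gcongr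
    _ = 14 ^ 3 * (Real.log (√n)) ^ 3 * √n := by ring
    _ ≤ 14 ^ 3 * (c / 14 ^ 3 * √n) * √n := by gcongr
    _ = c * (√n * √n) := by ring
    _ = c * n := by rw [hs]

lemma sparse_count (k D W : ℕ) (hk : k ≤ 2 ^ D) :
    (((Finset.range (2 ^ k)).filter (fun s => wt s ≤ W)).card : ℝ) ≤ 4 * 2 ^ (D * W) := by
  set S := (Finset.range (2 ^ k)).filter (fun s => wt s ≤ W) with hS
  set z : ℝ := (2 ^ D)⁻¹ with hz
  have hz0 : 0 < z := by positivity
  have hz1 : z ≤ 1 := inv_le_one_of_one_le₀ (one_le_pow₀ (by norm_num))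
  have h1 : (S.card : ℝ) * z ^ W ≤ (1 + z) ^ k := by
    rw [← wt_gen, ← nsmul_eq_mul]
    refine (Finset.card_nsmul_le_sum S (fun s => z ^ wt s) _ ?_).trans
      (Finset.sum_le_sum_of_subset_of_nonneg (Finset.filter_subset _ _)
        (fun _ _ _ => by positivity))
    intro s hs
    exact pow_le_pow_of_le_one hz0.le hz1 (Finset.mem_filter.1 hs).2
  have h2 : (1 + z) ^ k ≤ 4 := by
    have a : 1 + z ≤ Real.exp z := by have := Real.add_one_le_exp z; linarith
    have b : (k : ℝ) * z ≤ 1 := by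
      rw [hz, ← div_eq_mul_inv, div_le_one (by positivity)]
      exact_mod_cast hk
    calc (1 + z) ^ k ≤ (Real.exp z) ^ k := by gcongr
      _ = Real.exp (k * z) := by rw [← Real.exp_nat_mul]
      _ ≤ Real.exp 1 := Real.exp_le_exp.2 b
      _ ≤ 4 := by have := Real.exp_one_lt_d9; linarith
  have h3 : z ^ W * 2 ^ (D * W) = 1 := by
    rw [hz, pow_mul, ← mul_pow, inv_mul_cancel₀ (by positivity), one_pow]
  calc (S.card : ℝ) = (S.card * z ^ W) * 2 ^ (D * W) := by rw [mul_assoc, h3, mul_one]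
    _ ≤ 4 * 2 ^ (D * W) := by
      apply mul_le_mul_of_nonneg_right (h1.trans h2); positivity

lemma bad_count (m : ℕ) (H l : ℝ) (hl : 0 ≤ l) :
    (((Finset.range (2 ^ m)).filter (fun s => H ≤ (wt s : ℝ))).card : ℝ)
      ≤ 2 ^ m * Real.exp ((l / 2 + l ^ 2 / 8) * m - l * H) := by
  set S := (Finset.range (2 ^ m)).filter (fun s => H ≤ (wt s : ℝ)) with hS
  have h1 : (S.card : ℝ) * Real.exp (l * H) ≤ (1 + Real.exp l) ^ m := by
    rw [← wt_gen, ← nsmul_eq_mul]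
    refine (Finset.card_nsmul_le_sum S (fun s => Real.exp l ^ wt s) _ ?_).trans
      (Finset.sum_le_sum_of_subset_of_nonneg (Finset.filter_subset _ _)
        (fun _ _ _ => by positivity))
    intro s hs
    rw [← Real.exp_nat_mul, mul_comm l]
    apply Real.exp_le_exp.2
    exact mul_le_mul_of_nonneg_right (Finset.mem_filter.1 hs).2 hl
  have h2 : 1 + Real.exp l ≤ 2 * Real.exp (l / 2 + l ^ 2 / 8) := by
    have e1 : 1 + Real.exp l = 2 * Real.exp (l / 2) * Real.cosh (l / 2) := by
      rw [Real.cosh_eq]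
      have a1 : Real.exp l = Real.exp (l / 2) * Real.exp (l / 2) := by
        rw [← Real.exp_add]; congr 1; ring
      have a3 : Real.exp (l / 2) * Real.exp (-(l / 2)) = 1 := by rw [← Real.exp_add]; simp
      rw [a1]; linear_combination -a3
    rw [e1, Real.exp_add, mul_assoc]
    have := Real.cosh_le_exp_half_sq (l / 2)
    rw [show (l / 2) ^ 2 / 2 = l ^ 2 / 8 by ring] at this
    gcongr
  have h3 : (1 + Real.exp l) ^ m ≤ 2 ^ m * Real.exp ((l / 2 + l ^ 2 / 8) * m) := by
    calc (1 + Real.exp l) ^ m ≤ (2 * Real.exp (l / 2 + l ^ 2 / 8)) ^ m := by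
          have := Real.exp_pos l
          gcongr
      _ = _ := by rw [mul_pow, ← Real.exp_nat_mul, mul_comm (m : ℝ)]
  rw [Real.exp_sub, ← mul_div_assoc, le_div_iff₀ (Real.exp_pos _)]
  exact h1.trans h3

lemma split_primes (n : ℕ) (hn : 17 ≤ n) : ∃ P1 P2 : Finset ℕ, P1 ⊆ primesP n ∧ P2 ⊆ primesP n ∧
    Disjoint P1 P2 ∧ 2 ^ (n - 1) ≤ 9 * n * P1.card ∧ 2 ^ (n - 1) ≤ 9 * n * P2.card := by
  classical
  have h := primes_count n hn
  have h2 : 2 ≤ (primesP n).card := by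
    by_contra hc
    have a := aux_pow (n - 1) (by omega)
    have : 3 * n * (primesP n).card ≤ 3 * n * 1 := Nat.mul_le_mul_left _ (by omega)
    omega
  obtain ⟨P1, hP1, hc⟩ := Finset.exists_subset_card_eq
    (show (primesP n).card / 2 ≤ (primesP n).card by omega)
  have hs := Finset.card_sdiff_of_subset hP1
  refine ⟨P1, primesP n \ P1, hP1, Finset.sdiff_subset, Finset.disjoint_sdiff, ?_, ?_⟩
  · refine h.trans ?_
    rw [show 9 * n * P1.card = 3 * n * (3 * P1.card) by ring]
    exact Nat.mul_le_mul_left _ (by omega)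
  · refine h.trans ?_
    rw [show 9 * n * (primesP n \ P1).card = 3 * n * (3 * (primesP n \ P1).card) by ring]
    exact Nat.mul_le_mul_left _ (by omega)

lemma shift_props (n D : ℕ) (hn : 17 ≤ n) (hD : 9 * n ≤ 2 ^ D) (P : Finset ℕ) (hP : P ⊆ primesP n)
    (hc : 2 ^ (n - 1) ≤ 9 * n * P.card) :
    (P.image (fun p => p - 2 ^ (n - 1))) ⊆ Finset.range (2 ^ (n - 1)) ∧
    (∀ u ∈ P.image (fun p => p - 2 ^ (n - 1)), u % 2 = 1) ∧
    2 ^ (n - 1) ≤ 2 ^ D * (P.image (fun p => p - 2 ^ (n - 1))).card ∧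
    (∀ u ∈ P.image (fun p => p - 2 ^ (n - 1)), u + 2 ^ (n - 1) ∈ P) := by
  have hp : ∀ p ∈ P, 2 ^ (n - 1) < p ∧ p < 2 ^ n ∧ p.Prime := by
    intro p h
    have := hP h
    simp only [primesP, Finset.mem_filter, Finset.mem_Ioo] at this
    tauto
  obtain ⟨k, rfl⟩ : ∃ k, n = k + 2 := ⟨n - 2, by omega⟩
  have hk : k + 2 - 1 = k + 1 := by omega
  rw [hk] at hc hp ⊢
  have h2 : 2 ^ (k + 2) = 2 * 2 ^ (k + 1) := by ring
  have h3 : 2 ^ (k + 1) = 2 * 2 ^ k := by ring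
  have h4 : 0 < 2 ^ k := by positivity
  refine ⟨?_, ?_, ?_, ?_⟩
  · intro u hu
    obtain ⟨p, h, rfl⟩ := Finset.mem_image.1 hu
    have := hp p h
    exact Finset.mem_range.2 (by omega)
  · intro u hu
    obtain ⟨p, h, rfl⟩ := Finset.mem_image.1 hu
    have := hp p h
    have : p % 2 = 1 := by
      rcases this.2.2.eq_two_or_odd with h | h
      · omega
      · exact h
    omega
  · rw [Finset.card_image_of_injOn]
    · exact hc.trans (Nat.mul_le_mul_right _ hD)
    · intro p h p' h' e
      have a := hp p h
      have b := hp p' h'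
      simp only at e
      omega
  · intro u hu
    obtain ⟨p, h, rfl⟩ := Finset.mem_image.1 hu
    have := hp p h
    rwa [Nat.sub_add_cancel this.1.le]

lemma final_numeric (ε : ℝ) (hε : 0 < ε) : ∃ n₀ : ℕ, ∀ n : ℕ, n₀ ≤ n → ∀ D T W E : ℕ,
    D = Nat.log 2 n + 5 → T = 3 * D * (Nat.sqrt n + 1) → W = 1 + D * T →
    E = 1 + D * (D + D + 2) →
    (E + 4 + D * W : ℝ) + ((ε / 2 + ε ^ 2 / 8) * (n + 1) - ε * ((1 / 2 + ε) * n - W)) < 0 := by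
  obtain ⟨n0, h0⟩ := asym (ε ^ 2 / (2 * (16 + 8 * ε + ε ^ 2))) (by positivity)
  refine ⟨max n0 1, ?_⟩
  rintro n hn D T W E hD rfl rfl rfl
  have h1 := h0 n (le_trans (le_max_left _ _) hn)
  rw [← hD] at h1
  have hn1 : (1 : ℝ) ≤ n := by exact_mod_cast le_trans (le_max_right _ _) hn
  have hD1 : (5 : ℝ) ≤ D := by rw [hD]; push_cast; linarith [Nat.cast_nonneg (α := ℝ) (Nat.log 2 n)]
  have hs : (Nat.sqrt n : ℝ) ≤ √n := Real.nat_sqrt_le_real_sqrt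
  have hs1 : 1 ≤ √(n : ℝ) := Real.one_le_sqrt.2 hn1
  set x := √(n : ℝ) with hx
  set d : ℝ := (D : ℝ) with hd
  have hd2 : 25 ≤ d ^ 2 := by nlinarith
  have hd3 : 5 * d ^ 2 ≤ d ^ 3 := by nlinarith
  have hd4 : d ^ 3 ≤ d ^ 3 * x := by nlinarith [pow_pos (show 0 < d by linarith) 3]
  have hd5 : d ^ 2 ≤ d ^ 2 * x := by nlinarith
  have hd6 : 5 * (d ^ 2 * x) ≤ d ^ 3 * x := by nlinarith
  have w : ((1 + D * (3 * D * (Nat.sqrt n + 1)) : ℕ) : ℝ) ≤ 7 * (d ^ 2 * x) := by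
    push_cast
    have : d ^ 2 * (Nat.sqrt n : ℝ) ≤ d ^ 2 * x := by gcongr
    nlinarith
  set W : ℝ := ((1 + D * (3 * D * (Nat.sqrt n + 1)) : ℕ) : ℝ) with hW
  have dw : d * W ≤ 7 * (d ^ 3 * x) := by
    have := mul_le_mul_of_nonneg_left w (show 0 ≤ d by linarith)
    nlinarith
  have e : ((1 + D * (D + D + 2) : ℕ) : ℝ) + 4 ≤ 9 * (d ^ 3 * x) := by
    push_cast
    nlinarith
  set q := d ^ 3 * x with hq
  have hq1 : 1 ≤ q := by nlinarith
  have tot : (((1 + D * (D + D + 2) : ℕ) : ℝ) + 4 + d * W) + (ε / 2 + ε ^ 2 / 8) + ε * W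
      ≤ (16 + 8 * ε + ε ^ 2) * q := by
    have a1 : ε * W ≤ ε * (7 * q) := by
      apply mul_le_mul_of_nonneg_left _ hε.le; nlinarith
    have a2 : ε ≤ ε * q := by nlinarith
    have a3 : ε ^ 2 ≤ ε ^ 2 * q := by nlinarith [sq_nonneg ε]
    have a4 := sq_nonneg ε
    nlinarith
  have h2 : (16 + 8 * ε + ε ^ 2) * q ≤ ε ^ 2 / 2 * n := by
    have := mul_le_mul_of_nonneg_left h1 (show 0 ≤ 16 + 8 * ε + ε ^ 2 by positivity)
    refine this.trans (le_of_eq ?_)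
    field_simp
  have h3 : 0 < ε ^ 2 * n := by positivity
  nlinarith

/-- For every `ε > 0`, for all sufficiently large `n` there exist distinct primes
`p, ℓ ∈ 𝒫 n` such that `M = p·ℓ` has at most `(1/2 + ε)·n` nonzero binary digits. -/
theorem exists_sparse_rsa_modulus :
    ∀ ε : ℝ, 0 < ε → ∃ n₀ : ℕ, ∀ n : ℕ, n₀ ≤ n →
      ∃ p ℓ : ℕ, p ∈ primesP n ∧ ℓ ∈ primesP n ∧ p ≠ ℓ ∧
        ((Nat.digits 2 (p * ℓ)).count 1 : ℝ) ≤ (1/2 + ε) * n := by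
  classical
  intro ε hε
  obtain ⟨n0, hnum⟩ := final_numeric ε hε
  refine ⟨max n0 17, fun n hn => ?_⟩
  have hn17 : 17 ≤ n := le_trans (le_max_right _ _) hn
  obtain ⟨D, hD⟩ : ∃ D, D = Nat.log 2 n + 5 := ⟨_, rfl⟩
  obtain ⟨T, hT⟩ : ∃ T, T = 3 * D * (Nat.sqrt n + 1) := ⟨_, rfl⟩
  obtain ⟨W, hW⟩ : ∃ W, W = 1 + D * T := ⟨_, rfl⟩
  obtain ⟨E, hE⟩ : ∃ E, E = 1 + D * (D + D + 2) := ⟨_, rfl⟩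
  have neg := hnum n (le_trans (le_max_left _ _) hn) D T W E hD hT hW hE
  have h9 : 9 * n ≤ 2 ^ D := by
    have := Nat.lt_pow_succ_log_self (b := 2) (by norm_num) n
    rw [hD, show Nat.log 2 n + 5 = (Nat.log 2 n).succ + 4 by omega, pow_add]
    omega
  obtain ⟨P1, P2, hP1, hP2, hdis, hc1, hc2⟩ := split_primes n hn17
  obtain ⟨u1, u2, u3, u4⟩ := shift_props n D hn17 h9 P1 hP1 hc1
  obtain ⟨v1, v2, v3, v4⟩ := shift_props n D hn17 h9 P2 hP2 hc2
  set U := P1.image (fun p => p - 2 ^ (n - 1))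
  set V := P2.image (fun p => p - 2 ^ (n - 1))
  have hTT : n * (2 * (D + D) + 1) ≤ T ^ 2 := by
    have a : n ≤ (Nat.sqrt n + 1) ^ 2 := by
      have := Nat.lt_succ_sqrt n
      rw [sq]; exact this.le
    have b : 2 * (D + D) + 1 ≤ (3 * D) ^ 2 := by
      have : 5 ≤ D := by omega
      nlinarith
    calc n * (2 * (D + D) + 1) ≤ (Nat.sqrt n + 1) ^ 2 * (3 * D) ^ 2 := Nat.mul_le_mul a b
      _ = T ^ 2 := by rw [hT]; ring
  have main := main_rec T n (by omega) D (n - 1) D U V (by omega) (by omega) hTT u1 v1 u2 v2 u3 v3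
  rw [← hE, ← hW] at main
  set Z := (U ×ˢ V).filter (fun z => wt (z.1 * z.2 % 2 ^ (n - 1)) ≤ W) with hZ
  by_contra hcon
  have hbig : ∀ p ∈ P1, ∀ q ∈ P2, (1 / 2 + ε) * n < (wt (p * q) : ℝ) := by
    intro p hp q hq
    by_contra hle
    refine hcon ⟨p, q, hP1 hp, hP2 hq, ?_, not_lt.1 hle⟩
    rintro rfl
    exact Finset.disjoint_left.1 hdis hp hq
  have prime_of : ∀ p ∈ primesP n, p.Prime ∧ p < 2 ^ n := by
    intro p hp
    simp only [primesP, Finset.mem_filter, Finset.mem_Ioo] at hp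
    tauto
  set S := (Finset.range (2 ^ (n - 1))).filter (fun s => wt s ≤ W) with hS
  set B := (Finset.range (2 ^ (n + 1))).filter
    (fun s => (1 / 2 + ε) * n - W ≤ (wt s : ℝ)) with hB
  have hcard : Z.card ≤ S.card * B.card := by
    rw [← Finset.card_product]
    apply Finset.card_le_card_of_injOn (fun z =>
      (((z.1 + 2 ^ (n - 1)) * (z.2 + 2 ^ (n - 1))) % 2 ^ (n - 1),
        ((z.1 + 2 ^ (n - 1)) * (z.2 + 2 ^ (n - 1))) / 2 ^ (n - 1)))
    · rintro ⟨u, v⟩ hz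
      obtain ⟨huv, hw⟩ := Finset.mem_filter.1 (Finset.mem_coe.1 hz)
      obtain ⟨hu, hv⟩ := Finset.mem_product.1 huv
      simp only at hu hv hw
      have hmod : (u + 2 ^ (n - 1)) * (v + 2 ^ (n - 1)) % 2 ^ (n - 1) = u * v % 2 ^ (n - 1) := by
        rw [Nat.mul_mod, Nat.add_mod_right, Nat.add_mod_right, ← Nat.mul_mod]
      have hb := hbig _ (u4 u hu) _ (v4 v hv)
      have hsp := wt_mod_add_div (n - 1) ((u + 2 ^ (n - 1)) * (v + 2 ^ (n - 1)))
      rw [hmod] at hsp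
      refine Finset.mem_coe.2 (Finset.mem_product.2 ⟨Finset.mem_filter.2 ⟨?_, ?_⟩,
        Finset.mem_filter.2 ⟨?_, ?_⟩⟩)
      · exact Finset.mem_range.2 (Nat.mod_lt _ (by positivity))
      · simp only; rw [hmod]; exact hw
      · refine Finset.mem_range.2 (Nat.div_lt_of_lt_mul ?_)
        have a := (prime_of _ (hP1 (u4 u hu))).2
        have b := (prime_of _ (hP2 (v4 v hv))).2
        calc (u + 2 ^ (n - 1)) * (v + 2 ^ (n - 1)) < 2 ^ n * 2 ^ n :=
              Nat.mul_lt_mul'' a b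
          _ = 2 ^ (n - 1) * 2 ^ (n + 1) := by rw [← pow_add, ← pow_add]; congr 1; omega
      · simp only
        rw [hsp] at hb
        push_cast at hb
        have : (wt (u * v % 2 ^ (n - 1)) : ℝ) ≤ W := by exact_mod_cast hw
        linarith
    · rintro ⟨u, v⟩ hz ⟨u', v'⟩ hz' h
      obtain ⟨huv, _⟩ := Finset.mem_filter.1 (Finset.mem_coe.1 hz)
      obtain ⟨hu, hv⟩ := Finset.mem_product.1 huv
      obtain ⟨huv', _⟩ := Finset.mem_filter.1 (Finset.mem_coe.1 hz')
      obtain ⟨hu', hv'⟩ := Finset.mem_product.1 huv'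
      simp only at hu hv hu' hv'
      simp only [Prod.mk.injEq] at h
      have hu := u4 u hu
      have hv := v4 v hv
      have hu' := u4 u' hu'
      have hv' := v4 v' hv'
      have hM : (u + 2 ^ (n - 1)) * (v + 2 ^ (n - 1)) =
          (u' + 2 ^ (n - 1)) * (v' + 2 ^ (n - 1)) := by
        rw [← Nat.mod_add_div ((u + 2 ^ (n - 1)) * (v + 2 ^ (n - 1))) (2 ^ (n - 1)), h.1, h.2,
          Nat.mod_add_div]
      have p1 := (prime_of _ (hP1 hu)).1
      have p2 := (prime_of _ (hP1 hu')).1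
      have p3 := (prime_of _ (hP2 hv')).1
      have hdv : (u + 2 ^ (n - 1)) ∣ (u' + 2 ^ (n - 1)) * (v' + 2 ^ (n - 1)) :=
        ⟨_, hM.symm⟩
      have huu : u + 2 ^ (n - 1) = u' + 2 ^ (n - 1) := by
        rcases (Nat.Prime.dvd_mul p1).1 hdv with h | h
        · exact (Nat.prime_dvd_prime_iff_eq p1 p2).1 h
        · have := (Nat.prime_dvd_prime_iff_eq p1 p3).1 h
          rw [this] at hu
          exact absurd hv' (Finset.disjoint_left.1 hdis hu)
      rw [huu] at hM
      have hvv := Nat.eq_of_mul_eq_mul_left p2.pos hM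
      simp only [Prod.mk.injEq]
      omega
  have b1 := sparse_count (n - 1) D W (by omega)
  have b2 := bad_count (n + 1) ((1 / 2 + ε) * n - W) ε hε.le
  rw [← hS] at b1
  rw [← hB] at b2
  push_cast at b2
  set Y := (ε / 2 + ε ^ 2 / 8) * ((n : ℝ) + 1) - ε * ((1 / 2 + ε) * n - W) with hY
  have c1 : (2 : ℝ) ^ (n - 1) ≤ 2 ^ E * ((4 * 2 ^ (D * W)) * (2 ^ (n + 1) * Real.exp Y)) := by
    have a1 : (2 : ℝ) ^ (n - 1) ≤ 2 ^ E * (Z.card : ℝ) := by exact_mod_cast main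
    have a2 : (Z.card : ℝ) ≤ S.card * B.card := by exact_mod_cast hcard
    refine a1.trans (mul_le_mul_of_nonneg_left (a2.trans ?_) (by positivity))
    exact mul_le_mul b1 b2 (by positivity) (by positivity)
  have c2 : (2 : ℝ) ^ E * ((4 * 2 ^ (D * W)) * (2 ^ (n + 1) * Real.exp Y))
      = 2 ^ (n - 1) * (2 ^ (E + 4 + D * W) * Real.exp Y) := by
    have : (2 : ℝ) ^ (n + 1) = 2 ^ (n - 1) * 4 := by
      rw [show n + 1 = (n - 1) + 2 by omega, pow_add]; norm_num
    rw [this, pow_add, pow_add]; ring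
  rw [c2] at c1
  have c3 : (1 : ℝ) ≤ 2 ^ (E + 4 + D * W) * Real.exp Y :=
    le_of_mul_le_mul_left (by rwa [mul_one]) (show (0 : ℝ) < 2 ^ (n - 1) by positivity)
  have c4 : (2 : ℝ) ^ (E + 4 + D * W) ≤ Real.exp ((E + 4 + D * W : ℝ)) := by
    have h2 : (2 : ℝ) ≤ Real.exp 1 := by have := Real.add_one_le_exp (1 : ℝ); linarith
    calc (2 : ℝ) ^ (E + 4 + D * W) ≤ (Real.exp 1) ^ (E + 4 + D * W) := by gcongr
      _ = _ := by rw [← Real.exp_nat_mul, mul_one]; push_cast; rfl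
  have c5 : (1 : ℝ) ≤ Real.exp ((E + 4 + D * W : ℝ) + Y) := by
    rw [Real.exp_add]
    exact c3.trans (mul_le_mul_of_nonneg_right c4 (Real.exp_pos _).le)
  have c6 : Real.exp ((E + 4 + D * W : ℝ) + Y) < 1 := Real.exp_lt_one_iff.2 neg
  linarith
end
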